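/- For every integer d ≥ 1 there exists ε = ε(d) > 0 with the following property: if K is a field, F is a finite subset of GL_d(K) containing the identity and generating a subgroup which is not virtually solvable (equivalently, by the Tits alternative, non-amenable), Γ is any subgroup of GL_d(K) containing F, and f : Γ → ℂ satisfies Σ_{x∈Γ} |f(x)|² < ∞, then there exists σ ∈ F such that Σ_{x∈Γ} |f(σ⁻¹x) − f(x)|² ≥ ε · Σ_{x∈Γ} |f(x)|². -/

import Mathlib

section PartP8
set_option linter.unusedVariables false
open Module
open scoped Pointwise

namespace USG

/-! ### ALG lemma -/

section ALG

variable {K V B : Type*} [Field K] [IsAlgClosed K] [AddCommGroup V] [Module K V]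
  [FiniteDimensional K V] [Group B]

lemma abs_det_of_eigen (a : AbsoluteValue K ℝ) (T : End K V) (c : ℝ)
    (h : ∀ l, T.HasEigenvalue l → a l = c) : a (LinearMap.det T) = c ^ finrank K V := by
  have hs : T.charpoly.Splits := IsAlgClosed.splits _
  rw [End.det_eq_prod_roots_charpoly_of_splits hs, map_multiset_prod]
  have : T.charpoly.roots.map a = Multiset.replicate (finrank K V) c := by
    rw [Multiset.eq_replicate]
    constructor
    · rw [Multiset.card_map, ← hs.natDegree_eq_card_roots, LinearMap.charpoly_natDegree]
    · intro b hb
      obtain ⟨l, hl, rfl⟩ := Multiset.mem_map.1 hb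
      exact h l ((End.hasEigenvalue_iff_isRoot_charpoly _ _).2 (Polynomial.isRoot_of_mem_roots hl))
  rw [this, Multiset.prod_replicate]

lemma exists_eigen_mod (T : End K V) (s : Submodule K V) (hs : s ≠ ⊤) (hT : s ≤ s.comap T) :
    ∃ l : K, ∃ v : V, v ∉ s ∧ T v - l • v ∈ s := by
  have : Nontrivial (V ⧸ s) := Submodule.Quotient.nontrivial_iff.2 hs
  obtain ⟨l, hl⟩ := End.exists_eigenvalue (s.mapQ s T hT)
  obtain ⟨w, hw⟩ := hl.exists_hasEigenvector
  obtain ⟨v, rfl⟩ := s.mkQ_surjective w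
  refine ⟨l, v, ?_, ?_⟩
  · intro hv
    exact hw.2 (by simpa using hv)
  · have := hw.apply_eq_smul
    rw [← Submodule.Quotient.mk_eq_zero, Submodule.Quotient.mk_sub, sub_eq_zero]
    simpa using this

lemma eigen_of_eigen_mod (T : End K V) (s : Submodule K V) (hT : s ≤ s.comap T) (l : K) (v : V)
    (hv : v ∉ s) (h : T v - l • v ∈ s) : T.HasEigenvalue l := by
  by_contra hne
  have hker : LinearMap.ker (T - l • (1 : End K V)) = ⊥ := by
    rw [End.hasEigenvalue_iff, End.eigenspace_def] at hne
    simpa using hne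
  set S := T - l • (1 : End K V) with hS
  have hinj : Function.Injective S := LinearMap.ker_eq_bot.1 hker
  have hmap : s.map S ≤ s := by
    rintro _ ⟨x, hx, rfl⟩
    simp only [hS, LinearMap.sub_apply, LinearMap.smul_apply, Module.End.one_apply]
    exact s.sub_mem (hT hx) (s.smul_mem _ hx)
  have heq : s.map S = s := by
    apply Submodule.eq_of_le_of_finrank_eq hmap
    exact (LinearEquiv.finrank_eq (Submodule.equivMapOfInjective S hinj s)).symm
  have h2 : S v ∈ s.map S := by
    rw [heq]; simpa [hS, LinearMap.smul_apply, Module.End.one_apply] using h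
  obtain ⟨x, hx, hxv⟩ := h2
  exact hv (hinj hxv ▸ hx)

theorem alg_lemma (a : AbsoluteValue K ℝ) (ρ : B →* End K V)
    (hdet : ∀ g, LinearMap.det (ρ g) = 1) (Y : Submodule K V)
    (hfin : (Set.range fun g => Y.map (ρ g)).Finite) (hY : Y ≠ ⊤)
    (heq : ∀ g, Y.map (ρ g) = Y → ∀ l₁ l₂ v₁ v₂, v₁ ∉ Y → v₂ ∉ Y → ρ g v₁ - l₁ • v₁ ∈ Y →
      ρ g v₂ - l₂ • v₂ ∈ Y → a l₁ = a l₂)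
    (hspan : ∀ W : Submodule K V, (∀ x : B, W.map (ρ (x ^ (finrank K V).factorial)) ≤ W) →
      W = ⊥ ∨ W = ⊤) (g : B) (l : K) (hl : (ρ g).HasEigenvalue l) : a l = 1 := by
  classical
  have hmul : ∀ g h (s : Submodule K V), s.map (ρ (g * h)) = (s.map (ρ h)).map (ρ g) := by
    intro g h s
    rw [map_mul, ← Submodule.map_comp]; rfl
  have hone : ∀ s : Submodule K V, s.map (ρ 1) = s := by
    intro s; rw [map_one]; exact Submodule.map_id s
  have hinv : ∀ g v, ρ g (ρ g⁻¹ v) = v := by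
    intro g v
    rw [← Module.End.mul_apply, ← map_mul]; simp
  have hinv' : ∀ g v, ρ g⁻¹ (ρ g v) = v := by
    intro g v
    rw [← Module.End.mul_apply, ← map_mul]; simp
  set S : Set (Submodule K V) := Set.range fun g => Y.map (ρ g) with hS
  have hSinv : ∀ g, ∀ s ∈ S, s.map (ρ g) ∈ S := by
    rintro g _ ⟨h, rfl⟩
    exact ⟨g * h, hmul g h Y⟩
  have hYS : Y ∈ S := ⟨1, hone Y⟩
  have : Finite S := hfin
  let : MulAction B S :=
    { smul := fun g s => ⟨s.1.map (ρ g), hSinv g _ s.2⟩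
      one_smul := fun s => Subtype.ext (hone _)
      mul_smul := fun g h s => Subtype.ext (hmul g h _) }
  have hsmul : ∀ (g : B) (s : S), ((g • s : S) : Submodule K V) = s.1.map (ρ g) := fun _ _ => rfl
  set Γ₀ : Subgroup B := (MulAction.toPermHom B S).ker with hΓ
  have hΓmem : ∀ g, g ∈ Γ₀ ↔ ∀ s ∈ S, s.map (ρ g) = s := by
    intro g
    rw [hΓ, MonoidHom.mem_ker, Equiv.ext_iff]
    constructor
    · intro h s hs
      have := h ⟨s, hs⟩
      simpa [Subtype.ext_iff, hsmul] using this
    · intro h s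
      apply Subtype.ext
      simpa [hsmul] using h s.1 s.2
  have hStop : ∀ s ∈ S, s ≠ ⊤ := by
    rintro _ ⟨h, rfl⟩ htop
    apply hY
    have := congrArg (Submodule.map (ρ h⁻¹)) htop
    simp only [← hmul, inv_mul_cancel, hone] at this
    rw [this, Submodule.map_top, LinearMap.range_eq_top]
    exact fun v => ⟨ρ h v, hinv' h v⟩
  set r := finrank K (V ⧸ Y) with hr
  have hrpos : 0 < r := by
    have : Nontrivial (V ⧸ Y) := Submodule.Quotient.nontrivial_iff.2 hY
    exact finrank_pos
  have hSr : ∀ s ∈ S, finrank K (V ⧸ s) = r := by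
    rintro _ ⟨h, rfl⟩
    have h1 := Submodule.finrank_quotient_add_finrank (Y.map (ρ h))
    have h2 := Submodule.finrank_quotient_add_finrank Y
    have hinj : Function.Injective (ρ h) := Function.LeftInverse.injective (hinv' h)
    have h3 := LinearEquiv.finrank_eq (Submodule.equivMapOfInjective (ρ h) hinj Y)
    simp only at *
    omega
  have hle : ∀ s ∈ S, ∀ g ∈ Γ₀, s ≤ s.comap (ρ g) := by
    intro s hs g hg
    rw [← Submodule.map_le_iff_le_comap]
    exact ((hΓmem g).1 hg s hs).le
  -- equal moduli on every translate
  have heqS : ∀ s ∈ S, ∀ g ∈ Γ₀, ∀ l₁ l₂ v₁ v₂, v₁ ∉ s → v₂ ∉ s → ρ g v₁ - l₁ • v₁ ∈ s →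
      ρ g v₂ - l₂ • v₂ ∈ s → a l₁ = a l₂ := by
    rintro _ ⟨h, rfl⟩ g hg l₁ l₂ v₁ v₂ hv₁ hv₂ h₁ h₂
    have hmem : ∀ v, v ∈ Y.map (ρ h) ↔ ρ h⁻¹ v ∈ Y := by
      intro v
      constructor
      · rintro ⟨y, hy, rfl⟩; rw [hinv']; exact hy
      · intro hv; exact ⟨_, hv, hinv h v⟩
    simp only [hmem, map_sub, map_smul] at hv₁ hv₂ h₁ h₂
    have hg' : h⁻¹ * g * h ∈ Γ₀ := by
      have := (inferInstance : Γ₀.Normal).conj_mem g hg h⁻¹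
      simpa using this
    have hk : ∀ v, ρ (h⁻¹ * g * h) (ρ h⁻¹ v) = ρ h⁻¹ (ρ g v) := by
      intro v
      rw [map_mul, map_mul, Module.End.mul_apply, Module.End.mul_apply, hinv]
    refine heq (h⁻¹ * g * h) ((hΓmem _).1 hg' Y hYS) l₁ l₂ _ _ hv₁ hv₂ ?_ ?_
    · rw [hk]; exact h₁
    · rw [hk]; exact h₂
  -- the modulus homomorphisms
  have hν : ∀ s : S, ∃ ν : Γ₀ →* ℝ, ∀ (g : Γ₀) l v, v ∉ s.1 → ρ g v - l • v ∈ s.1 →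
      a l ^ r = ν g := by
    intro s
    let δ : Γ₀ →* ℝ :=
      { toFun := fun g => a (LinearMap.det (s.1.mapQ s.1 (ρ g) (hle s.1 s.2 g g.2)))
        map_one' := by
          have : s.1.mapQ s.1 (ρ (1 : Γ₀)) (hle s.1 s.2 _ (1 : Γ₀).2) = LinearMap.id := by
            ext v; simp
          rw [this, LinearMap.det_id, map_one]
        map_mul' := by
          intro g h
          have : s.1.mapQ s.1 (ρ (g * h : Γ₀)) (hle s.1 s.2 _ (g * h).2) =
            (s.1.mapQ s.1 (ρ g) (hle s.1 s.2 g g.2)).comp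
              (s.1.mapQ s.1 (ρ h) (hle s.1 s.2 h h.2)) := by
            ext v; simp
          rw [this, LinearMap.det_comp, map_mul] }
    refine ⟨δ, ?_⟩
    intro g l v hv h
    have := abs_det_of_eigen a (s.1.mapQ s.1 (ρ g) (hle s.1 s.2 g g.2)) (a l) (by
      intro l' hl'
      obtain ⟨w, hw⟩ := hl'.exists_hasEigenvector
      obtain ⟨v', rfl⟩ := s.1.mkQ_surjective w
      refine heqS s.1 s.2 g g.2 l' l v' v ?_ hv ?_ h
      · intro hv'
        exact hw.2 (by simpa using hv')
      · have := hw.apply_eq_smul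
        rw [← Submodule.Quotient.mk_eq_zero, Submodule.Quotient.mk_sub, sub_eq_zero]
        simpa using this)
    rw [hSr s.1 s.2] at this
    exact this.symm
  choose ν hν using hν
  have hev : ∀ (s : S) (g : Γ₀), ∃ l v, v ∉ s.1 ∧ ρ g v - l • v ∈ s.1 := fun s g =>
    exists_eigen_mod _ _ (hStop s.1 s.2) (hle s.1 s.2 g g.2)
  have hνpos : ∀ s g, 0 < ν s g := by
    intro s g
    have h1 : ν s g * ν s g⁻¹ = 1 := by rw [← map_mul]; simp
    obtain ⟨l, v, hv, h⟩ := hev s g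
    have h2 : 0 ≤ ν s g := by rw [← hν s g l v hv h]; exact pow_nonneg (a.nonneg _) _
    rcases h2.lt_or_eq with h3 | h3
    · exact h3
    · rw [← h3] at h1; simp at h1
  -- conjugation
  have hconj : ∀ (x : B) (s : S) (g : Γ₀),
      ν (x • s) ⟨x * g * x⁻¹, (inferInstance : Γ₀.Normal).conj_mem g g.2 x⟩ = ν s g := by
    intro x s g
    obtain ⟨l, v, hv, h⟩ := hev s g
    rw [← hν s g l v hv h]
    symm
    apply hν _ _ l (ρ x v)
    · rw [hsmul]
      rintro ⟨y, hy, hyv⟩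
      apply hv
      have := congrArg (ρ x⁻¹) hyv
      rw [hinv', hinv'] at this
      exact this ▸ hy
    · rw [hsmul]
      refine ⟨_, h, ?_⟩
      simp [hinv']
  have hcongr : ∀ (x : B) (s t : S), ν s = ν t → ν (x • s) = ν (x • t) := by
    intro x s t hst
    ext g
    have hg : x⁻¹ * g.1 * x ∈ Γ₀ := by
      have := (inferInstance : Γ₀.Normal).conj_mem g.1 g.2 x⁻¹
      simpa using this
    have e : g = ⟨x * (⟨x⁻¹ * g.1 * x, hg⟩ : Γ₀).1 * x⁻¹,
        (inferInstance : Γ₀.Normal).conj_mem _ hg x⟩ := Subtype.ext (by simp [mul_assoc])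
    rw [e, hconj, hconj, hst]
  -- an element separating the homs
  obtain ⟨g₀, hg₀⟩ : ∃ g₀ : Γ₀, ∀ s t : S, ν s g₀ = ν t g₀ → ν s = ν t := by
    by_contra! hcon
    have := Fintype.ofFinite S
    let H : S × S → Subgroup Γ₀ := fun p =>
      { carrier := {g | ν p.1 g = ν p.2 g}
        mul_mem' := by
          intro x y hx hy
          simp only [Set.mem_ofPred_eq, map_mul] at *
          rw [hx, hy]
        one_mem' := by simp
        inv_mem' := by
          intro x hx
          simp only [Set.mem_ofPred_eq] at *
          have h1 : ν p.1 x * ν p.1 x⁻¹ = 1 := by rw [← map_mul]; simp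
          have h2 : ν p.2 x * ν p.2 x⁻¹ = 1 := by rw [← map_mul]; simp
          rw [hx] at h1
          exact mul_left_cancel₀ (hνpos p.2 x).ne' (h1.trans h2.symm) }
    have hcov : ⋃ p ∈ (Finset.univ.filter fun p : S × S => ν p.1 ≠ ν p.2),
        (1 : Γ₀) • (H p : Set Γ₀) = Set.univ := by
      rw [Set.eq_univ_iff_forall]
      intro g
      obtain ⟨s, t, h1, h2⟩ := hcon g
      simp only [Set.mem_iUnion]
      refine ⟨(s, t), by simpa using h2, ?_⟩
      rw [one_smul]
      exact h1
    obtain ⟨p, hp, hfi⟩ := Subgroup.exists_finiteIndex_of_leftCoset_cover hcov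
    apply (Finset.mem_filter.1 hp).2
    ext g
    obtain ⟨n, hn, -, hmem⟩ := Subgroup.exists_pow_mem_of_index_ne_zero hfi.index_ne_zero g
    have : ν p.1 (g ^ n) = ν p.2 (g ^ n) := hmem
    rw [map_pow, map_pow] at this
    exact (pow_left_inj₀ (hνpos _ _).le (hνpos _ _).le hn.ne').1 this
  -- at most k homs
  set N := Set.range ν with hN
  have : Finite N := Set.finite_range ν
  have hcard : Nat.card N ≤ finrank K V := by
    have hroots : ∀ n : N, ∃ l ∈ (ρ g₀).charpoly.roots.toFinset, a l ^ r = n.1 g₀ := by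
      rintro ⟨_, s, rfl⟩
      obtain ⟨l, v, hv, h⟩ := hev s g₀
      refine ⟨l, ?_, hν s g₀ l v hv h⟩
      rw [Multiset.mem_toFinset, Polynomial.mem_roots (LinearMap.charpoly_monic _).ne_zero,
        ← End.hasEigenvalue_iff_isRoot_charpoly]
      exact eigen_of_eigen_mod _ _ (hle s.1 s.2 g₀ g₀.2) l v hv h
    choose φ hφ1 hφ2 using hroots
    have hinj : Function.Injective (fun n : N =>
        (⟨φ n, hφ1 n⟩ : {x // x ∈ (ρ g₀).charpoly.roots.toFinset})) := by
      rintro ⟨_, s, rfl⟩ ⟨_, t, rfl⟩ h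
      apply Subtype.ext
      apply hg₀
      rw [← hφ2 ⟨_, s, rfl⟩, ← hφ2 ⟨_, t, rfl⟩, show φ ⟨_, s, rfl⟩ = φ ⟨_, t, rfl⟩ from Subtype.ext_iff.1 h]
    calc Nat.card N ≤ Nat.card {x // x ∈ (ρ g₀).charpoly.roots.toFinset} :=
          Nat.card_le_card_of_injective _ hinj
      _ = (ρ g₀).charpoly.roots.toFinset.card := Nat.card_eq_fintype_card.trans (Fintype.card_coe _)
      _ ≤ Multiset.card (ρ g₀).charpoly.roots := Multiset.toFinset_card_le _
      _ ≤ (ρ g₀).charpoly.natDegree := Polynomial.card_roots' _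
      _ = finrank K V := LinearMap.charpoly_natDegree _
  choose σ hσ using (fun n : N => n.2)
  let : MulAction B N :=
    { smul := fun x n => ⟨ν (x • σ n), x • σ n, rfl⟩
      one_smul := by
        intro n; apply Subtype.ext
        show ν ((1 : B) • σ n) = n
        rw [one_smul, hσ]
      mul_smul := by
        intro x y n; apply Subtype.ext
        show ν ((x * y) • σ n) = ν (x • σ _)
        rw [mul_smul]
        apply hcongr
        rw [hσ]
        rfl }
  have hact : ∀ (x : B) (s : S), x • (⟨ν s, s, rfl⟩ : N) = ⟨ν (x • s), x • s, rfl⟩ := by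
    intro x s
    apply Subtype.ext
    show ν (x • σ _) = ν (x • s)
    apply hcongr
    rw [hσ]
  have hpow : ∀ (x : B) (s : S), ν (x ^ (finrank K V).factorial • s) = ν s := by
    intro x s
    have h1 : (MulAction.toPermHom B N x) ^ (finrank K V).factorial = 1 := by
      apply orderOf_dvd_iff_pow_eq_one.1
      refine (orderOf_dvd_natCard _).trans ?_
      rw [Nat.card_perm]
      exact Nat.factorial_dvd_factorial hcard
    rw [← map_pow] at h1
    have h2 := Equiv.ext_iff.1 h1 ⟨ν s, s, rfl⟩
    rw [MulAction.toPermHom_apply, MulAction.toPerm_apply, hact] at h2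
    exact Subtype.ext_iff.1 h2
  -- the intersection
  let s₀ : S := ⟨Y, hYS⟩
  let W : Submodule K V := ⨅ s : {s : S // ν s = ν s₀}, s.1.1
  have hWx : ∀ x : B, W.map (ρ (x ^ (finrank K V).factorial)) ≤ W := by
    intro x
    apply le_iInf
    rintro ⟨s, hs⟩
    have h1 : ν ((x⁻¹) ^ (finrank K V).factorial • s) = ν s₀ := by rw [hpow, hs]
    have h2 : W ≤ ((x⁻¹) ^ (finrank K V).factorial • s).1 :=
      iInf_le (fun s : {s : S // ν s = ν s₀} => s.1.1) ⟨_, h1⟩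
    refine (Submodule.map_mono h2).trans ?_
    rw [hsmul, ← hmul, inv_pow, mul_inv_cancel, hone]
  have hW : W = ⊥ := by
    rcases hspan W hWx with h | h
    · exact h
    · exfalso
      apply hY
      rw [eq_top_iff, ← h]
      exact iInf_le (fun s : {s : S // ν s = ν s₀} => s.1.1) ⟨s₀, rfl⟩
  have hmod : ∀ (g : Γ₀) l, (ρ g).HasEigenvalue l → a l ^ r = ν s₀ g := by
    intro g l hl
    obtain ⟨v, hv⟩ := hl.exists_hasEigenvector
    have : v ∉ W := by rw [hW]; simpa using hv.2
    simp only [W, Submodule.mem_iInf, not_forall] at this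
    obtain ⟨⟨s, hs⟩, hvs⟩ := this
    rw [← hs]
    apply hν s g l v hvs
    rw [hv.apply_eq_smul, sub_self]
    exact zero_mem _
  have hmod1 : ∀ (g : Γ₀) l, (ρ g).HasEigenvalue l → a l = 1 := by
    intro g l hl
    have h1 := abs_det_of_eigen a (ρ g) (a l) (by
      intro l' hl'
      exact (pow_left_inj₀ (a.nonneg _) (a.nonneg _) hrpos.ne').1
        ((hmod g l' hl').trans (hmod g l hl).symm))
    rw [hdet, map_one] at h1
    have hpos : finrank K V ≠ 0 := by
      intro h0
      have := finrank_zero_iff.1 h0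
      obtain ⟨v, hv⟩ := hl.exists_hasEigenvector
      exact hv.2 (Subsingleton.elim _ _)
    exact (pow_eq_one_iff_of_nonneg (a.nonneg _) hpos).1 h1.symm
  have hfi : Γ₀.FiniteIndex := by
    rw [hΓ]; infer_instance
  obtain ⟨n, hn, -, hmem⟩ := Subgroup.exists_pow_mem_of_index_ne_zero hfi.index_ne_zero g
  have h1 : (ρ (g ^ n)).HasEigenvalue (l ^ n) := by
    rw [map_pow]; exact hl.pow n
  have h2 := hmod1 ⟨g ^ n, hmem⟩ _ h1
  rw [map_pow] at h2
  exact (pow_eq_one_iff_of_nonneg (a.nonneg _) hn.ne').1 h2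

end ALG
end USG
end PartP8

section PartP7a
set_option linter.unusedVariables false
open Filter Topology

namespace USG

/-! ### Ultraproduct of valued fields -/

section Ultra

lemma exists_ulim (U : Ultrafilter ℕ) (f : ℕ → ℝ) (C : ℝ) (h : ∀ᶠ n in U, |f n| ≤ C) :
    ∃ x, Tendsto f U (𝓝 x) := by
  have hc : IsCompact (Set.Icc (-C) C) := isCompact_Icc
  have h1 : (U.map f : Filter ℝ) ≤ 𝓟 (Set.Icc (-C) C) := by
    rw [le_principal_iff]
    exact h.mono fun n hn => abs_le.1 hn
  obtain ⟨x, -, hx⟩ := hc.ultrafilter_le_nhds (U.map f) h1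
  exact ⟨x, hx⟩

variable (K : ℕ → Type) [∀ n, Field (K n)] (a : ∀ n, AbsoluteValue (K n) ℝ) (U : Ultrafilter ℕ)

/-- bounded sequences -/
def bdd : Subring (∀ n, K n) where
  carrier := {x | ∃ C, ∀ᶠ n in U, a n (x n) ≤ C}
  mul_mem' := by
    rintro x y ⟨C, hC⟩ ⟨D, hD⟩
    refine ⟨C * D, ?_⟩
    filter_upwards [hC, hD] with n h1 h2
    rw [Pi.mul_apply, map_mul]
    exact mul_le_mul h1 h2 ((a n).nonneg _) (((a n).nonneg _).trans h1)
  one_mem' := ⟨1, by simp⟩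
  add_mem' := by
    rintro x y ⟨C, hC⟩ ⟨D, hD⟩
    refine ⟨C + D, ?_⟩
    filter_upwards [hC, hD] with n h1 h2
    exact ((a n).add_le _ _).trans (add_le_add h1 h2)
  zero_mem' := ⟨0, by simp⟩
  neg_mem' := by
    rintro x ⟨C, hC⟩
    refine ⟨C, ?_⟩
    filter_upwards [hC] with n h1
    simpa using h1

lemma mem_bdd (x : ∀ n, K n) : x ∈ bdd K a U ↔ ∃ C, ∀ᶠ n in U, a n (x n) ≤ C := Iff.rfl

noncomputable def bval (x : bdd K a U) : ℝ := limUnder U fun n => a n (x.1 n)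

lemma bval_tendsto (x : bdd K a U) : Tendsto (fun n => a n (x.1 n)) U (𝓝 (bval K a U x)) := by
  obtain ⟨C, hC⟩ := x.2
  apply tendsto_nhds_limUnder
  apply exists_ulim U _ C
  filter_upwards [hC] with n hn
  rwa [abs_of_nonneg ((a n).nonneg _)]

lemma bval_eq (x : bdd K a U) (c : ℝ) (h : Tendsto (fun n => a n (x.1 n)) U (𝓝 c)) :
    bval K a U x = c := tendsto_nhds_unique (bval_tendsto K a U x) h

lemma bval_mul (x y : bdd K a U) : bval K a U (x * y) = bval K a U x * bval K a U y := by
  apply bval_eq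
  convert (bval_tendsto K a U x).mul (bval_tendsto K a U y) using 2
  simp

lemma bval_add (x y : bdd K a U) : bval K a U (x + y) ≤ bval K a U x + bval K a U y :=
  le_of_tendsto_of_tendsto' (bval_tendsto K a U (x + y))
    ((bval_tendsto K a U x).add (bval_tendsto K a U y)) fun n => (a n).add_le _ _

lemma bval_nonneg (x : bdd K a U) : 0 ≤ bval K a U x :=
  ge_of_tendsto' (bval_tendsto K a U x) fun n => (a n).nonneg _

def binf : Ideal (bdd K a U) where
  carrier := {x | bval K a U x = 0}
  add_mem' := by
    intro x y hx hy
    apply le_antisymm _ (bval_nonneg K a U _)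
    refine (bval_add K a U x y).trans ?_
    rw [show bval K a U x = 0 from hx, show bval K a U y = 0 from hy, add_zero]
  zero_mem' := bval_eq K a U 0 0 (by simp)
  smul_mem' := by
    intro c x hx
    show bval K a U (c * x) = 0
    rw [bval_mul, show bval K a U x = 0 from hx, mul_zero]

lemma mem_binf (x : bdd K a U) : x ∈ binf K a U ↔ bval K a U x = 0 := Iff.rfl

lemma binf_max : (binf K a U).IsMaximal := by
  rw [Ideal.isMaximal_iff]
  constructor
  · rw [mem_binf, bval_eq K a U 1 1 (by simp)]; exact one_ne_zero
  · intro J x hJ hx hxJ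
    rw [mem_binf] at hx
    have hpos : 0 < bval K a U x := lt_of_le_of_ne (bval_nonneg K a U x) (Ne.symm hx)
    have hev : ∀ᶠ n in U, bval K a U x / 2 < a n (x.1 n) :=
      (bval_tendsto K a U x).eventually_const_lt (half_lt_self hpos)
    let y : bdd K a U := ⟨fun n => (x.1 n)⁻¹, (bval K a U x / 2)⁻¹, by
      filter_upwards [hev] with n hn
      rw [map_inv₀]
      exact inv_anti₀ (half_pos hpos) hn.le⟩
    have h1 : y * x - 1 ∈ binf K a U := by
      rw [mem_binf]
      apply bval_eq
      apply tendsto_const_nhds.congr'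
      filter_upwards [hev] with n hn
      have : x.1 n ≠ 0 := by
        intro h0; rw [h0, map_zero] at hn; linarith [half_pos hpos]
      simp [y, this]
    have := J.sub_mem (J.mul_mem_left y hxJ) (hJ h1)
    simpa using this

theorem exists_ultra [∀ n, IsAlgClosed (K n)] :
    ∃ (L : Type) (_ : Field L) (_ : IsAlgClosed L) (b : AbsoluteValue L ℝ)
      (st : bdd K a U →+* L), Function.Surjective st ∧
      ∀ x : bdd K a U, Tendsto (fun n => a n (x.1 n)) U (𝓝 (b (st x))) := by
  classical
  have := binf_max K a U
  let fld : Field (bdd K a U ⧸ binf K a U) := Ideal.Quotient.field _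
  have hcongr : ∀ x y : bdd K a U, x - y ∈ binf K a U → bval K a U x ≤ bval K a U y := by
    intro x y h
    have := bval_add K a U (x - y) y
    rw [(mem_binf K a U _).1 h] at this
    simpa using this
  let bf : (bdd K a U ⧸ binf K a U) → ℝ := fun x =>
    bval K a U (Function.surjInv Ideal.Quotient.mk_surjective x)
  have hbf : ∀ x, bf (Ideal.Quotient.mk _ x) = bval K a U x := by
    intro x
    have h := Function.surjInv_eq Ideal.Quotient.mk_surjective (Ideal.Quotient.mk (binf K a U) x)
    apply le_antisymm
    · exact hcongr _ _ (Ideal.Quotient.eq.1 h)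
    · exact hcongr _ _ (Ideal.Quotient.eq.1 h.symm)
  let b : AbsoluteValue (bdd K a U ⧸ binf K a U) ℝ :=
    { toFun := bf
      map_mul' := by
        intro x y
        obtain ⟨x, rfl⟩ := Ideal.Quotient.mk_surjective x
        obtain ⟨y, rfl⟩ := Ideal.Quotient.mk_surjective y
        rw [← map_mul, hbf, hbf, hbf, bval_mul]
      nonneg' := fun x => bval_nonneg K a U _
      eq_zero' := by
        intro x
        obtain ⟨x, rfl⟩ := Ideal.Quotient.mk_surjective x
        show bf _ = 0 ↔ _
        rw [hbf, Ideal.Quotient.eq_zero_iff_mem, mem_binf]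
      add_le' := by
        intro x y
        obtain ⟨x, rfl⟩ := Ideal.Quotient.mk_surjective x
        obtain ⟨y, rfl⟩ := Ideal.Quotient.mk_surjective y
        show bf _ ≤ bf _ + bf _
        rw [← map_add, hbf, hbf, hbf]
        exact bval_add K a U x y }
  refine ⟨_, fld, ?_, b, Ideal.Quotient.mk _, Ideal.Quotient.mk_surjective, ?_⟩
  swap
  · intro x
    show Tendsto _ _ (𝓝 (bf _))
    rw [hbf]
    exact bval_tendsto K a U x
  apply IsAlgClosed.of_exists_root
  intro p hp hirr
  set d := p.natDegree with hd
  have hd0 : 0 < d := Polynomial.Monic.natDegree_pos_of_not_isUnit hp hirr.not_isUnit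
  choose c hc using fun i : ℕ => Ideal.Quotient.mk_surjective (I := binf K a U) (p.coeff i)
  -- roots at each level
  have hroot : ∀ n, ∃ z : K n, z ^ d + ∑ i ∈ Finset.range d, (c i).1 n * z ^ i = 0 := by
    intro n
    let P : Polynomial (K n) := Polynomial.X ^ d +
      ∑ i ∈ Finset.range d, Polynomial.C ((c i).1 n) * Polynomial.X ^ i
    have hdeg : P.degree = d := by
      have h2 : (∑ i ∈ Finset.range d, Polynomial.C ((c i).1 n) *
          (Polynomial.X : Polynomial (K n)) ^ i).degree < d := by
        refine (Polynomial.degree_sum_le _ _).trans_lt ?_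
        refine (Finset.sup_lt_iff (WithBot.bot_lt_coe d)).2 ?_
        intro i hi
        refine (Polynomial.degree_C_mul_X_pow_le _ _).trans_lt ?_
        exact WithBot.coe_lt_coe.2 (Finset.mem_range.1 hi)
      rw [Polynomial.degree_add_eq_left_of_degree_lt] <;> simp [h2]
    obtain ⟨z, hz⟩ := IsAlgClosed.exists_root P (by rw [hdeg]; exact_mod_cast hd0.ne')
    refine ⟨z, ?_⟩
    simpa [P, Polynomial.IsRoot.def, Polynomial.eval_finset_sum] using hz
  choose z hz using hroot
  have hzb : z ∈ bdd K a U := by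
    choose C hC using fun i => (c i).2
    refine ⟨1 + ∑ i ∈ Finset.range d, C i, ?_⟩
    have hev : ∀ᶠ n in U, ∀ i ∈ Finset.range d, a n ((c i).1 n) ≤ C i := by
      rw [Filter.eventually_all_finset]
      intro i _; exact hC i
    filter_upwards [hev] with n hn
    have hCn : ∀ i ∈ Finset.range d, 0 ≤ C i := fun i hi => ((a n).nonneg _).trans (hn i hi)
    have hsum : 0 ≤ ∑ i ∈ Finset.range d, C i := Finset.sum_nonneg hCn
    by_contra! hlt
    have h1 : 1 ≤ a n (z n) := by linarith
    have h2 : a n (z n) ^ d ≤ (∑ i ∈ Finset.range d, C i) * a n (z n) ^ (d - 1) := by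
      have : z n ^ d = - ∑ i ∈ Finset.range d, (c i).1 n * z n ^ i :=
        eq_neg_of_add_eq_zero_left (hz n)
      rw [← map_pow, this, AbsoluteValue.map_neg, Finset.sum_mul]
      refine ((a n).sum_le _ _).trans (Finset.sum_le_sum fun i hi => ?_)
      rw [map_mul, map_pow]
      have : i ≤ d - 1 := by have := Finset.mem_range.1 hi; omega
      exact mul_le_mul (hn i hi) (pow_le_pow_right₀ h1 this) (by positivity) (hCn i hi)
    have h3 : a n (z n) ^ d = a n (z n) * a n (z n) ^ (d - 1) := by
      rw [← pow_succ']; congr 1; omega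
    rw [h3] at h2
    have := le_of_mul_le_mul_right h2 (by positivity)
    linarith
  refine ⟨Ideal.Quotient.mk _ ⟨z, hzb⟩, ?_⟩
  rw [Polynomial.eval_eq_sum_range, Finset.sum_range_succ]
  have hlead : p.coeff p.natDegree = 1 := hp
  rw [hlead, one_mul]
  simp only [← hc, ← map_pow, ← map_mul, ← map_sum, ← map_add]
  rw [← hd, ← map_zero (Ideal.Quotient.mk (binf K a U))]
  congr 1
  apply Subtype.ext
  funext n
  have := hz n
  simpa [add_comm] using this

end Ultra
end USG
end PartP7a

section PartP7b
set_option linter.unusedVariables false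
set_option linter.unusedSectionVars false
open Filter Topology Module

namespace USG

/-! ### The limit system and heavy subspaces -/

abbrev XX (k : ℕ) (K : ℕ → Type) := Σ n, (Fin k → K n)

section Lim

variable {k : ℕ} {K : ℕ → Type} [∀ n, Field (K n)] {a : ∀ n, AbsoluteValue (K n) ℝ}
  {U : Ultrafilter ℕ}

def IsConeX (A : Set (XX k K)) : Prop :=
  ∀ p ∈ A, ∀ c : K p.1, c ≠ 0 → (⟨p.1, c • p.2⟩ : XX k K) ∈ A

def actX {B : Type*} [Group B] (γ : B →* ∀ n, Matrix.SpecialLinearGroup (Fin k) (K n)) (g : B)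
    (p : XX k K) : XX k K := ⟨p.1, (γ g p.1).1.mulVec p.2⟩

structure LimSys (a : ∀ n, AbsoluteValue (K n) ℝ) (U : Ultrafilter ℕ) {L : Type} [Field L]
    (b : AbsoluteValue L ℝ) (st : bdd K a U →+* L) (k : ℕ)
    (B : Type) [Group B] where
  γ : B →* ∀ n, Matrix.SpecialLinearGroup (Fin k) (K n)
  bd : ∀ g, ∃ C, ∀ n i j, a n ((γ g n).1 i j) ≤ C
  surj : Function.Surjective st
  lim : ∀ x : bdd K a U, Tendsto (fun n => a n (x.1 n)) U (𝓝 (b (st x)))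
  M : Set (XX k K) → ℝ
  nonneg : ∀ A, 0 ≤ M A
  add : ∀ A A', Disjoint A A' → M (A ∪ A') = M A + M A'
  univ : M Set.univ = 1
  mono : ∀ A A' : Set (XX k K), (∀ᶠ n in U, ∀ x, (⟨n, x⟩ : XX k K) ∈ A →
    (⟨n, x⟩ : XX k K) ∈ A') → M A ≤ M A'
  zero : M {p | p.2 = 0} = 0
  inv : ∀ g A, IsConeX A → M (actX γ g '' A) = M A

variable (a) in
noncomputable def nrm (p : XX k K) : ℝ := ∑ i, a p.1 (p.2 i)

noncomputable def evX (l : Fin k → bdd K a U) (p : XX k K) : K p.1 := ∑ i, (l i).1 p.1 * p.2 i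

def Nb (S : Finset (Fin k → bdd K a U)) (ε : ℝ) : Set (XX k K) :=
  {p | ∀ l ∈ S, a p.1 (evX l p) ≤ ε * nrm a p}

lemma nrm_nonneg (p : XX k K) : 0 ≤ nrm a p := Finset.sum_nonneg fun i _ => (a _).nonneg _

lemma mem_Nb (S : Finset (Fin k → bdd K a U)) (ε : ℝ) (p : XX k K) :
    p ∈ Nb S ε ↔ ∀ l ∈ S, a p.1 (evX l p) ≤ ε * nrm a p := Iff.rfl

lemma Nb_mono {S S' : Finset (Fin k → bdd K a U)} {ε ε' : ℝ} (hS : S ⊆ S') (hε : ε' ≤ ε) :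
    Nb S' ε' ⊆ Nb S ε := fun p hp l hl =>
  (hp l (hS hl)).trans (mul_le_mul_of_nonneg_right hε (nrm_nonneg p))

lemma evX_add (l l' : Fin k → bdd K a U) (p : XX k K) : evX (l + l') p = evX l p + evX l' p := by
  simp [evX, add_mul, Finset.sum_add_distrib]

lemma evX_sub (l l' : Fin k → bdd K a U) (p : XX k K) : evX (l - l') p = evX l p - evX l' p := by
  simp [evX, sub_mul, Finset.sum_sub_distrib]

lemma evX_smul (c : bdd K a U) (l : Fin k → bdd K a U) (p : XX k K) :
    evX (c • l) p = c.1 p.1 * evX l p := by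
  simp [evX, Finset.mul_sum, mul_assoc]

lemma nrm_smul (n : ℕ) (x : Fin k → K n) (c : K n) :
    nrm a (⟨n, c • x⟩ : XX k K) = a n c * nrm a (⟨n, x⟩ : XX k K) := by
  simp [nrm, Finset.mul_sum]

lemma evX_smulv (l : Fin k → bdd K a U) (n : ℕ) (x : Fin k → K n) (c : K n) :
    evX l (⟨n, c • x⟩ : XX k K) = c * evX l (⟨n, x⟩ : XX k K) := by
  simp only [evX, Finset.mul_sum, Pi.smul_apply, smul_eq_mul]
  exact Finset.sum_congr rfl fun i _ => by ring

lemma Nb_cone_iff (S : Finset (Fin k → bdd K a U)) (ε : ℝ) (n : ℕ) (x : Fin k → K n) (c : K n)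
    (hc : c ≠ 0) : (⟨n, c • x⟩ : XX k K) ∈ Nb S ε ↔ (⟨n, x⟩ : XX k K) ∈ Nb S ε := by
  have hpos : 0 < a n c := (a n).pos hc
  simp only [mem_Nb, nrm_smul, evX_smulv, map_mul]
  refine forall₂_congr fun l _ => ?_
  rw [mul_left_comm]
  exact mul_le_mul_iff_right₀ hpos

lemma evX_bound (l : Fin k → bdd K a U) (C : ℝ) (h : ∀ i, ∀ᶠ n in U, a n ((l i).1 n) ≤ C) :
    ∀ᶠ n in U, ∀ x, a n (evX l (⟨n, x⟩ : XX k K)) ≤ C * nrm a (⟨n, x⟩ : XX k K) := by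
  filter_upwards [Filter.eventually_all.2 h] with n hn x
  rw [nrm, Finset.mul_sum, evX]
  refine ((a n).sum_le _ _).trans (Finset.sum_le_sum fun i _ => ?_)
  rw [map_mul]
  exact mul_le_mul_of_nonneg_right (hn i) ((a n).nonneg _)

lemma evX_bdd (l : Fin k → bdd K a U) : ∃ C > 0,
    ∀ᶠ n in U, ∀ x, a n (evX l (⟨n, x⟩ : XX k K)) ≤ C * nrm a (⟨n, x⟩ : XX k K) := by
  choose C hC using fun i => (l i).2
  refine ⟨1 + ∑ i, |C i|, by positivity, evX_bound l _ fun i => ?_⟩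
  filter_upwards [hC i] with n hn
  have h1 : |C i| ≤ ∑ i, |C i| :=
    Finset.single_le_sum (fun i _ => abs_nonneg (C i)) (Finset.mem_univ i)
  linarith [le_abs_self (C i)]

end Lim

namespace LimSys

section

variable {k : ℕ} {K : ℕ → Type} [∀ n, Field (K n)] {a : ∀ n, AbsoluteValue (K n) ℝ}
  {U : Ultrafilter ℕ} {L : Type} [Field L] {b : AbsoluteValue L ℝ} {st : bdd K a U →+* L}
  {B : Type} [Group B] (D : LimSys a U b st k B)

lemma M_mono {A A' : Set (XX k K)} (h : A ⊆ A') : D.M A ≤ D.M A' :=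
  D.mono _ _ (Eventually.of_forall fun n x hx => h hx)

lemma M_union (A A' : Set (XX k K)) : D.M (A ∪ A') ≤ D.M A + D.M A' := by
  rw [← Set.union_sdiff_self, D.add _ _ Set.disjoint_sdiff_right]
  gcongr
  exact D.M_mono Set.sdiff_subset

lemma M_diff (A A' : Set (XX k K)) : D.M A - D.M (A ∩ A') ≤ D.M (A \ A') := by
  have := D.M_union (A ∩ A') (A \ A')
  rw [Set.inter_union_sdiff] at this
  linarith

lemma M_empty : D.M ∅ = 0 := by
  have := D.add ∅ ∅ (by simp)
  simp at this
  exact this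

lemma M_sum {ι : Type*} (T : Finset ι) (A : ι → Set (XX k K))
    (h : Set.PairwiseDisjoint (T : Set ι) A) : D.M (⋃ i ∈ T, A i) = ∑ i ∈ T, D.M (A i) := by
  classical
  induction T using Finset.induction_on with
  | empty => simp [D.M_empty]
  | insert i T hi ih =>
    rw [Finset.set_biUnion_insert, D.add, Finset.sum_insert hi, ih]
    · exact h.subset (by simp)
    · rw [Set.disjoint_iUnion₂_right]
      intro j hj
      exact h (by simp) (by simp [hj]) (by rintro rfl; exact hi hj)

lemma packing {ι : Type*} (T : Finset ι) (A : ι → Set (XX k K)) (δ : ℝ) (hδ : 0 < δ)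
    (h1 : ∀ i ∈ T, δ ≤ D.M (A i))
    (h2 : ∀ i ∈ T, ∀ j ∈ T, i ≠ j → D.M (A i ∩ A j) ≤ δ / (2 * T.card)) :
    T.card * (δ / 2) ≤ 1 := by
  classical
  let A' : ι → Set (XX k K) := fun i => A i \ ⋃ j ∈ T.erase i, A j
  have hd : Set.PairwiseDisjoint (T : Set ι) A' := by
    intro i hi j hj hij
    rw [Function.onFun, Set.disjoint_left]
    rintro p ⟨h1, h2⟩ ⟨h3, h4⟩
    apply h4
    simp only [Set.mem_iUnion]
    exact ⟨i, Finset.mem_erase.2 ⟨hij, hi⟩, h1⟩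
  have hun : ∀ (i : ι) (T' : Finset ι), D.M (A i ∩ ⋃ j ∈ T', A j) ≤ ∑ j ∈ T', D.M (A i ∩ A j) := by
    intro i T'
    induction T' using Finset.induction_on with
    | empty => simp [D.M_empty]
    | insert j T' hj ih =>
      rw [Finset.set_biUnion_insert, Finset.sum_insert hj, Set.inter_union_distrib_left]
      exact (D.M_union _ _).trans (by linarith)
  have h3 : ∀ i ∈ T, δ / 2 ≤ D.M (A' i) := by
    intro i hi
    have hc : (0 : ℝ) < T.card := by exact_mod_cast Finset.card_pos.2 ⟨i, hi⟩
    have h4 := D.M_diff (A i) (⋃ j ∈ T.erase i, A j)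
    have h5 : ∑ j ∈ T.erase i, D.M (A i ∩ A j) ≤ δ / 2 := by
      calc ∑ j ∈ T.erase i, D.M (A i ∩ A j) ≤ ∑ j ∈ T.erase i, δ / (2 * T.card) :=
            Finset.sum_le_sum fun j hj => h2 i hi j (Finset.mem_of_mem_erase hj)
              (Finset.ne_of_mem_erase hj).symm
        _ = (T.erase i).card * (δ / (2 * T.card)) := by simp
        _ ≤ T.card * (δ / (2 * T.card)) := by
            gcongr
            exact Finset.erase_subset _ _
        _ = δ / 2 := by field_simp
    linarith [h1 i hi, hun i (T.erase i)]
  calc (T.card : ℝ) * (δ / 2) = ∑ i ∈ T, δ / 2 := by simp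
    _ ≤ ∑ i ∈ T, D.M (A' i) := Finset.sum_le_sum h3
    _ = D.M (⋃ i ∈ T, A' i) := (D.M_sum T A' hd).symm
    _ ≤ D.M Set.univ := D.M_mono (Set.subset_univ _)
    _ = 1 := D.univ

lemma infinitesimal (D : LimSys a U b st k B) (l : Fin k → bdd K a U) (h : ∀ i, st (l i) = 0) (ε : ℝ) (hε : 0 < ε) :
    ∀ᶠ n in U, ∀ x, a n (evX l (⟨n, x⟩ : XX k K)) ≤ ε * nrm a (⟨n, x⟩ : XX k K) := by
  apply evX_bound
  intro i
  have := D.lim (l i)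
  rw [h i, map_zero] at this
  exact (this.eventually_lt_const hε).mono fun n hn => hn.le

/-- entries as bounded sequences -/
noncomputable def gE (g : B) (i j : Fin k) : bdd K a U := ⟨fun n => (D.γ g n).1 i j, by
    obtain ⟨C, hC⟩ := D.bd g
    exact ⟨C, Eventually.of_forall fun n => hC n i j⟩⟩

lemma gE_mul (g h : B) (i j : Fin k) : D.gE (g * h) i j = ∑ t, D.gE g i t * D.gE h t j := by
  apply Subtype.ext
  funext n
  simp only [AddSubmonoidClass.coe_finset_sum, Finset.sum_apply]
  change (D.γ (g * h) n).1 i j = ∑ t, (D.γ g n).1 i t * (D.γ h n).1 t j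
  rw [map_mul, Pi.mul_apply, Matrix.SpecialLinearGroup.coe_mul, Matrix.mul_apply]

lemma gE_one (i j : Fin k) : D.gE 1 i j = (1 : Matrix (Fin k) (Fin k) (bdd K a U)) i j := by
  apply Subtype.ext
  funext n
  change (D.γ 1 n).1 i j = _
  by_cases h : i = j <;> simp [Matrix.one_apply, h]

/-- matrices over bounded sequences -/
noncomputable def gO : B →* Matrix (Fin k) (Fin k) (bdd K a U) where
  toFun g := Matrix.of (D.gE g)
  map_one' := by
    ext i j : 1
    exact D.gE_one i j
  map_mul' := by
    intro g h
    ext i j : 1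
    rw [Matrix.mul_apply]
    exact D.gE_mul g h i j

/-- the limit representation -/
noncomputable def θ : B →* Matrix (Fin k) (Fin k) L :=
  (st.mapMatrix : Matrix (Fin k) (Fin k) (bdd K a U) →+* Matrix (Fin k) (Fin k) L).toMonoidHom.comp
    D.gO

lemma θ_apply (g : B) (i j : Fin k) : D.θ g i j = st (D.gO g i j) := rfl

lemma θ_eq (g : B) : D.θ g = (D.gO g).map st := rfl

/-- action on row vectors -/
noncomputable def ρ : B →* End L (Fin k → L) where
  toFun g := (D.θ g⁻¹).vecMulLinear
  map_one' := by ext; simp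
  map_mul' := by
    intro g h
    apply LinearMap.ext
    intro v
    simp [Matrix.vecMul_vecMul]

lemma ρ_apply (g : B) (v : Fin k → L) : D.ρ g v = Matrix.vecMul v (D.θ g⁻¹) := rfl

lemma evX_act (g : B) (l : Fin k → bdd K a U) (p : XX k K) :
    evX l (actX D.γ g p) = evX (Matrix.vecMul l (D.gO g)) p := by
  obtain ⟨n, x⟩ := p
  change ∑ i, (l i).1 n * (∑ j, (D.γ g n).1 i j * x j) =
    ∑ j, (∑ i, l i * D.gO g i j : bdd K a U).1 n * x j
  simp only [Finset.mul_sum]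
  rw [Finset.sum_comm]
  refine Finset.sum_congr rfl fun j _ => ?_
  have : (∑ i, l i * D.gO g i j : bdd K a U).1 n = ∑ i, (l i).1 n * (D.γ g n).1 i j := by
    simp only [AddSubmonoidClass.coe_finset_sum, Finset.sum_apply]
    rfl
  rw [this, Finset.sum_mul]
  exact Finset.sum_congr rfl fun i _ => by ring

lemma st_vecMul (l : Fin k → bdd K a U) (g : B) :
    (fun i => st (Matrix.vecMul l (D.gO g) i)) = Matrix.vecMul (fun i => st (l i)) (D.θ g) := by
  funext j
  simp [Matrix.vecMul, dotProduct, θ_apply]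

lemma nrm_act (g : B) : ∃ C > 0, ∀ p, nrm a (actX D.γ g p) ≤ C * nrm a p := by
  obtain ⟨C, hC⟩ := D.bd g
  refine ⟨k * |C| + 1, by positivity, fun p => ?_⟩
  have h1 : ∀ i, a p.1 (((D.γ g p.1).1.mulVec p.2) i) ≤ |C| * nrm a p := by
    intro i
    rw [Matrix.mulVec, dotProduct, nrm, Finset.mul_sum]
    refine ((a _).sum_le _ _).trans (Finset.sum_le_sum fun j _ => ?_)
    rw [map_mul]
    exact mul_le_mul_of_nonneg_right ((hC _ _ _).trans (le_abs_self C)) ((a _).nonneg _)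
  calc nrm a (actX D.γ g p) = ∑ i, a p.1 (((D.γ g p.1).1.mulVec p.2) i) := rfl
    _ ≤ ∑ i : Fin k, |C| * nrm a p := Finset.sum_le_sum fun i _ => h1 i
    _ = k * |C| * nrm a p := by simp [mul_assoc]
    _ ≤ _ := by
      have := nrm_nonneg (a := a) p
      nlinarith

lemma act_inv (g : B) (p : XX k K) : actX D.γ g⁻¹ (actX D.γ g p) = p := by
  obtain ⟨n, x⟩ := p
  have : ((D.γ g⁻¹) n).1 * ((D.γ g) n).1 = 1 := by
    rw [← Matrix.SpecialLinearGroup.coe_mul, ← Pi.mul_apply, ← map_mul]; simp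
  change (⟨n, ((D.γ g⁻¹) n).1.mulVec (((D.γ g) n).1.mulVec x)⟩ : XX k K) = ⟨n, x⟩
  rw [Matrix.mulVec_mulVec, this, Matrix.one_mulVec]

/-- lifts lie in Y -/
def Lifts (st : bdd K a U →+* L) (Y : Submodule L (Fin k → L)) (S : Finset (Fin k → bdd K a U)) :
    Prop := ∀ l ∈ S, (fun i => st (l i)) ∈ Y

def Heavy (Y : Submodule L (Fin k → L)) (δ : ℝ) : Prop :=
  ∀ S : Finset (Fin k → bdd K a U), Lifts st Y S → ∀ ε > 0, δ ≤ D.M (Nb S ε)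

lemma exists_lift (D : LimSys a U b st k B) (v : Fin k → L) :
    ∃ l : Fin k → bdd K a U, (fun i => st (l i)) = v :=
  ⟨fun i => (D.surj (v i)).choose, funext fun i => (D.surj (v i)).choose_spec⟩

lemma Nb_sup (D : LimSys a U b st k B) (Z₁ Z₂ : Submodule L (Fin k → L))
    (S : Finset (Fin k → bdd K a U)) (hS : Lifts st (Z₁ ⊔ Z₂) S) (ε : ℝ) (hε : 0 < ε) :
    ∃ S₁ S₂ : Finset (Fin k → bdd K a U), ∃ ε' > 0, Lifts st Z₁ S₁ ∧ Lifts st Z₂ S₂ ∧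
      ∀ᶠ n in U, ∀ x, (⟨n, x⟩ : XX k K) ∈ Nb S₁ ε' → (⟨n, x⟩ : XX k K) ∈ Nb S₂ ε' →
        (⟨n, x⟩ : XX k K) ∈ Nb S ε := by
  classical
  have h : ∀ l ∈ S, ∃ l₁ l₂ : Fin k → bdd K a U, (fun i => st (l₁ i)) ∈ Z₁ ∧
      (fun i => st (l₂ i)) ∈ Z₂ ∧ ∀ i, st ((l - (l₁ + l₂)) i) = 0 := by
    intro l hl
    obtain ⟨y, hy, z, hz, hyz⟩ := Submodule.mem_sup.1 (hS l hl)
    obtain ⟨l₁, h₁⟩ := D.exists_lift y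
    obtain ⟨l₂, h₂⟩ := D.exists_lift z
    refine ⟨l₁, l₂, h₁ ▸ hy, h₂ ▸ hz, fun i => ?_⟩
    have h1 := congrFun h₁ i
    have h2 := congrFun h₂ i
    have h3 := congrFun hyz i
    simp only [Pi.add_apply] at h3
    simp only [Pi.sub_apply, Pi.add_apply, map_sub, map_add, h1, h2, h3, sub_self]
  choose! f₁ f₂ hf₁ hf₂ hf using h
  refine ⟨S.image f₁, S.image f₂, ε / 3, by positivity, ?_, ?_, ?_⟩
  · intro l hl
    obtain ⟨l', hl', rfl⟩ := Finset.mem_image.1 hl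
    exact hf₁ l' hl'
  · intro l hl
    obtain ⟨l', hl', rfl⟩ := Finset.mem_image.1 hl
    exact hf₂ l' hl'
  · have hev : ∀ᶠ n in U, ∀ l ∈ S, ∀ x, a n (evX (l - (f₁ l + f₂ l)) (⟨n, x⟩ : XX k K)) ≤
        ε / 3 * nrm a (⟨n, x⟩ : XX k K) := by
      rw [Filter.eventually_all_finset]
      intro l hl
      exact D.infinitesimal _ (hf l hl) _ (by positivity)
    filter_upwards [hev] with n hn x h1 h2 l hl
    have e1 := hn l hl x
    have e2 := h1 _ (Finset.mem_image_of_mem f₁ hl)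
    have e3 := h2 _ (Finset.mem_image_of_mem f₂ hl)
    have : evX l (⟨n, x⟩ : XX k K) = evX (l - (f₁ l + f₂ l)) (⟨n, x⟩ : XX k K) +
        (evX (f₁ l) (⟨n, x⟩ : XX k K) + evX (f₂ l) (⟨n, x⟩ : XX k K)) := by
      rw [evX_sub, evX_add]; ring
    change a n _ ≤ _
    rw [this]
    have t1 := (a n).add_le (evX (l - (f₁ l + f₂ l)) (⟨n, x⟩ : XX k K))
      (evX (f₁ l) (⟨n, x⟩ : XX k K) + evX (f₂ l) (⟨n, x⟩ : XX k K))
    have t2 := (a n).add_le (evX (f₁ l) (⟨n, x⟩ : XX k K)) (evX (f₂ l) (⟨n, x⟩ : XX k K))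
    simp only at e1 e2 e3
    linarith

lemma Nb_span (D : LimSys a U b st k B) (l₀ : Fin k → bdd K a U)
    (S : Finset (Fin k → bdd K a U)) (hS : Lifts st (Submodule.span L {fun i => st (l₀ i)}) S)
    (ε : ℝ) (hε : 0 < ε) : ∃ ε' > 0,
      ∀ᶠ n in U, ∀ x, (⟨n, x⟩ : XX k K) ∈ Nb {l₀} ε' → (⟨n, x⟩ : XX k K) ∈ Nb S ε := by
  classical
  induction S using Finset.induction_on with
  | empty => exact ⟨1, one_pos, Eventually.of_forall fun n x _ l hl => by simp at hl⟩
  | insert l S hl ih =>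
    obtain ⟨ε₁, hε₁, h₁⟩ := ih fun l' hl' => hS l' (Finset.mem_insert_of_mem hl')
    obtain ⟨c, hc⟩ := Submodule.mem_span_singleton.1 (hS l (Finset.mem_insert_self _ _))
    obtain ⟨c, rfl⟩ := D.surj c
    obtain ⟨C, hC⟩ := c.2
    have hC' : 0 < |C| + 1 := by positivity
    refine ⟨min ε₁ (ε / 2 / (|C| + 1)), lt_min hε₁ (by positivity), ?_⟩
    have hinf := D.infinitesimal (l - c • l₀) (by
      intro i
      have := congrFun hc i
      simp only [Pi.smul_apply, smul_eq_mul] at this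
      simp [this]) (ε / 2) (by positivity)
    filter_upwards [h₁, hinf, hC] with n h1 h2 h3 x hx
    have hx1 := Nb_mono (le_refl _) (min_le_left _ _) hx
    have hx2 := Nb_mono (le_refl _) (min_le_right _ _) hx
    intro l' hl'
    rcases Finset.mem_insert.1 hl' with rfl | hl'
    · have e1 := h2 x
      have e2 := hx2 l₀ (Finset.mem_singleton_self _)
      have : evX l' (⟨n, x⟩ : XX k K) = evX (l' - c • l₀) (⟨n, x⟩ : XX k K) +
          c.1 n * evX l₀ (⟨n, x⟩ : XX k K) := by
        rw [evX_sub, evX_smul]; ring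
      change a n _ ≤ _
      rw [this]
      have t1 := (a n).add_le (evX (l' - c • l₀) (⟨n, x⟩ : XX k K))
        (c.1 n * evX l₀ (⟨n, x⟩ : XX k K))
      have t2 : a n (c.1 n * evX l₀ (⟨n, x⟩ : XX k K)) ≤ ε / 2 * nrm a (⟨n, x⟩ : XX k K) := by
        rw [map_mul]
        calc a n (c.1 n) * a n (evX l₀ (⟨n, x⟩ : XX k K))
            ≤ (|C| + 1) * (ε / 2 / (|C| + 1) * nrm a (⟨n, x⟩ : XX k K)) :=
              mul_le_mul (h3.trans ((le_abs_self C).trans (by linarith))) e2 ((a n).nonneg _) hC'.le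
          _ = _ := by field_simp
      linarith
    · exact h1 x hx1 l' hl'

lemma heavy_bot : D.Heavy ⊥ 1 := by
  intro S hS ε hε
  rw [← D.univ]
  apply D.mono
  have : ∀ᶠ n in U, ∀ l ∈ S, ∀ x, a n (evX l (⟨n, x⟩ : XX k K)) ≤
      ε * nrm a (⟨n, x⟩ : XX k K) := by
    rw [Filter.eventually_all_finset]
    intro l hl
    exact D.infinitesimal l (fun i => congrFun ((Submodule.mem_bot L).1 (hS l hl)) i) ε hε
  filter_upwards [this] with n hn x _ l hl
  exact hn l hl x

lemma not_heavy_top (δ : ℝ) (hδ : 0 < δ) : ¬ D.Heavy ⊤ δ := by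
  classical
  intro h
  have h1 := h (Finset.univ.image fun i : Fin k => (Pi.single i 1 : Fin k → bdd K a U))
    (fun _ _ => Submodule.mem_top) (1 / (k + 1)) (by positivity)
  have h2 : D.M (Nb (Finset.univ.image fun i : Fin k => (Pi.single i 1 : Fin k → bdd K a U))
      (1 / (k + 1))) ≤ 0 := by
    rw [← D.zero]
    apply D.M_mono
    rintro ⟨n, x⟩ hp
    have h3 : ∀ i, a n (x i) ≤ 1 / (k + 1) * nrm a (⟨n, x⟩ : XX k K) := by
      intro i
      have := hp _ (Finset.mem_image_of_mem _ (Finset.mem_univ i))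
      have e : evX (Pi.single i 1 : Fin k → bdd K a U) (⟨n, x⟩ : XX k K) = x i := by
        change ∑ j, ((Pi.single i 1 : Fin k → bdd K a U) j).1 n * x j = x i
        rw [Finset.sum_eq_single i]
        · simp
        · intro j _ hj; simp [hj]
        · simp
      rw [e] at this
      exact this
    have h4 : nrm a (⟨n, x⟩ : XX k K) ≤ k * (1 / (k + 1) * nrm a (⟨n, x⟩ : XX k K)) := by
      calc nrm a (⟨n, x⟩ : XX k K) = ∑ i, a n (x i) := rfl
        _ ≤ ∑ i : Fin k, 1 / (k + 1) * nrm a (⟨n, x⟩ : XX k K) :=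
            Finset.sum_le_sum fun i _ => h3 i
        _ = _ := by simp
    have h5 : nrm a (⟨n, x⟩ : XX k K) ≤ 0 := by
      have h6 : (0 : ℝ) < k + 1 := by positivity
      have : (k : ℝ) * (1 / (k + 1) * nrm a (⟨n, x⟩ : XX k K)) =
        nrm a (⟨n, x⟩ : XX k K) - nrm a (⟨n, x⟩ : XX k K) / (k + 1) := by field_simp; ring
      rw [this] at h4
      have h7 : nrm a (⟨n, x⟩ : XX k K) / (k + 1) ≤ 0 := by linarith
      by_contra! h8
      have := div_pos h8 h6
      linarith
    change x = 0
    funext i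
    have h6 := h3 i
    have h7 : a n (x i) ≤ 0 := h6.trans (mul_nonpos_of_nonneg_of_nonpos (by positivity) h5)
    exact (a n).eq_zero.1 (le_antisymm h7 ((a n).nonneg _))
  linarith

lemma Nb_cone (S : Finset (Fin k → bdd K a U)) (ε : ℝ) : IsConeX (Nb S ε) := by
  rintro ⟨n, x⟩ hp c hc
  exact (Nb_cone_iff S ε n x c hc).2 hp

lemma heavy_map (Y : Submodule L (Fin k → L)) (δ : ℝ) (h : D.Heavy Y δ) (g : B) :
    D.Heavy (Y.map (D.ρ g)) δ := by
  classical
  intro S hS ε hε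
  obtain ⟨C, hC, hCb⟩ := D.nrm_act g⁻¹
  have h1 := h (S.image fun l => Matrix.vecMul l (D.gO g)) (by
    intro l hl
    obtain ⟨l', hl', rfl⟩ := Finset.mem_image.1 hl
    obtain ⟨y, hy, hyl⟩ := hS l' hl'
    rw [D.st_vecMul, ← hyl, D.ρ_apply, Matrix.vecMul_vecMul, ← map_mul]
    simpa using hy) (ε / C) (by positivity)
  refine h1.trans ?_
  rw [← D.inv g _ (Nb_cone _ _)]
  apply D.M_mono
  rintro _ ⟨p, hp, rfl⟩ l hl
  rw [D.evX_act]
  have h2 := hp _ (Finset.mem_image_of_mem _ hl)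
  refine le_trans h2 ?_
  have h3 := hCb (actX D.γ g p)
  rw [D.act_inv] at h3
  calc ε / C * nrm a p ≤ ε / C * (C * nrm a (actX D.γ g p)) := by gcongr
    _ = _ := by field_simp

end
end LimSys
end USG
end PartP7b

section PartP7c
set_option linter.unusedVariables false
set_option linter.unusedSectionVars false
open Filter Topology Module

namespace USG
namespace LimSys

section

variable {k : ℕ} {K : ℕ → Type} [∀ n, Field (K n)] {a : ∀ n, AbsoluteValue (K n) ℝ}
  {U : Ultrafilter ℕ} {L : Type} [Field L] {b : AbsoluteValue L ℝ} {st : bdd K a U →+* L}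
  {B : Type} [Group B] (D : LimSys a U b st k B)

lemma not_heavy_span (Y : Submodule L (Fin k → L)) (l : Fin k → bdd K a U) (δ : ℝ) (hδ : 0 < δ)
    (h : ¬ D.Heavy (Y ⊔ Submodule.span L {fun i => st (l i)}) δ) :
    ∃ S : Finset (Fin k → bdd K a U), Lifts st Y S ∧ ∃ ε > 0,
      D.M (Nb S ε ∩ Nb {l} ε) < δ := by
  rw [Heavy] at h
  push Not at h
  obtain ⟨S, hS, ε, hε, hM⟩ := h
  obtain ⟨S₁, S₂, ε', hε', h1, h2, h3⟩ := D.Nb_sup _ _ S hS ε hε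
  obtain ⟨ε'', hε'', h4⟩ := D.Nb_span l S₂ h2 ε' hε'
  refine ⟨S₁, h1, min ε' ε'', lt_min hε' hε'', lt_of_le_of_lt (D.mono _ _ ?_) hM⟩
  filter_upwards [h3, h4] with n h5 h6 x hx
  exact h5 x (Nb_mono le_rfl (min_le_left _ _) hx.1) (h6 x (Nb_mono le_rfl (min_le_right _ _) hx.2))

lemma map_ρ_inv (Y : Submodule L (Fin k → L)) (g : B) : (Y.map (D.ρ g)).map (D.ρ g⁻¹) = Y := by
  rw [← Submodule.map_comp, ← Module.End.mul_eq_comp, ← map_mul]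
  simp [Module.End.one_eq_id]

lemma stab_pow (Y : Submodule L (Fin k → L)) (g : B) (h : Y.map (D.ρ g) = Y) (j : ℕ) :
    Y.map (D.ρ (g ^ j)) = Y := by
  induction j with
  | zero => simp [Module.End.one_eq_id]
  | succ j ih => rw [pow_succ, map_mul, Module.End.mul_eq_comp, Submodule.map_comp, h, ih]

lemma eig_pow (Y : Submodule L (Fin k → L)) (g : B) (h : Y.map (D.ρ g) = Y) (l : L)
    (v : Fin k → L) (hv : D.ρ g v - l • v ∈ Y) (j : ℕ) : D.ρ (g ^ j) v - l ^ j • v ∈ Y := by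
  induction j with
  | zero => simp
  | succ j ih =>
    have h1 : D.ρ (g ^ (j + 1)) v - l ^ (j + 1) • v =
      D.ρ (g ^ j) (D.ρ g v - l • v) + l • (D.ρ (g ^ j) v - l ^ j • v) := by
      rw [pow_succ, map_mul, Module.End.mul_apply, map_sub, map_smul, smul_sub, smul_smul]
      rw [pow_succ, mul_comm l]
      abel
    rw [h1]
    refine Y.add_mem ?_ (Y.smul_mem _ ih)
    have := Submodule.mem_map_of_mem (f := D.ρ (g ^ j)) hv
    rwa [D.stab_pow Y g h j] at this

lemma abs_aux {F : Type*} [Field F] (a : AbsoluteValue F ℝ) (w u e : F) (h : w = u + e) :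
    a u ≤ a w + a e := by
  have : u = w - e := by rw [h]; ring
  rw [this]
  exact a.sub_le_add _ _

lemma evX_eig (h : B) (m : Fin k → bdd K a U) (c : bdd K a U) (j : ℕ) (p : XX k K) :
    evX m (actX D.γ h p) = (c.1 p.1) ^ j * evX m p +
      evX (Matrix.vecMul m (D.gO h) - c ^ j • m) p := by
  rw [D.evX_act, evX_sub, evX_smul]
  change (_ : K p.1) = (c.1 p.1) ^ j * _ + (_ - (c.1 p.1) ^ j * _)
  ring

lemma eigen_aux (Y : Submodule L (Fin k → L)) (δ : ℝ) (hδ : 0 < δ) (hY : D.Heavy Y δ)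
    (hmax : ∀ Z, Y < Z → ∀ δ' > 0, ¬ D.Heavy Z δ') (g : B) (hg : Y.map (D.ρ g) = Y)
    (l₁ l₂ : L) (v₁ v₂ : Fin k → L) (hv₁ : v₁ ∉ Y) (hv₂ : v₂ ∉ Y) (h₁ : D.ρ g v₁ - l₁ • v₁ ∈ Y)
    (h₂ : D.ρ g v₂ - l₂ • v₂ ∈ Y) : b l₂ ≤ b l₁ := by
  classical
  by_contra! hlt
  obtain ⟨p, hp1, hp2⟩ := exists_between hlt
  obtain ⟨q, hq1, hq2⟩ := exists_between hp2
  have hp0 : 0 < p := lt_of_le_of_lt (b.nonneg _) hp1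
  have hq0 : 0 < q := hp0.trans hq1
  obtain ⟨m₁, rfl⟩ := D.exists_lift v₁
  obtain ⟨m₂, rfl⟩ := D.exists_lift v₂
  obtain ⟨c₁, rfl⟩ := D.surj l₁
  obtain ⟨c₂, rfl⟩ := D.surj l₂
  have hltS : ∀ m : Fin k → bdd K a U, (fun i => st (m i)) ∉ Y →
      Y < Y ⊔ Submodule.span L {fun i => st (m i)} := by
    intro m hm
    refine lt_of_le_of_ne le_sup_left fun h => hm ?_
    rw [h]
    exact Submodule.mem_sup_right (Submodule.mem_span_singleton_self _)
  obtain ⟨S₁, hS₁, ε₁, hε₁, hM₁⟩ := D.not_heavy_span Y m₁ (δ / 4) (by positivity)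
    (hmax _ (hltS m₁ hv₁) _ (by positivity))
  obtain ⟨S₂, hS₂, ε₂, hε₂, hM₂⟩ := D.not_heavy_span Y m₂ (δ / 4) (by positivity)
    (hmax _ (hltS m₂ hv₂) _ (by positivity))
  obtain ⟨S, hSd⟩ : ∃ S, S = S₁ ∪ S₂ := ⟨_, rfl⟩
  obtain ⟨ε, hεd⟩ : ∃ ε, ε = min ε₁ ε₂ := ⟨_, rfl⟩
  have hε : 0 < ε := by rw [hεd]; exact lt_min hε₁ hε₂
  have hS : Lifts st Y S := by
    intro l hl
    rw [hSd, Finset.mem_union] at hl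
    exact hl.elim (hS₁ l) (hS₂ l)
  have hN₁ : D.M (Nb S ε ∩ Nb {m₁} ε) < δ / 4 := by
    refine lt_of_le_of_lt (D.M_mono ?_) hM₁
    rw [hεd, hSd]
    exact Set.inter_subset_inter (Nb_mono Finset.subset_union_left (min_le_left _ _))
      (Nb_mono le_rfl (min_le_left _ _))
  have hN₂ : D.M (Nb S ε ∩ Nb {m₂} ε) < δ / 4 := by
    refine lt_of_le_of_lt (D.M_mono ?_) hM₂
    rw [hεd, hSd]
    exact Set.inter_subset_inter (Nb_mono Finset.subset_union_right (min_le_right _ _))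
      (Nb_mono le_rfl (min_le_right _ _))
  obtain ⟨C₁, hC₁, hCb₁⟩ := evX_bdd m₁
  obtain ⟨C₂, hC₂, hCb₂⟩ := evX_bdd m₂
  obtain ⟨j, hj⟩ : ∃ j : ℕ, p ^ j * (4 * C₁ * C₂) ≤ ε ^ 2 * q ^ j := by
    have h1 : Tendsto (fun j : ℕ => (p / q) ^ j) atTop (𝓝 0) :=
      tendsto_pow_atTop_nhds_zero_of_lt_one (by positivity) ((div_lt_one hq0).2 hq1)
    have h2 : (0 : ℝ) < ε ^ 2 / (4 * C₁ * C₂) := by positivity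
    obtain ⟨j, hj⟩ := (h1.eventually_lt_const h2).exists
    refine ⟨j, ?_⟩
    rw [div_pow, div_lt_div_iff₀ (by positivity) (by positivity)] at hj
    exact hj.le
  obtain ⟨η, hηd⟩ : ∃ η, η = min ε (min (p ^ j * C₁) (q ^ j * ε / 2)) := ⟨_, rfl⟩
  have hη : 0 < η := by rw [hηd]; positivity
  have hη1 : η ≤ ε := by rw [hηd]; exact min_le_left _ _
  have hη2 : η ≤ p ^ j * C₁ := by rw [hηd]; exact (min_le_right _ _).trans (min_le_left _ _)
  have hη3 : η ≤ q ^ j * ε / 2 := by rw [hηd]; exact (min_le_right _ _).trans (min_le_right _ _)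
  -- the neighbourhood
  set h : B := (g ^ j)⁻¹ with hh
  let E (m : Fin k → bdd K a U) (c : bdd K a U) : Fin k → bdd K a U :=
    Matrix.vecMul m (D.gO h) - c ^ j • m
  let S' : Finset (Fin k → bdd K a U) := S ∪ (S.image fun l => Matrix.vecMul l (D.gO h)) ∪
    {E m₁ c₁, E m₂ c₂}
  have hE : ∀ m : Fin k → bdd K a U, ∀ c : bdd K a U,
      D.ρ g (fun i => st (m i)) - st c • (fun i => st (m i)) ∈ Y →
      (fun i => st (E m c i)) ∈ Y := by
    intro m c hm
    have h1 := D.eig_pow Y g hg _ _ hm j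
    have : (fun i => st (E m c i)) = D.ρ (g ^ j) (fun i => st (m i)) -
        st c ^ j • (fun i => st (m i)) := by
      rw [D.ρ_apply, ← D.st_vecMul]
      funext i
      simp [E, hh]
    rw [this]; exact h1
  have hS' : Lifts st Y S' := by
    intro l hl
    simp only [S', Finset.mem_union, Finset.mem_image, Finset.mem_insert,
      Finset.mem_singleton] at hl
    rcases hl with (hl | ⟨l', hl', rfl⟩) | rfl | rfl
    · exact hS l hl
    · rw [D.st_vecMul, hh, ← D.ρ_apply]
      have := Submodule.mem_map_of_mem (f := D.ρ (g ^ j)) (hS l' hl')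
      rwa [D.stab_pow Y g hg j] at this
    · exact hE _ _ h₁
    · exact hE _ _ h₂
  have hMN := hY S' hS' η hη
  obtain ⟨N, hNd⟩ : ∃ N, N = Nb S' η := ⟨_, rfl⟩
  have hNS : N ⊆ Nb S ε := by
    rw [hNd]
    exact Nb_mono (fun l hl => by simp [S', hl]) hη1
  let R : Set (XX k K) := N \ (Nb {m₁} ε ∪ Nb {m₂} ε)
  have hMR : δ / 2 ≤ D.M R := by
    have h1 := D.M_diff N (Nb {m₁} ε ∪ Nb {m₂} ε)
    have h2 : D.M (N ∩ (Nb {m₁} ε ∪ Nb {m₂} ε)) ≤ δ / 4 + δ / 4 := by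
      rw [Set.inter_union_distrib_left]
      refine (D.M_union _ _).trans (add_le_add ?_ ?_)
      · exact (D.M_mono (Set.inter_subset_inter_left _ hNS)).trans hN₁.le
      · exact (D.M_mono (Set.inter_subset_inter_left _ hNS)).trans hN₂.le
    rw [← hNd] at hMN
    change _ ≤ D.M (N \ _)
    linarith
  have hRc : IsConeX R := by
    rintro ⟨n, x⟩ hp c hc
    have hp : (⟨n, x⟩ : XX k K) ∈ R := hp
    change (⟨n, c • x⟩ : XX k K) ∈ R
    simp only [R, hNd, Set.mem_sdiff, Set.mem_union] at hp ⊢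
    rw [Nb_cone_iff _ _ _ _ _ hc, Nb_cone_iff _ _ _ _ _ hc, Nb_cone_iff _ _ _ _ _ hc]
    exact hp
  have hfin : D.M (actX D.γ h '' R) ≤ D.M (Nb S ε ∩ Nb {m₁} ε) := by
    apply D.mono
    have t1 := (D.lim c₁).eventually_lt_const hp1
    have t2 := (D.lim c₂).eventually_const_lt hq2
    filter_upwards [hCb₁, hCb₂, t1, t2] with n hb1 hb2 ht1 ht2
    rintro _ ⟨⟨n', x⟩, hx, he⟩
    have hn : n' = n := congrArg Sigma.fst he
    subst hn
    rw [← he]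
    obtain ⟨hx1, hx2⟩ := hx
    rw [Set.mem_union, not_or] at hx2
    obtain ⟨hx2, hx3⟩ := hx2
    rw [hNd] at hx1
    simp only [mem_Nb, Finset.mem_singleton, forall_eq, not_le] at hx2 hx3
    set P : XX k K := ⟨n', x⟩ with hP
    set P' : XX k K := actX D.γ h P with hP'
    have e1 := hx1 (E m₁ c₁) (by simp [S'])
    have e2 := hx1 (E m₂ c₂) (by simp [S'])
    have hb1' := hb1 x
    have hb2' : a n' (evX m₂ P') ≤ C₂ * nrm a P' := hb2 _
    change a n' _ ≤ _ at e1 e2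
    change _ < a n' _ at hx2 hx3
    change a n' (evX m₁ P) ≤ C₁ * nrm a P at hb1'
    change ε * nrm a P < a n' (evX m₁ P) at hx2
    change ε * nrm a P < a n' (evX m₂ P) at hx3
    have d1 : (evX m₁ P' : K n') = (c₁.1 n') ^ j * (evX m₁ P : K n') + (evX (E m₁ c₁) P : K n') :=
      D.evX_eig h m₁ c₁ j P
    have d2 : (evX m₂ P' : K n') = (c₂.1 n') ^ j * (evX m₂ P : K n') + (evX (E m₂ c₂) P : K n') :=
      D.evX_eig h m₂ c₂ j P
    have hN0 : 0 ≤ nrm a P := nrm_nonneg P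
    have f1 : a n' (evX m₁ P') ≤ 2 * (p ^ j * C₁) * nrm a P := by
      rw [d1]
      refine ((a n').add_le _ _).trans ?_
      rw [map_mul, map_pow]
      have : a n' (c₁.1 n') ^ j * a n' (evX m₁ P) ≤ p ^ j * (C₁ * nrm a P) :=
        mul_le_mul (pow_le_pow_left₀ ((a n').nonneg _) ht1.le j) hb1' ((a n').nonneg _)
          (by positivity)
      nlinarith
    have f2 : q ^ j * ε / 2 * nrm a P ≤ C₂ * nrm a P' := by
      refine le_trans ?_ hb2'
      have g2 : a n' ((c₂.1 n') ^ j * evX m₂ P) ≤ a n' (evX m₂ P') + a n' (evX (E m₂ c₂) P) :=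
        abs_aux (a n') _ _ _ d2
      rw [map_mul, map_pow] at g2
      have g3 : q ^ j * (ε * nrm a P) ≤ a n' (c₂.1 n') ^ j * a n' (evX m₂ P) :=
        mul_le_mul (pow_le_pow_left₀ hq0.le ht2.le j) hx3.le (by positivity)
          (pow_nonneg ((a n').nonneg _) _)
      nlinarith
    have f3 : 2 * (p ^ j * C₁) * nrm a P ≤ ε * nrm a P' := by
      have g1 : (p ^ j * (4 * C₁ * C₂)) * nrm a P ≤ (ε ^ 2 * q ^ j) * nrm a P :=
        mul_le_mul_of_nonneg_right hj hN0
      have g2 : (2 * C₂) * (2 * (p ^ j * C₁) * nrm a P) ≤ (2 * C₂) * (ε * nrm a P') := by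
        nlinarith
      exact le_of_mul_le_mul_left g2 (by positivity)
    constructor
    · intro l hl
      have e3 := hx1 (Matrix.vecMul l (D.gO h)) (by
        simp only [S', Finset.mem_union, Finset.mem_image]
        exact Or.inl (Or.inr ⟨l, hl, rfl⟩))
      rw [← D.evX_act] at e3
      refine (show a n' _ ≤ _ from e3).trans (le_trans ?_ f3)
      have : 0 ≤ p ^ j * C₁ := by positivity
      exact mul_le_mul_of_nonneg_right (by linarith) hN0
    · intro l hl
      rw [Finset.mem_singleton.1 hl]
      exact f1.trans f3
  rw [D.inv h R hRc] at hfin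
  linarith

lemma orbit_finite (Y : Submodule L (Fin k → L)) (δ : ℝ) (hδ : 0 < δ) (hY : D.Heavy Y δ)
    (hmax : ∀ Z, Y < Z → ∀ δ' > 0, ¬ D.Heavy Z δ') :
    (Set.range fun g => Y.map (D.ρ g)).Finite := by
  classical
  by_contra hinf
  have hinf : (Set.range fun g => Y.map (D.ρ g)).Infinite := hinf
  obtain ⟨N, hN⟩ := exists_nat_gt (2 / δ)
  obtain ⟨T, hT, hTc⟩ := hinf.exists_subset_card_eq N
  have hmax' : ∀ s ∈ T, ∀ Z, s < Z → ∀ δ' > 0, ¬ D.Heavy Z δ' := by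
    intro s hs Z hZ δ' hδ' hH
    obtain ⟨g, rfl⟩ := hT hs
    refine hmax (Z.map (D.ρ g⁻¹)) ?_ δ' hδ' (D.heavy_map Z δ' hH g⁻¹)
    have hmono : Y.map (D.ρ g) ≤ Z := hZ.le
    refine lt_of_le_of_ne ?_ fun h => ?_
    · have := Submodule.map_mono (f := D.ρ g⁻¹) hmono
      rwa [D.map_ρ_inv] at this
    · apply hZ.ne
      have h1 := D.map_ρ_inv Z g⁻¹
      rw [← h, inv_inv] at h1
      exact h1
  have hheavy : ∀ s ∈ T, D.Heavy s δ := by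
    intro s hs
    obtain ⟨g, rfl⟩ := hT hs
    exact D.heavy_map Y δ hY g
  have hrank : ∀ s ∈ T, ∀ t ∈ T, s ≠ t → s < s ⊔ t := by
    intro s hs t ht hst
    refine lt_of_le_of_ne le_sup_left fun h => hst ?_
    have hts : t ≤ s := by rw [h]; exact le_sup_right
    obtain ⟨g, hg⟩ := hT hs
    obtain ⟨g', hg'⟩ := hT ht
    refine (Submodule.eq_of_le_of_finrank_eq hts ?_).symm
    have hinj : ∀ g, Function.Injective (D.ρ g) := fun g x y hxy => by
      have : D.ρ g⁻¹ (D.ρ g x) = D.ρ g⁻¹ (D.ρ g y) := by rw [hxy]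
      simpa [← Module.End.mul_apply, ← map_mul] using this
    rw [← hg, ← hg']
    exact (LinearEquiv.finrank_eq (Submodule.equivMapOfInjective _ (hinj g') Y)).symm.trans
      (LinearEquiv.finrank_eq (Submodule.equivMapOfInjective _ (hinj g) Y))
  have hNpos : 0 < (N : ℝ) := lt_trans (by positivity) hN
  have hδ' : 0 < δ / (2 * (N : ℝ)) := by positivity
  have key : ∀ s ∈ T, ∀ t ∈ T, s ≠ t → ∃ S₁ S₂ : Finset (Fin k → bdd K a U), ∃ ε > 0,
      Lifts st s S₁ ∧ Lifts st t S₂ ∧ D.M (Nb S₁ ε ∩ Nb S₂ ε) < δ / (2 * N) := by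
    intro s hs t ht hst
    have h1 := hmax' s hs _ (hrank s hs t ht hst) _ hδ'
    rw [Heavy] at h1
    push Not at h1
    obtain ⟨S, hS, ε, hε, hM⟩ := h1
    obtain ⟨S₁, S₂, ε', hε', h1, h2, h3⟩ := D.Nb_sup _ _ S hS ε hε
    refine ⟨S₁, S₂, ε', hε', h1, h2, lt_of_le_of_lt (D.mono _ _ ?_) hM⟩
    filter_upwards [h3] with n h5 x hx
    exact h5 x hx.1 hx.2
  choose! S₁ S₂ ε hε hS₁ hS₂ hM using key
  let SS : Submodule L (Fin k → L) → Finset (Fin k → bdd K a U) := fun s =>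
    (T.erase s).biUnion (S₁ s) ∪ (T.erase s).biUnion fun t => S₂ t s
  obtain ⟨η, hη, hηle⟩ : ∃ η > 0, ∀ s ∈ T, ∀ t ∈ T, s ≠ t → η ≤ ε s t := by
    obtain ⟨η, h1, h2⟩ := Finset.exists_le (s := T ×ˢ T) |> fun _ => (by
      have : ∀ T' : Finset (Submodule L (Fin k → L) × Submodule L (Fin k → L)),
        ∃ η > (0 : ℝ), ∀ x ∈ T', 0 < ε x.1 x.2 → η ≤ ε x.1 x.2 := by
        intro T'
        induction T' using Finset.induction_on with
        | empty => exact ⟨1, one_pos, by simp⟩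
        | insert x T' hx ih =>
          obtain ⟨η, h1, h2⟩ := ih
          by_cases h0 : 0 < ε x.1 x.2
          · refine ⟨min η (ε x.1 x.2), lt_min h1 h0, fun y hy hy0 => ?_⟩
            rcases Finset.mem_insert.1 hy with rfl | hy
            · exact min_le_right _ _
            · exact (min_le_left _ _).trans (h2 y hy hy0)
          · refine ⟨η, h1, fun y hy hy0 => ?_⟩
            rcases Finset.mem_insert.1 hy with rfl | hy
            · exact absurd hy0 h0
            · exact h2 y hy hy0
      exact this (T ×ˢ T) :
        ∃ η > (0 : ℝ), ∀ x ∈ T ×ˢ T, 0 < ε x.1 x.2 → η ≤ ε x.1 x.2)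
    exact ⟨η, h1, fun s hs t ht hst => h2 (s, t) (Finset.mem_product.2 ⟨hs, ht⟩) (hε s hs t ht hst)⟩
  have hSS : ∀ s ∈ T, Lifts st s (SS s) := by
    intro s hs l hl
    simp only [SS, Finset.mem_union, Finset.mem_biUnion, Finset.mem_erase] at hl
    rcases hl with ⟨t, ⟨h1, h2⟩, h3⟩ | ⟨t, ⟨h1, h2⟩, h3⟩
    · exact hS₁ s hs t h2 h1.symm l h3
    · exact hS₂ t h2 s hs h1 l h3
  have := D.packing T (fun s => Nb (SS s) η) δ hδ
    (fun s hs => hheavy s hs _ (hSS s hs) η hη) (by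
      intro s hs t ht hst
      rw [hTc]
      refine (D.M_mono ?_).trans (hM s hs t ht hst).le
      refine Set.inter_subset_inter (Nb_mono ?_ (hηle s hs t ht hst))
        (Nb_mono ?_ (hηle s hs t ht hst))
      · intro l hl
        simp only [SS, Finset.mem_union, Finset.mem_biUnion, Finset.mem_erase]
        exact Or.inl ⟨t, ⟨hst.symm, ht⟩, hl⟩
      · intro l hl
        simp only [SS, Finset.mem_union, Finset.mem_biUnion, Finset.mem_erase]
        exact Or.inr ⟨s, ⟨hst, hs⟩, hl⟩)
  rw [hTc] at this
  rw [div_lt_iff₀ hδ] at hN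
  linarith

theorem abs_eigen [IsAlgClosed L]
    (hspan : ∀ W : Submodule L (Fin k → L), (∀ x : B, W.map (D.ρ (x ^ k.factorial)) ≤ W) →
      W = ⊥ ∨ W = ⊤) (g : B) (l : L) (hl : (D.ρ g).HasEigenvalue l) : b l = 1 := by
  classical
  obtain ⟨Y, ⟨δ, hδ, hY⟩, hmax⟩ := (wellFounded_gt (α := Submodule L (Fin k → L))).has_min
    {Y | ∃ δ > 0, D.Heavy Y δ} ⟨⊥, 1, one_pos, D.heavy_bot⟩
  have hmax : ∀ Z, Y < Z → ∀ δ' > 0, ¬ D.Heavy Z δ' := fun Z hZ δ' hδ' hH =>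
    hmax Z ⟨δ', hδ', hH⟩ hZ
  refine alg_lemma b D.ρ ?_ Y (D.orbit_finite Y δ hδ hY hmax) ?_ ?_ ?_ g l hl
  · intro g
    have h1 : D.ρ g = Matrix.toLin' (D.θ g⁻¹).transpose := by
      apply LinearMap.ext
      intro v
      rw [D.ρ_apply, Matrix.toLin'_apply, Matrix.mulVec_transpose]
    rw [h1, LinearMap.det_toLin', Matrix.det_transpose]
    have h2 : D.θ g⁻¹ = st.mapMatrix (D.gO g⁻¹) := rfl
    rw [h2, ← RingHom.map_det]
    have h3 : (D.gO g⁻¹).det = 1 := by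
      apply Subtype.ext
      funext n
      let ev : bdd K a U →+* K n := (Pi.evalRingHom K n).comp (bdd K a U).subtype
      have : ev (D.gO g⁻¹).det = 1 := by
        rw [RingHom.map_det]
        exact (D.γ g⁻¹ n).2
      exact this
    rw [h3, map_one]
  · rintro rfl
    exact D.not_heavy_top δ hδ hY
  · intro g hg l₁ l₂ v₁ v₂ h1 h2 h3 h4
    exact le_antisymm (D.eigen_aux Y δ hδ hY hmax g hg _ _ _ _ h2 h1 h4 h3)
      (D.eigen_aux Y δ hδ hY hmax g hg _ _ _ _ h1 h2 h3 h4)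
  · intro W hW
    apply hspan W
    intro x
    have := hW x
    rwa [Module.finrank_fin_fun] at this

end
end LimSys
end USG
end PartP7c

section PartP4a
set_option linter.unusedVariables false
set_option linter.unusedSectionVars false
open Module Pointwise

namespace USG

/-! ### Bounded generation of spans -/

section Z
variable {K : Type*} [Field K] {A : Type*} [Ring A] [Algebra K A] [FiniteDimensional K A]

lemma span_pow_succ (X : Set A) (n : ℕ) :
    Submodule.span K (X ^ (n + 1)) = Submodule.span K (X ^ n) * Submodule.span K X := by
  rw [pow_succ, Submodule.span_mul_span]

lemma span_pow_mono {X : Set A} (h1 : (1 : A) ∈ X) {m n : ℕ} (h : m ≤ n) :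
    Submodule.span K (X ^ m) ≤ Submodule.span K (X ^ n) :=
  Submodule.span_mono (Set.pow_subset_pow_right h1 h)

lemma span_pow_stable {X : Set A} {n : ℕ}
    (h : Submodule.span K (X ^ n) = Submodule.span K (X ^ (n + 1))) (j : ℕ) :
    Submodule.span K (X ^ (n + j)) = Submodule.span K (X ^ n) := by
  induction j with
  | zero => rfl
  | succ j ih => rw [← add_assoc, span_pow_succ, ih, ← span_pow_succ, h]

lemma span_pow_eq {X : Set A} (h1 : (1 : A) ∈ X) (n : ℕ) :
    n ≤ finrank K (Submodule.span K (X ^ n)) ∨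
      ∀ j, Submodule.span K (X ^ (n + j)) = Submodule.span K (X ^ n) := by
  induction n with
  | zero => left; simp
  | succ n ih =>
    rcases ih with ih | ih
    · by_cases h : Submodule.span K (X ^ n) = Submodule.span K (X ^ (n + 1))
      · right
        intro j
        rw [add_assoc, span_pow_stable h, ← h]
      · left
        have h2 : Submodule.span K (X ^ n) < Submodule.span K (X ^ (n + 1)) :=
          lt_of_le_of_ne (span_pow_mono h1 (Nat.le_succ n)) h
        have := Submodule.finrank_lt_finrank_of_lt h2
        omega
    · right
      intro j
      rw [add_assoc, ih, ih]

lemma lemmaZ {X : Set A} (h1 : (1 : A) ∈ X) {N : ℕ} (hN : finrank K A ≤ N) (W : Submodule K A)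
    (h : X ^ N ⊆ W) : (Submonoid.closure X : Set A) ⊆ W := by
  have key : ∀ m, Submodule.span K (X ^ m) ≤ Submodule.span K (X ^ N) := by
    intro m
    rcases le_total m N with hm | hm
    · exact span_pow_mono h1 hm
    · obtain ⟨j, rfl⟩ := Nat.exists_eq_add_of_le hm
      rcases span_pow_eq (K := K) h1 N with h2 | h2
      · have : Submodule.span K (X ^ N) = ⊤ := by
          apply Submodule.eq_top_of_finrank_eq
          exact le_antisymm (Submodule.finrank_le _) (hN.trans h2)
        rw [this]; exact le_top
      · rw [h2 j]
  have h2 : ∀ x ∈ Submonoid.closure X, ∃ m, x ∈ X ^ m := by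
    intro x hx
    induction hx using Submonoid.closure_induction with
    | mem x hx => exact ⟨1, by simpa using hx⟩
    | one => exact ⟨0, by simp⟩
    | mul x y _ _ hx hy =>
      obtain ⟨m, hm⟩ := hx
      obtain ⟨n, hn⟩ := hy
      exact ⟨m + n, by rw [pow_add]; exact Set.mul_mem_mul hm hn⟩
  intro x hx
  obtain ⟨m, hm⟩ := h2 x hx
  exact Submodule.span_le.2 h (key m (Submodule.subset_span hm))

end Z

section BD
variable {K : Type} [Field K] {H : Type} [Group H]

/-- bounded degree functions on a group -/
def BD (K : Type) [Field K] {H : Type} [Group H] {V : Type} [AddCommGroup V] [Module K V]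
    (N : ℕ) (P : H → V) : Prop :=
  ∃ (A : Type) (_ : Ring A) (_ : Algebra K A) (_ : FiniteDimensional K A) (R : H →* A)
    (φ : A →ₗ[K] V), finrank K A ≤ N ∧ ∀ x, P x = φ (R x)

lemma BD.mono {V : Type} [AddCommGroup V] [Module K V] {N N' : ℕ} {P : H → V} (h : BD K N P)
    (hN : N ≤ N') : BD K N' P := by
  obtain ⟨A, _, _, _, R, φ, h1, h2⟩ := h
  exact ⟨A, _, _, ‹_›, R, φ, h1.trans hN, h2⟩

lemma BD.const {V : Type} [AddCommGroup V] [Module K V] (v : V) : BD K 1 (fun _ : H => v) :=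
  ⟨K, inferInstance, inferInstance, inferInstance, 1, LinearMap.toSpanSingleton K V v, by simp,
    by simp⟩

lemma BD.comp {V V' : Type} [AddCommGroup V] [Module K V] [AddCommGroup V'] [Module K V'] {N : ℕ}
    {P : H → V} (h : BD K N P) (ψ : V →ₗ[K] V') : BD K N (fun x => ψ (P x)) := by
  obtain ⟨A, _, _, _, R, φ, h1, h2⟩ := h
  exact ⟨A, _, _, ‹_›, R, ψ.comp φ, h1, fun x => by simp [h2]⟩

open TensorProduct in
lemma BD.mul {V : Type} [Ring V] [Algebra K V] {N N' : ℕ} {P P' : H → V} (h : BD K N P)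
    (h' : BD K N' P') : BD K (N * N') (fun x => P x * P' x) := by
  obtain ⟨A, _, _, _, R, φ, h1, h2⟩ := h
  obtain ⟨A', _, _, _, R', φ', h1', h2'⟩ := h'
  refine ⟨A ⊗[K] A', inferInstance, inferInstance, inferInstance,
    { toFun := fun x => R x ⊗ₜ R' x
      map_one' := by simp [Algebra.TensorProduct.one_def]
      map_mul' := by intro x y; simp },
    (LinearMap.mul' K V).comp (TensorProduct.map φ φ'), ?_, ?_⟩
  · rw [Module.finrank_tensorProduct]
    exact Nat.mul_le_mul h1 h1'
  · intro x
    change P x * P' x = LinearMap.mul' K V (TensorProduct.map φ φ' (R x ⊗ₜ R' x))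
    rw [h2, h2', TensorProduct.map_tmul, LinearMap.mul'_apply]

lemma BD.pow {V : Type} [Ring V] [Algebra K V] {N : ℕ} {P : H → V} (h : BD K N P) (q : ℕ) :
    BD K (N ^ q) (fun x => P x ^ q) := by
  induction q with
  | zero => simpa using BD.const (1 : V)
  | succ q ih =>
    simp only [pow_succ]
    exact ih.mul h

lemma BD.mem {V : Type} [AddCommGroup V] [Module K V] {N : ℕ} {P : H → V} (h : BD K N P)
    {F : Set H} (h1 : (1 : H) ∈ F) (hF : ∀ x ∈ F, x⁻¹ ∈ F) (W : Submodule K V)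
    (hW : ∀ x ∈ F ^ N, P x ∈ W) : ∀ x ∈ Subgroup.closure F, P x ∈ W := by
  obtain ⟨A, _, _, _, R, φ, h2, h3⟩ := h
  have h4 := lemmaZ (K := K) (X := R '' F) ⟨1, h1, map_one R⟩ h2 (W.comap φ) (by
    rw [← Set.image_pow]
    rintro _ ⟨x, hx, rfl⟩
    change φ (R x) ∈ W
    rw [← h3]
    exact hW x hx)
  intro x hx
  have hinv : F⁻¹ ⊆ F := fun y hy => by
    have := hF _ hy
    simpa using this
  have h5 : x ∈ Submonoid.closure F := by
    have : x ∈ (Subgroup.closure F).toSubmonoid := hx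
    rw [Subgroup.closure_toSubmonoid, Set.union_eq_left.2 hinv] at this
    exact this
  have h6 : R x ∈ (Submonoid.closure (R '' F)) := by
    rw [← MonoidHom.map_mclosure]
    exact Submonoid.mem_map_of_mem R h5
  have := h4 h6
  rw [h3]
  exact this

variable {k : ℕ}
abbrev SLk (k : ℕ) (K : Type) [Field K] := Matrix.SpecialLinearGroup (Fin k) K

lemma BD.coe : BD K (k ^ 2) (fun x : SLk k K => (x.1 : Matrix (Fin k) (Fin k) K)) :=
  ⟨Matrix (Fin k) (Fin k) K, inferInstance, inferInstance, inferInstance,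
    { toFun := fun x => x.1, map_one' := rfl, map_mul' := fun _ _ => rfl }, LinearMap.id,
    by simp [Module.finrank_matrix, sq], fun _ => rfl⟩

lemma BD.coe_inv : BD K (k ^ 2) (fun x : SLk k K => (x⁻¹.1 : Matrix (Fin k) (Fin k) K)) :=
  ⟨Matrix (Fin k) (Fin k) K, inferInstance, inferInstance, inferInstance,
    { toFun := fun x => (x⁻¹).1.transpose, map_one' := by simp,
      map_mul' := fun x y => by rw [mul_inv_rev, Matrix.SpecialLinearGroup.coe_mul,
        Matrix.transpose_mul] },
    (Matrix.transposeLinearEquiv (Fin k) (Fin k) K K).toLinearMap,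
    by simp [Module.finrank_matrix, sq], fun _ => by simp⟩

end BD
end USG
end PartP4a

section PartP4b
set_option linter.unusedVariables false
set_option linter.unusedSectionVars false
open Module Pointwise

namespace USG

section Sc
variable {K : Type} [Field K] {k : ℕ}

abbrev Mk (k : ℕ) (K : Type) [Field K] := Matrix (Fin k) (Fin k) K

def scal (k : ℕ) (K : Type) [Field K] : Submodule K (Mk k K) := Submodule.span K {1}

def Sc (x : SLk k K) : Prop := x.1 ∈ scal k K

lemma sc_iff (x : SLk k K) : Sc x ↔ ∃ c : K, c • (1 : Mk k K) = x.1 :=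
  Submodule.mem_span_singleton

def mc (x : SLk k K) : Mk k K := x.1

/-- Every normal subgroup is scalar or spans. -/
def Star (G : Subgroup (SLk k K)) : Prop :=
  ∀ N : Subgroup (SLk k K), N ≤ G → (∀ g ∈ G, ∀ n ∈ N, g * n * g⁻¹ ∈ N) →
    (∀ x ∈ N, Sc x) ∨ Submodule.span K (mc '' (N : Set (SLk k K))) = ⊤

lemma scal_of_commute (x : Mk k K) (S : Set (Mk k K)) (hS : Submodule.span K S = ⊤)
    (h : ∀ y ∈ S, x * y = y * x) : x ∈ scal k K := by
  have h1 : ∀ y, x * y = y * x := by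
    intro y
    have hy : y ∈ Submodule.span K S := by rw [hS]; trivial
    induction hy using Submodule.span_induction with
    | mem y hy => exact h y hy
    | zero => simp
    | add y z _ _ h1 h2 => rw [mul_add, add_mul, h1, h2]
    | smul c y _ h1 => rw [mul_smul_comm, h1, smul_mul_assoc]
  have h2 : x ∈ Subalgebra.center K (Mk k K) := by
    rw [Subalgebra.mem_center_iff]
    exact fun y => (h1 y).symm
  rw [Algebra.IsCentral.center_eq_bot, Algebra.mem_bot] at h2
  obtain ⟨c, rfl⟩ := h2
  rw [Algebra.algebraMap_eq_smul_one]
  exact Submodule.mem_span_singleton.2 ⟨c, rfl⟩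

lemma sc_finite : {x : SLk k K | Sc x}.Finite := by
  rcases Nat.eq_zero_or_pos k with rfl | hk
  · exact Set.toFinite _
  classical
  have h1 : {c : K | c ^ k = 1}.Finite := by
    have : {c : K | c ^ k = 1} = ((Polynomial.nthRoots k (1 : K)).toFinset : Set K) := by
      ext c
      simp [Polynomial.mem_nthRoots hk]
    rw [this]
    exact Finset.finite_toSet _
  have h2 := h1.image fun c : K => c • (1 : Mk k K)
  refine Set.Finite.of_finite_image (f := mc) (h2.subset ?_) (fun x _ y _ h => Subtype.ext h)
  rintro _ ⟨x, hx, rfl⟩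
  obtain ⟨c, hc⟩ := (sc_iff x).1 hx
  refine ⟨c, ?_, hc⟩
  have := x.2
  rw [← hc, Matrix.det_smul] at this
  simpa using this

lemma sc_pow (x : SLk k K) (h : Sc x) (n : ℕ) : Sc (x ^ n) := by
  obtain ⟨c, hc⟩ := (sc_iff x).1 h
  refine (sc_iff _).2 ⟨c ^ n, ?_⟩
  rw [Matrix.SpecialLinearGroup.coe_pow, ← hc, smul_pow, one_pow]

lemma sc_pow_k (x : SLk k K) (h : Sc x) : x ^ k = 1 := by
  obtain ⟨c, hc⟩ := (sc_iff x).1 h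
  have h1 := x.2
  rw [← hc, Matrix.det_smul] at h1
  have h2 : c ^ k = 1 := by simpa using h1
  apply Subtype.ext
  rw [Matrix.SpecialLinearGroup.coe_pow, ← hc, smul_pow, one_pow, h2, one_smul]; rfl

lemma root_pow (x : SLk k K) (n : ℕ) (h : x ^ n = 1) (z : K) (hz : z ∈ x.1.charpoly.roots) :
    z ^ n = 1 := by
  have h1 : x.1.charpoly.IsRoot z := (Polynomial.mem_roots'.1 hz).2
  have h2 : Module.End.HasEigenvalue (Matrix.toLin' x.1) z := by
    rw [Module.End.hasEigenvalue_iff_isRoot_charpoly, Matrix.charpoly_toLin']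
    exact h1
  obtain ⟨v, hv⟩ := h2.exists_hasEigenvector
  have h3 := hv.pow_apply n
  rw [← Matrix.toLin'_pow, ← Matrix.SpecialLinearGroup.coe_pow, h] at h3
  simp only [Matrix.SpecialLinearGroup.coe_one, Matrix.toLin'_one, LinearMap.id_coe, id_eq] at h3
  have h4 : (z ^ n - 1) • v = 0 := by rw [sub_smul, ← h3]; simp
  rcases smul_eq_zero.1 h4 with h5 | h5
  · exact sub_eq_zero.1 h5
  · exact absurd h5 hv.2

lemma trace_finite [IsAlgClosed K] (n : ℕ) (hn : 0 < n) :
    {t : K | ∃ x : SLk k K, x ^ n = 1 ∧ t = x.1.trace}.Finite := by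
  classical
  have h1 : {c : K | c ^ n = 1}.Finite := by
    have : {c : K | c ^ n = 1} = ((Polynomial.nthRoots n (1 : K)).toFinset : Set K) := by
      ext c
      simp [Polynomial.mem_nthRoots hn]
    rw [this]
    exact Finset.finite_toSet _
  have h2 : (Set.pi Set.univ fun _ : Fin k => {c : K | c ^ n = 1}).Finite :=
    Set.Finite.pi' (fun _ => h1) |>.subset (fun f hf i => hf i trivial)
  refine (h2.image fun f => ∑ i, f i).subset ?_
  rintro _ ⟨x, hx, rfl⟩
  have hcard : x.1.charpoly.roots.card = k := by
    rw [Polynomial.splits_iff_card_roots.1 (IsAlgClosed.splits x.1.charpoly),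
      Matrix.charpoly_natDegree_eq_dim, Fintype.card_fin]
  obtain ⟨l, hl⟩ := Quot.exists_rep x.1.charpoly.roots
  have hl : (l : Multiset K) = x.1.charpoly.roots := hl
  have hlen : l.length = k := by rw [← hcard, ← hl]; rfl
  subst hlen
  refine ⟨l.get, ?_, ?_⟩
  · intro i _
    apply root_pow x n hx
    rw [← hl]
    simp
  · rw [Matrix.trace_eq_sum_roots_charpoly, ← hl]
    simp only [Multiset.sum_coe]
    conv_rhs => rw [← List.ofFn_get l, List.sum_ofFn]

lemma finite_of_trace (G : Set (SLk k K)) (S : Set (Mk k K)) (hS : Submodule.span K S = ⊤)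
    (T : Set K) (hT : T.Finite) (h : ∀ g ∈ G, ∀ s ∈ S, (g.1 * s).trace ∈ T) : G.Finite := by
  obtain ⟨S', hS', hsp, hli⟩ := exists_linearIndependent K S
  rw [hS] at hsp
  have hfin : Finite S' := hli.finite
  have h2 : (Set.pi Set.univ fun _ : S' => T).Finite :=
    Set.Finite.pi' (fun _ => hT) |>.subset (fun f hf i => hf i trivial)
  refine Set.Finite.of_finite_image (f := fun g s => (g.1 * s.1).trace) (h2.subset ?_) ?_
  · rintro _ ⟨g, hg, rfl⟩ s _
    exact h g hg s.1 (hS' s.2)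
  · intro x _ y _ hxy
    apply Subtype.ext
    rw [Matrix.ext_iff_trace_mul_right]
    intro z
    have hz : z ∈ Submodule.span K S' := by rw [hsp]; trivial
    induction hz using Submodule.span_induction with
    | mem y hy => exact congrFun hxy ⟨y, hy⟩
    | zero => simp
    | add y z _ _ h1 h2 => rw [mul_add, mul_add, Matrix.trace_add, Matrix.trace_add, h1, h2]
    | smul c y _ h1 => rw [mul_smul_comm, mul_smul_comm, Matrix.trace_smul, Matrix.trace_smul, h1]

lemma finite_lemma [IsAlgClosed K] (G : Subgroup (SLk k K))
    (hG : Submodule.span K (mc '' (G : Set (SLk k K))) = ⊤) (q : ℕ) (hq : 0 < q)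
    (h : ∀ x ∈ G, Sc (x ^ q)) : (G : Set (SLk k K)).Finite := by
  rcases Nat.eq_zero_or_pos k with rfl | hk
  · exact Set.toFinite _
  refine finite_of_trace _ _ hG _ (trace_finite (k := k) (K := K) (q * k) (by positivity)) ?_
  rintro g hg _ ⟨s, hs, rfl⟩
  refine ⟨g * s, ?_, rfl⟩
  rw [pow_mul]
  exact sc_pow_k _ (h _ (G.mul_mem hg hs))

end Sc
end USG
end PartP4b

section PartP4c
set_option linter.unusedVariables false
set_option linter.unusedSectionVars false
open Module Pointwise

namespace USG

section
variable {K : Type} [Field K] {k : ℕ}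

structure Good (F : Set (SLk k K)) : Prop where
  one : 1 ∈ F
  symm : ∀ x ∈ F, x⁻¹ ∈ F
  inf : (Subgroup.closure F : Set (SLk k K)).Infinite
  star : Star (Subgroup.closure F)

lemma Good.nonsc {F : Set (SLk k K)} (hF : Good F) : ∃ x ∈ Subgroup.closure F, ¬ Sc x := by
  by_contra! h
  exact hF.inf (sc_finite.subset fun x hx => h x hx)

lemma Good.span {F : Set (SLk k K)} (hF : Good F) :
    Submodule.span K (mc '' (Subgroup.closure F : Set (SLk k K))) = ⊤ := by
  rcases hF.star _ le_rfl (fun g hg n hn => mul_mem (mul_mem hg hn) (inv_mem hg)) with h | h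
  · obtain ⟨x, hx, hx'⟩ := hF.nonsc
    exact absurd (h x hx) hx'
  · exact h

lemma Good.pow_nonsc [IsAlgClosed K] {F : Set (SLk k K)} (hF : Good F) (q : ℕ) (hq : 0 < q) :
    ∃ x ∈ F ^ ((k ^ 2) ^ q), ¬ Sc (x ^ q) := by
  by_contra! h
  have h1 := BD.mem (BD.pow (BD.coe (K := K) (k := k)) q) hF.one hF.symm (scal k K) (by
    intro x hx
    have := h x hx
    rwa [Sc, Matrix.SpecialLinearGroup.coe_pow] at this)
  refine hF.inf (finite_lemma _ hF.span q hq fun x hx => ?_)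
  rw [Sc, Matrix.SpecialLinearGroup.coe_pow]
  exact h1 x hx

/-- Step 1: bounded products of powers span. -/
lemma Good.pow_span [IsAlgClosed K] {F : Set (SLk k K)} (hF : Good F) (q : ℕ) (hq : 0 < q) :
    Submodule.span K (((fun x : SLk k K => x.1 ^ q) '' (F ^ ((k ^ 2) ^ q))) ^ (k ^ 2)) = ⊤ := by
  set X := (fun x : SLk k K => x.1 ^ q) '' (F ^ ((k ^ 2) ^ q)) with hX
  have h1X : (1 : Mk k K) ∈ X := ⟨1, Set.one_mem_pow hF.one, by simp⟩
  -- the power subgroup spans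
  set G := Subgroup.closure F with hG
  let P : Subgroup (SLk k K) := Subgroup.closure ((fun x => x ^ q) '' (G : Set (SLk k K)))
  have hPG : P ≤ G := by
    rw [Subgroup.closure_le]
    rintro _ ⟨x, hx, rfl⟩
    exact pow_mem hx q
  have hPn : ∀ g ∈ G, ∀ n ∈ P, g * n * g⁻¹ ∈ P := by
    intro g hg n hn
    induction hn using Subgroup.closure_induction with
    | mem x hx =>
      obtain ⟨y, hy, rfl⟩ := hx
      refine Subgroup.subset_closure ⟨g * y * g⁻¹, mul_mem (mul_mem hg hy) (inv_mem hg), ?_⟩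
      exact conj_pow
    | one => simp
    | mul x y _ _ hx hy =>
      have : g * (x * y) * g⁻¹ = (g * x * g⁻¹) * (g * y * g⁻¹) := by group
      rw [this]; exact mul_mem hx hy
    | inv x _ hx =>
      have : g * x⁻¹ * g⁻¹ = (g * x * g⁻¹)⁻¹ := by group
      rw [this]; exact inv_mem hx
  have hPs : Submodule.span K (mc '' (P : Set (SLk k K))) = ⊤ := by
    rcases hF.star P hPG hPn with h | h
    · exfalso
      obtain ⟨x, hx, hx'⟩ := hF.pow_nonsc q hq
      refine hx' (h _ (Subgroup.subset_closure ⟨x, ?_, rfl⟩))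
      have : F ^ ((k ^ 2) ^ q) ⊆ (G : Set (SLk k K)) := by
        have h3 : ∀ n, F ^ n ⊆ (G : Set (SLk k K)) := by
          intro n
          induction n with
          | zero => simp
          | succ n ih =>
            rw [pow_succ]
            rintro _ ⟨a, ha, b, hb, rfl⟩
            exact mul_mem (ih ha) (Subgroup.subset_closure hb)
        exact h3 _
      exact this hx
    · exact h
  -- P lies in the span of products
  have hXW := lemmaZ (K := K) h1X (N := k ^ 2) (by simp [Module.finrank_matrix, sq])
    (Submodule.span K (X ^ (k ^ 2))) Submodule.subset_span
  have hadj : (Algebra.adjoin K X : Set (Mk k K)) ⊆ Submodule.span K (X ^ (k ^ 2)) := by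
    intro y hy
    have : y ∈ Subalgebra.toSubmodule (Algebra.adjoin K X) := hy
    rw [Algebra.adjoin_eq_span] at this
    exact Submodule.span_le.2 hXW this
  have hpow := BD.mem (BD.pow (BD.coe (K := K) (k := k)) q) hF.one hF.symm
    (Subalgebra.toSubmodule (Algebra.adjoin K X)) (fun x hx => Algebra.subset_adjoin ⟨x, hx, rfl⟩)
  rw [eq_top_iff, ← hPs, Submodule.span_le]
  rintro _ ⟨x, hx, rfl⟩
  apply hadj
  have hx' : x ∈ P.toSubmonoid := hx
  rw [Subgroup.closure_toSubmonoid] at hx'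
  induction hx' using Submonoid.closure_induction with
  | mem y hy =>
    rcases hy with ⟨z, hz, rfl⟩ | ⟨z, hz, hzy⟩
    · exact (hpow z hz :)
    · have : y = z⁻¹ ^ q := by
        rw [← inv_inv y, ← hzy]; simp
      rw [this]
      exact hpow _ (inv_mem hz)
  | one => exact one_mem (Algebra.adjoin K X)
  | mul a b ha hb h1 h2 =>
    have ha' : a ∈ P.toSubmonoid := by rw [Subgroup.closure_toSubmonoid]; exact ha
    have hb' : b ∈ P.toSubmonoid := by rw [Subgroup.closure_toSubmonoid]; exact hb
    exact mul_mem (h1 ha') (h2 hb')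

def cm {H : Type*} [Group H] (a b : H) : H := a * b * a⁻¹ * b⁻¹

lemma sc_comm_iff (a c : SLk k K) : Sc (cm a c) ↔ ∃ s : K, a.1 * c.1 = s • (c.1 * a.1) := by
  have hcm : (cm a c).1 * (c.1 * a.1) = a.1 * c.1 := by
    have e : cm a c * (c * a) = a * c := by rw [cm]; group
    exact congrArg Subtype.val e
  rw [sc_iff]
  constructor
  · rintro ⟨s, hs⟩
    refine ⟨s, ?_⟩
    rw [← hcm, ← hs, smul_mul_assoc, one_mul]
  · rintro ⟨s, hs⟩
    refine ⟨s, ?_⟩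
    have h1 : (c * a).1 * ((c * a)⁻¹).1 = 1 := by
      rw [← Matrix.SpecialLinearGroup.coe_mul]; simp
    have h2 : (cm a c).1 * ((c * a).1 * ((c * a)⁻¹).1) =
        (s • (1 : Mk k K)) * ((c * a).1 * ((c * a)⁻¹).1) := by
      rw [← mul_assoc, Matrix.SpecialLinearGroup.coe_mul c a, hcm, hs, ← mul_assoc]
      simp
    rw [h1] at h2
    simpa using h2.symm

lemma sc_comm_mul_right (a c c' : SLk k K) (h : Sc (cm a c)) (h' : Sc (cm a c')) : Sc (cm a (c * c')) := by
  rw [sc_comm_iff] at *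
  obtain ⟨s, hs⟩ := h
  obtain ⟨t, ht⟩ := h'
  refine ⟨s * t, ?_⟩
  rw [Matrix.SpecialLinearGroup.coe_mul, ← mul_assoc, hs, smul_mul_assoc, mul_assoc, ht,
    mul_smul_comm, smul_smul, mul_assoc]

lemma sc_conj (a g : SLk k K) (h : Sc a) : g * a * g⁻¹ = a := by
  obtain ⟨s, hs⟩ := (sc_iff a).1 h
  have : g * a = a * g := by
    apply Subtype.ext
    rw [Matrix.SpecialLinearGroup.coe_mul, Matrix.SpecialLinearGroup.coe_mul, ← hs]
    simp
  rw [this]; group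

lemma sc_inv (a : SLk k K) (h : Sc a) : Sc a⁻¹ := by
  rcases Nat.eq_zero_or_pos k with rfl | hk
  · rwa [Subsingleton.elim a⁻¹ a]
  obtain ⟨n, rfl⟩ : ∃ n, k = n + 1 := ⟨k - 1, by omega⟩
  have h1 := sc_pow_k a h
  have : a⁻¹ = a ^ n := by
    rw [inv_eq_iff_mul_eq_one, ← pow_succ', h1]
  rw [this]; exact sc_pow a h n

lemma sc_comm_swap (a c : SLk k K) (h : Sc (cm a c)) : Sc (cm c a) := by
  have : cm c a = (cm a c)⁻¹ := by simp only [cm]; group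
  rw [this]
  exact sc_inv _ h

lemma sc_comm_inv_right (a c : SLk k K) (h : Sc (cm a c)) : Sc (cm a (c⁻¹)) := by
  have h1 : (cm a (c⁻¹)) = c⁻¹ * (cm a c)⁻¹ * c⁻¹⁻¹ := by
    simp only [cm]; group
  rw [h1, sc_conj _ _ (sc_inv _ h)]
  exact sc_inv _ h

lemma sc_comm_conj (a c g : SLk k K) (h : Sc (cm a c)) : Sc (cm (g * a * g⁻¹) (g * c * g⁻¹)) := by
  have h1 : (cm (g * a * g⁻¹) (g * c * g⁻¹)) = g * (cm a c) * g⁻¹ := by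
    simp only [cm]; group
  rw [h1, sc_conj _ _ h]; exact h

/-- Lemma S. -/
lemma Good.lemmaS [IsAlgClosed K] {F : Set (SLk k K)} (hF : Good F) (A B : SLk k K)
    (hA : A ∈ Subgroup.closure F) (hB : B ∈ Subgroup.closure F) (hA' : ¬ Sc A) (hB' : ¬ Sc B) :
    ∃ h ∈ Subgroup.closure F, ¬ Sc (cm A (h * B * h⁻¹)) := by
  by_contra! hcon
  set G := Subgroup.closure F with hG
  let N : Subgroup (SLk k K) := Subgroup.closure {x | ∃ h ∈ G, x = h * B * h⁻¹}
  have hNG : N ≤ G := by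
    rw [Subgroup.closure_le]
    rintro _ ⟨h, hh, rfl⟩
    exact mul_mem (mul_mem hh hB) (inv_mem hh)
  have hNn : ∀ g ∈ G, ∀ n ∈ N, g * n * g⁻¹ ∈ N := by
    intro g hg n hn
    induction hn using Subgroup.closure_induction with
    | mem x hx =>
      obtain ⟨y, hy, rfl⟩ := hx
      refine Subgroup.subset_closure ⟨g * y, mul_mem hg hy, ?_⟩
      group
    | one => simp
    | mul x y _ _ hx hy =>
      have : g * (x * y) * g⁻¹ = (g * x * g⁻¹) * (g * y * g⁻¹) := by group
      rw [this]; exact mul_mem hx hy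
    | inv x _ hx =>
      have : g * x⁻¹ * g⁻¹ = (g * x * g⁻¹)⁻¹ := by group
      rw [this]; exact inv_mem hx
  have hNs : Submodule.span K (mc '' (N : Set (SLk k K))) = ⊤ := by
    rcases hF.star N hNG hNn with h | h
    · exact absurd (h B (Subgroup.subset_closure ⟨1, one_mem _, by simp⟩)) hB'
    · exact h
  have one_sc : Sc (1 : SLk k K) := (sc_iff _).2 ⟨1, by simp⟩
  let Z : Subgroup (SLk k K) :=
    { carrier := {a | a ∈ G ∧ ∀ n ∈ N, Sc (cm a n)}
      one_mem' := ⟨one_mem _, fun n _ => by simpa [cm] using one_sc⟩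
      mul_mem' := fun {a b} ha hb => ⟨mul_mem ha.1 hb.1, fun n hn => sc_comm_swap _ _
        (sc_comm_mul_right _ _ _ (sc_comm_swap _ _ (ha.2 n hn)) (sc_comm_swap _ _ (hb.2 n hn)))⟩
      inv_mem' := fun {a} ha => ⟨inv_mem ha.1, fun n hn => sc_comm_swap _ _
        (sc_comm_inv_right _ _ (sc_comm_swap _ _ (ha.2 n hn)))⟩ }
  have hZn : ∀ g ∈ G, ∀ n ∈ Z, g * n * g⁻¹ ∈ Z := by
    rintro g hg a ⟨ha, ha'⟩
    refine ⟨mul_mem (mul_mem hg ha) (inv_mem hg), fun n hn => ?_⟩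
    have h1 := sc_comm_conj _ _ g (ha' (g⁻¹ * n * g⁻¹⁻¹) (hNn _ (inv_mem hg) _ hn))
    have h2 : g * (g⁻¹ * n * g⁻¹⁻¹) * g⁻¹ = n := by group
    rwa [h2] at h1
  have hAZ : A ∈ Z := by
    refine ⟨hA, fun n hn => ?_⟩
    induction hn using Subgroup.closure_induction with
    | mem x hx =>
      obtain ⟨y, hy, rfl⟩ := hx
      exact hcon y hy
    | one => simpa [cm] using one_sc
    | mul x y _ _ hx hy => exact sc_comm_mul_right _ _ _ hx hy
    | inv x _ hx => exact sc_comm_inv_right _ _ hx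
  have hZs : Submodule.span K (mc '' (Z : Set (SLk k K))) = ⊤ := by
    rcases hF.star Z (fun a ha => ha.1) hZn with h | h
    · exact absurd (h A hAZ) hA'
    · exact h
  have hZZ : ∀ a ∈ Z, ∀ c ∈ Z, Sc (cm a c) := by
    suffices hh : ∀ a ∈ Z, ∀ c ∈ Z, Sc (cm a⁻¹ c⁻¹) by
      intro a ha c hc
      simpa using hh _ (inv_mem ha) _ (inv_mem hc)
    intro a ha c hc
    refine scal_of_commute _ _ hNs ?_
    rintro _ ⟨n, hn, rfl⟩
    have e1 : a * n * a⁻¹ = cm a n * n := by rw [cm]; group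
    have e2 : c * n * c⁻¹ = cm c n * n := by rw [cm]; group
    have c1 : ∀ g, g * cm a n = cm a n * g := fun g => by
      have := sc_conj _ g (ha.2 n hn)
      rwa [mul_inv_eq_iff_eq_mul] at this
    have c2 : ∀ g, g * cm c n = cm c n * g := fun g => by
      have := sc_conj _ g (hc.2 n hn)
      rwa [mul_inv_eq_iff_eq_mul] at this
    generalize cm a n = u at *
    generalize cm c n = v at *
    have e3 : a * c * n * (a * c)⁻¹ = v * u * n := by
      calc a * c * n * (a * c)⁻¹ = a * (c * n * c⁻¹) * a⁻¹ := by group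
        _ = a * v * n * a⁻¹ := by rw [e2]; group
        _ = v * (a * n * a⁻¹) := by rw [c2]; group
        _ = _ := by rw [e1]; group
    have e4 : c * a * n * (c * a)⁻¹ = u * v * n := by
      calc c * a * n * (c * a)⁻¹ = c * (a * n * a⁻¹) * c⁻¹ := by group
        _ = c * u * n * c⁻¹ := by rw [e1]; group
        _ = u * (c * n * c⁻¹) := by rw [c1]; group
        _ = _ := by rw [e2]; group
    have e5 : a * c * n * (a * c)⁻¹ = c * a * n * (c * a)⁻¹ := by
      rw [e3, e4, c1]
    have e6 : cm a⁻¹ c⁻¹ * n = n * cm a⁻¹ c⁻¹ := by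
      calc cm a⁻¹ c⁻¹ * n = (c * a)⁻¹ * (a * c * n * (a * c)⁻¹) * (a * c) := by rw [cm]; group
        _ = n * cm a⁻¹ c⁻¹ := by rw [e5, cm]; group
    exact congrArg Subtype.val e6
  have hZk : ∀ n ∈ Z, Sc (n ^ k) := by
    intro n hn
    refine scal_of_commute _ _ hZs ?_
    rintro _ ⟨a, ha, rfl⟩
    have h1 := hZZ a ha n hn
    have h2 := sc_pow_k _ h1
    have e1 : a * n * a⁻¹ = cm a n * n := by rw [cm]; group
    have c1 : Commute (cm a n) n := by
      have := sc_conj _ n h1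
      rw [mul_inv_eq_iff_eq_mul] at this
      exact this.symm
    have e2 : a * n ^ k * a⁻¹ = n ^ k := by
      rw [← conj_pow, e1, c1.mul_pow, h2, one_mul]
    rw [mul_inv_eq_iff_eq_mul] at e2
    exact congrArg Subtype.val e2.symm
  rcases Nat.eq_zero_or_pos k with rfl | hk
  · exact hF.inf (Set.toFinite _)
  have hZfin := finite_lemma Z hZs k hk hZk
  apply hF.inf
  obtain ⟨S', hS', hsp, hli⟩ := exists_linearIndependent K (mc '' (Z : Set (SLk k K)))
  rw [hZs] at hsp
  have hfin : Finite S' := hli.finite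
  have h2 : (Set.pi Set.univ fun _ : S' => mc '' (Z : Set (SLk k K))).Finite :=
    Set.Finite.pi' (fun _ => hZfin.image _) |>.subset (fun f hf i => hf i trivial)
  refine Set.Finite.of_finite_fibers (fun (g : SLk k K) (s : S') => g.1 * s.1 * (g⁻¹).1) (h2.subset ?_) ?_
  · rintro _ ⟨g, hg, rfl⟩ s _
    obtain ⟨z, hz, hzs⟩ := hS' s.2
    exact ⟨g * z * g⁻¹, hZn g hg z hz, by
      change _ = g.1 * s.1 * (g⁻¹).1
      rw [← hzs]; rfl⟩
  · rintro y -
    by_cases hne : ∃ g₀ ∈ G, (fun (s : S') => g₀.1 * s.1 * (g₀⁻¹).1) = y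
    · obtain ⟨g₀, hg₀, rfl⟩ := hne
      refine (sc_finite.image fun x => g₀ * x).subset ?_
      rintro g ⟨hg, hgy⟩
      refine ⟨g₀⁻¹ * g, ?_, by group⟩
      refine scal_of_commute _ _ hsp ?_
      intro s hs
      obtain ⟨z, hz, hzs⟩ := hS' hs
      have h3 : g.1 * s * (g⁻¹).1 = g₀.1 * s * (g₀⁻¹).1 := congrFun hgy ⟨s, hs⟩
      rw [← hzs] at h3 ⊢
      have h4 : g * z * g⁻¹ = g₀ * z * g₀⁻¹ := Subtype.ext h3
      have h5 : g₀⁻¹ * g * z = z * (g₀⁻¹ * g) := by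
        calc g₀⁻¹ * g * z = g₀⁻¹ * (g * z * g⁻¹) * g := by group
          _ = _ := by rw [h4]; group
      exact congrArg Subtype.val h5
    · convert Set.finite_empty
      ext g
      simp only [Set.mem_inter_iff, Set.mem_preimage, Set.mem_singleton_iff, Set.mem_empty_iff_false,
        iff_false, not_and]
      exact fun hg he => hne ⟨g, hg, he⟩
end
end USG
end PartP4c

section PartP4d
set_option linter.unusedVariables false
set_option linter.unusedSectionVars false
open Module Pointwise

namespace USG

section
variable {K : Type} [Field K] {k : ℕ}

lemma pow_inv_mem {H : Type*} [Group H] {F : Set H} (hs : ∀ x ∈ F, x⁻¹ ∈ F) {n : ℕ} {x : H}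
    (hx : x ∈ F ^ n) : x⁻¹ ∈ F ^ n := by
  induction n generalizing x with
  | zero => simpa using hx
  | succ n ih =>
    rw [pow_succ] at hx
    obtain ⟨a, ha, b, hb, rfl⟩ := hx
    rw [pow_succ', mul_inv_rev]
    exact Set.mul_mem_mul (hs b hb) (ih ha)

lemma pow_mem_closure {H : Type*} [Group H] {F : Set H} (n : ℕ) :
    F ^ n ⊆ (Subgroup.closure F : Set H) := by
  induction n with
  | zero => simp
  | succ n ih =>
    rw [pow_succ]
    rintro _ ⟨a, ha, b, hb, rfl⟩
    exact mul_mem (ih ha) (Subgroup.subset_closure hb)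

lemma cm_mem {H : Type*} [Group H] {F : Set H} (hs : ∀ x ∈ F, x⁻¹ ∈ F) {m n : ℕ} {x y : H}
    (hx : x ∈ F ^ m) (hy : y ∈ F ^ n) : cm x y ∈ F ^ (2 * (m + n)) := by
  have : 2 * (m + n) = m + n + m + n := by ring
  rw [this, pow_add, pow_add, pow_add]
  exact Set.mul_mem_mul (Set.mul_mem_mul (Set.mul_mem_mul hx hy) (pow_inv_mem hs hx))
    (pow_inv_mem hs hy)

lemma conj_mem {H : Type*} [Group H] {F : Set H} (hs : ∀ x ∈ F, x⁻¹ ∈ F) {m n : ℕ} {x y : H}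
    (hx : x ∈ F ^ m) (hy : y ∈ F ^ n) : x * y * x⁻¹ ∈ F ^ (2 * m + n) := by
  have : 2 * m + n = m + n + m := by ring
  rw [this, pow_add, pow_add]
  exact Set.mul_mem_mul (Set.mul_mem_mul hx hy) (pow_inv_mem hs hx)

lemma Good.lemmaS' [IsAlgClosed K] {F : Set (SLk k K)} (hF : Good F) (A B : SLk k K)
    (hA : A ∈ Subgroup.closure F) (hB : B ∈ Subgroup.closure F) (hA' : ¬ Sc A) (hB' : ¬ Sc B) :
    ∃ h ∈ F ^ ((k ^ 2) ^ 4), ¬ Sc (cm A (h * B * h⁻¹)) := by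
  by_contra! hcon
  obtain ⟨h, hh, hh'⟩ := hF.lemmaS A B hA hB hA' hB'
  apply hh'
  have hbd : BD K ((k ^ 2) ^ 4) (fun h : SLk k K => A.1 * h.1 * B.1 * (h⁻¹).1 * (A⁻¹).1 * h.1 *
      (B⁻¹).1 * (h⁻¹).1) := by
    have h1 := ((((((((BD.const (K := K) (H := SLk k K) A.1).mul BD.coe).mul (BD.const B.1)).mul
      BD.coe_inv).mul (BD.const (A⁻¹).1)).mul BD.coe).mul (BD.const (B⁻¹).1)).mul BD.coe_inv)
    refine h1.mono (le_of_eq ?_)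
    ring
  have e : ∀ h : SLk k K, (cm A (h * B * h⁻¹)).1 = A.1 * h.1 * B.1 * (h⁻¹).1 * (A⁻¹).1 * h.1 *
      (B⁻¹).1 * (h⁻¹).1 := by
    intro h
    have : cm A (h * B * h⁻¹) = A * h * B * h⁻¹ * A⁻¹ * h * B⁻¹ * h⁻¹ := by rw [cm]; group
    rw [this]; rfl
  have := hbd.mem hF.one hF.symm (scal k K) (fun x hx => by
    rw [← e]; exact hcon x hx) h hh
  rw [← e] at this
  exact this

/-- length bound for the law words -/
def lawLen (k M : ℕ) : ℕ → ℕ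
  | 0 => (k ^ 2) ^ M.factorial
  | j + 1 => 2 * (2 * (lawLen k M j + (2 * (k ^ 2) ^ 4 + lawLen k M j)) +
      (2 * (k ^ 2) ^ 4 + (k ^ 2) ^ M.factorial * (j + 1)))

structure Law {H : Type*} [Group H] (M : ℕ) (x : H) (c g h : ℕ → H) : Prop where
  zero : c 0 = x
  step : ∀ j < M, c (j + 1) = cm (cm (c j) (g j * c j * (g j)⁻¹)) (h j * x ^ (j + 1) * (h j)⁻¹)
  step' : ∀ j, M ≤ j → c (j + 1) = cm (c j) (g j * c j * (g j)⁻¹)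

lemma Good.law [IsAlgClosed K] {F : Set (SLk k K)} (hF : Good F) (M : ℕ) :
    ∃ (x : SLk k K) (c g h : ℕ → SLk k K), Law M x c g h ∧
      (∀ j, g j ∈ F ^ ((k ^ 2) ^ 4)) ∧ (∀ j, h j ∈ F ^ ((k ^ 2) ^ 4)) ∧
      (∀ j, c j ∈ F ^ (lawLen k M j)) ∧ ∀ j, ¬ Sc (c j) := by
  classical
  obtain ⟨x, hx, hxM⟩ := hF.pow_nonsc M.factorial (Nat.factorial_pos M)
  have hxc : x ∈ Subgroup.closure F := pow_mem_closure _ hx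
  have hxj : ∀ j < M, ¬ Sc (x ^ (j + 1)) := by
    intro j hj hsc
    obtain ⟨t, ht⟩ := Nat.dvd_factorial (Nat.succ_pos j) hj
    apply hxM
    rw [ht, pow_mul]
    exact sc_pow _ hsc t
  have hS : ∀ A B : SLk k K, ∃ h ∈ F ^ ((k ^ 2) ^ 4), A ∈ Subgroup.closure F →
      B ∈ Subgroup.closure F → ¬ Sc A → ¬ Sc B → ¬ Sc (cm A (h * B * h⁻¹)) := by
    intro A B
    by_cases hh : A ∈ Subgroup.closure F ∧ B ∈ Subgroup.closure F ∧ ¬ Sc A ∧ ¬ Sc B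
    · obtain ⟨h, h1, h2⟩ := hF.lemmaS' A B hh.1 hh.2.1 hh.2.2.1 hh.2.2.2
      exact ⟨h, h1, fun _ _ _ _ => h2⟩
    · exact ⟨1, Set.one_mem_pow hF.one, fun a b c d => absurd ⟨a, b, c, d⟩ hh⟩
  choose s hs1 hs2 using hS
  let inner : SLk k K → SLk k K := fun c => cm c (s c c * c * (s c c)⁻¹)
  let c : ℕ → SLk k K := fun n => Nat.rec x (fun j cj => if j < M then
    cm (inner cj) (s (inner cj) (x ^ (j + 1)) * x ^ (j + 1) * (s (inner cj) (x ^ (j + 1)))⁻¹)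
    else inner cj) n
  have hc : ∀ j, c (j + 1) = if j < M then
    cm (inner (c j)) (s (inner (c j)) (x ^ (j + 1)) * x ^ (j + 1) *
      (s (inner (c j)) (x ^ (j + 1)))⁻¹) else inner (c j) := fun j => rfl
  have hmain : ∀ j, c j ∈ F ^ (lawLen k M j) ∧ ¬ Sc (c j) := by
    intro j
    induction j with
    | zero => exact ⟨hx, fun h => hxM (sc_pow _ h _)⟩
    | succ j ih =>
      obtain ⟨h1, h2⟩ := ih
      have hcc := pow_mem_closure _ h1
      have hi1 : inner (c j) ∈ F ^ (2 * (lawLen k M j + (2 * (k ^ 2) ^ 4 + lawLen k M j))) :=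
        cm_mem hF.symm h1 (conj_mem hF.symm (hs1 _ _) h1)
      have hi2 : ¬ Sc (inner (c j)) := hs2 _ _ hcc hcc h2 h2
      rw [hc]
      split_ifs with hj
      · refine ⟨cm_mem hF.symm hi1 (conj_mem hF.symm (hs1 _ _) ?_),
          hs2 _ _ (pow_mem_closure _ hi1) (pow_mem hxc _) hi2 (hxj j hj)⟩
        rw [pow_mul]
        exact Set.pow_mem_pow hx
      · refine ⟨Set.pow_subset_pow_right hF.one ?_ hi1, hi2⟩
        rw [lawLen]; omega
  refine ⟨x, c, fun j => s (c j) (c j), fun j => s (inner (c j)) (x ^ (j + 1)),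
    ⟨rfl, ?_, ?_⟩, fun j => hs1 _ _, fun j => hs1 _ _, fun j => (hmain j).1, fun j => (hmain j).2⟩
  · intro j hj
    rw [hc, if_pos hj]
  · intro j hj
    rw [hc, if_neg (not_lt.2 hj)]

end
end USG
end PartP4d

section PartP9
set_option linter.unusedVariables false
set_option linter.unusedSectionVars false
open Module Pointwise

namespace USG

section
variable {k : ℕ} {H : Type*} [Group H]

/-- operator bound with respect to a norm-like function -/
def Bdd (N : (Fin k → ℂ) → ℝ) (X : Matrix (Fin k) (Fin k) ℂ) (c : ℝ) : Prop :=
  0 ≤ c ∧ ∀ v, N (X.mulVec v) ≤ c * N v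

lemma Bdd.mul {N : (Fin k → ℂ) → ℝ} {X Y : Matrix (Fin k) (Fin k) ℂ} {c d : ℝ}
    (hX : Bdd N X c) (hY : Bdd N Y d) : Bdd N (X * Y) (c * d) := by
  refine ⟨mul_nonneg hX.1 hY.1, fun v => ?_⟩
  rw [← Matrix.mulVec_mulVec, mul_assoc]
  exact (hX.2 _).trans (mul_le_mul_of_nonneg_left (hY.2 v) hX.1)

lemma Bdd.mono {N : (Fin k → ℂ) → ℝ} (hN0 : ∀ v, 0 ≤ N v) {X : Matrix (Fin k) (Fin k) ℂ} {c d : ℝ}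
    (hX : Bdd N X c) (h : c ≤ d) : Bdd N X d :=
  ⟨hX.1.trans h, fun v => (hX.2 v).trans (mul_le_mul_of_nonneg_right h (hN0 v))⟩

lemma Bdd.sub {N : (Fin k → ℂ) → ℝ} (hN : ∀ v w, N (v - w) ≤ N v + N w)
    {X Y : Matrix (Fin k) (Fin k) ℂ} {c d : ℝ}
    (hX : Bdd N X c) (hY : Bdd N Y d) : Bdd N (X - Y) (c + d) := by
  refine ⟨add_nonneg hX.1 hY.1, fun v => ?_⟩
  rw [Matrix.sub_mulVec, add_mul]
  exact (hN _ _).trans (add_le_add (hX.2 v) (hY.2 v))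

structure NN (ρ : H →* Matrix (Fin k) (Fin k) ℂ) (N : (Fin k → ℂ) → ℝ) : Prop where
  nonneg : ∀ v, 0 ≤ N v
  sub : ∀ v w, N (v - w) ≤ N v + N w
  neg : ∀ v, N (- v) = N v
  inv : ∀ g v, N ((ρ g).mulVec v) ≤ N v

variable {ρ : H →* Matrix (Fin k) (Fin k) ℂ} {N : (Fin k → ℂ) → ℝ}

lemma NN.rho (h : NN ρ N) (g : H) : Bdd N (ρ g) 1 := ⟨by norm_num, fun v => by simpa using h.inv g v⟩

lemma NN.two (h : NN ρ N) (g : H) : Bdd N (ρ g - 1) 2 := by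
  have := (h.rho g).sub h.sub (h.rho 1)
  rw [map_one] at this
  convert this using 1; norm_num

lemma NN.inv' (h : NN ρ N) {g : H} {s : ℝ} (hg : Bdd N (ρ g - 1) s) : Bdd N (ρ g⁻¹ - 1) s := by
  have h1 : ρ g⁻¹ * (1 - ρ g) = ρ g⁻¹ - 1 := by
    rw [mul_sub, ← map_mul]; simp
  have h2 : Bdd N (1 - ρ g) s := by
    refine ⟨hg.1, fun v => ?_⟩
    rw [← h.neg, ← Matrix.neg_mulVec, neg_sub]
    exact hg.2 v
  have := (h.rho g⁻¹).mul h2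
  rwa [h1, one_mul] at this

lemma NN.conj (h : NN ρ N) {g : H} {s : ℝ} (hg : Bdd N (ρ g - 1) s) (a : H) :
    Bdd N (ρ (a * g * a⁻¹) - 1) s := by
  have h1 : ρ a * (ρ g - 1) * ρ a⁻¹ = ρ (a * g * a⁻¹) - 1 := by
    rw [mul_sub, sub_mul, ← map_mul, ← map_mul, mul_one, ← map_mul]; simp
  have := ((h.rho a).mul hg).mul (h.rho a⁻¹)
  rwa [h1, one_mul, mul_one] at this

lemma NN.mul (h : NN ρ N) {x y : H} {s t : ℝ} (hx : Bdd N (ρ x - 1) s) (hy : Bdd N (ρ y - 1) t) :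
    Bdd N (ρ (x * y) - 1) (s + t) := by
  have h1 : ρ x * (ρ y - 1) - (1 - ρ x) = ρ (x * y) - 1 := by
    rw [mul_sub, map_mul]; noncomm_ring
  have h2 : Bdd N (1 - ρ x) s := by
    refine ⟨hx.1, fun v => ?_⟩
    rw [← h.neg, ← Matrix.neg_mulVec, neg_sub]
    exact hx.2 v
  have := ((h.rho x).mul hy).sub h.sub h2
  rw [h1, one_mul] at this
  rwa [add_comm]

lemma NN.cm_left (h : NN ρ N) {x y : H} {s : ℝ} (hx : Bdd N (ρ x - 1) s) :
    Bdd N (ρ (cm x y) - 1) (2 * s) := by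
  have := h.mul hx (h.conj (h.inv' hx) y)
  have e : x * (y * x⁻¹ * y⁻¹) = cm x y := by rw [cm]; group
  rw [e] at this
  rwa [two_mul]

lemma NN.cm_right (h : NN ρ N) {x y : H} {s : ℝ} (hx : Bdd N (ρ y - 1) s) :
    Bdd N (ρ (cm x y) - 1) (2 * s) := by
  have := h.mul (h.conj hx x) (h.inv' hx)
  rw [two_mul]; exact this

lemma NN.cm_both (h : NN ρ N) {x y : H} {s t : ℝ} (hx : Bdd N (ρ x - 1) s)
    (hy : Bdd N (ρ y - 1) t) : Bdd N (ρ (cm x y) - 1) (2 * (s * t)) := by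
  have h1 : ((ρ x - 1) * (ρ y - 1) - (ρ y - 1) * (ρ x - 1)) * ρ (x⁻¹ * y⁻¹) = ρ (cm x y) - 1 := by
    have e1 : (ρ x - 1) * (ρ y - 1) - (ρ y - 1) * (ρ x - 1) = ρ (x * y) - ρ (y * x) := by
      rw [map_mul, map_mul]; noncomm_ring
    rw [e1, sub_mul, ← map_mul, ← map_mul]
    have e2 : y * x * (x⁻¹ * y⁻¹) = 1 := by group
    have e3 : x * y * (x⁻¹ * y⁻¹) = cm x y := by rw [cm]; group
    rw [e2, e3, map_one]
  have := ((hx.mul hy).sub h.sub (hy.mul hx)).mul (h.rho (x⁻¹ * y⁻¹))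
  rw [h1, mul_one] at this
  convert this using 1; ring

lemma NN.law (h : NN ρ N) {M : ℕ} {x : H} {c g l : ℕ → H} (hl : Law M x c g l) {j : ℕ}
    (hj1 : 1 ≤ j) (hj : j ≤ M) (hx : Bdd N (ρ (x ^ j) - 1) (1 / 8)) (r : ℕ) :
    Bdd N (ρ (c (M + r)) - 1) (1 / 4 * (1 / 2) ^ r) := by
  have h1 : ∀ i, j + i ≤ M → Bdd N (ρ (c (j + i)) - 1) (1 / 4) := by
    intro i
    induction i with
    | zero =>
      intro _
      obtain ⟨j', rfl⟩ : ∃ j', j = j' + 1 := ⟨j - 1, by omega⟩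
      rw [add_zero, hl.step j' (by omega)]
      have := h.cm_right (x := cm (c j') (g j' * c j' * (g j')⁻¹)) (h.conj hx (l j'))
      convert this using 1; norm_num
    | succ i ih =>
      intro hi
      have := ih (by omega)
      rw [← add_assoc, hl.step _ (by omega)]
      have h2 := h.cm_both this (h.conj this (g (j + i)))
      have h3 := h.cm_left (y := l (j + i) * x ^ (j + i + 1) * (l (j + i))⁻¹) h2
      convert h3 using 1; norm_num
  induction r with
  | zero =>
    have := h1 (M - j) (by omega)
    rw [Nat.add_sub_cancel' hj] at this
    simpa using this
  | succ r ih =>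
    rw [← add_assoc, hl.step' _ (by omega)]
    refine Bdd.mono h.nonneg (h.cm_both ih (h.conj ih (g (M + r)))) ?_
    have h5 : (0 : ℝ) < (1 / 2) ^ r := by positivity
    have h6 : ((1 : ℝ) / 2) ^ r ≤ 1 := pow_le_one₀ (by norm_num) (by norm_num)
    rw [pow_succ]
    nlinarith

/-- Almost law. -/
theorem almost_law (k : ℕ) (C δ : ℝ) (hδ : 0 < δ) : ∃ M r : ℕ, ∀ (H : Type) [Group H]
    (ρ : H →* Matrix (Fin k) (Fin k) ℂ), (∀ g i j, ‖ρ g i j‖ ≤ C) →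
    ∀ (x : H) (c g l : ℕ → H), Law M x c g l → ∀ u : H,
      ‖((ρ (c (M + r)) - 1) * ρ u).trace‖ ≤ δ := by
  classical
  rcases Nat.eq_zero_or_pos k with rfl | hk
  · exact ⟨0, 0, fun H _ ρ _ x c g l _ u => by simp [Matrix.trace]; exact hδ.le⟩
  set C' : ℝ := max C 1 with hC'
  have hC1 : 1 ≤ C' := le_max_right _ _
  have hk1 : (1 : ℝ) ≤ k := by exact_mod_cast hk
  set A : ℝ := k * C' with hA
  have hA1 : 1 ≤ A := by nlinarith
  set η : ℝ := 1 / (8 * A * k) with hη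
  have hηpos : 0 < η := by positivity
  -- totally bounded
  have htb : TotallyBounded (Metric.closedBall (0 : Fin k → Fin k → ℂ) C') :=
    (isCompact_closedBall _ _).totallyBounded
  obtain ⟨t, ht, hcov⟩ := Metric.totallyBounded_iff.1 htb (η / 2) (by positivity)
  set M := ht.toFinset.card with hM
  obtain ⟨r, hr⟩ := exists_pow_lt_of_lt_one (x := δ / (k * A)) (y := (1 : ℝ) / 2) (by positivity) (by norm_num)
  refine ⟨M, r, fun H _ ρ hρ x c g l hl u => ?_⟩
  have hρ' : ∀ g i j, ‖ρ g i j‖ ≤ C' := fun g i j => (hρ g i j).trans (le_max_left _ _)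
  have hmv : ∀ (X : Matrix (Fin k) (Fin k) ℂ) (B : ℝ), 0 ≤ B → (∀ i j, ‖X i j‖ ≤ B) → ∀ v : Fin k → ℂ,
      ‖X.mulVec v‖ ≤ k * B * ‖v‖ := by
    intro X B hB hX v
    rw [pi_norm_le_iff_of_nonneg (by positivity)]
    intro i
    rw [Matrix.mulVec, dotProduct]
    refine (norm_sum_le _ _).trans ?_
    have : ∀ j ∈ (Finset.univ : Finset (Fin k)), ‖X i j * v j‖ ≤ B * ‖v‖ := by
      intro j _
      rw [norm_mul]
      exact mul_le_mul (hX i j) (norm_le_pi_norm v j) (norm_nonneg _) hB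
    refine (Finset.sum_le_card_nsmul _ _ _ this).trans ?_
    simp [mul_assoc]
  set N : (Fin k → ℂ) → ℝ := fun v => ⨆ g : H, ‖(ρ g).mulVec v‖ with hN
  have hbdd : ∀ v, BddAbove (Set.range fun g : H => ‖(ρ g).mulVec v‖) := by
    intro v
    refine ⟨A * ‖v‖, ?_⟩
    rintro _ ⟨g, rfl⟩
    exact hmv _ _ (by positivity) (hρ' g) v
  have hNle : ∀ v, N v ≤ A * ‖v‖ := fun v => ciSup_le fun g => hmv _ _ (by positivity) (hρ' g) v
  have hleN : ∀ v, ‖v‖ ≤ N v := by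
    intro v
    have := le_ciSup (hbdd v) 1
    simpa using this
  have hNN : NN ρ N := by
    refine ⟨fun v => (norm_nonneg v).trans (hleN v), ?_, ?_, ?_⟩
    · intro v w
      refine ciSup_le fun g => ?_
      rw [Matrix.mulVec_sub]
      exact (norm_sub_le _ _).trans (add_le_add (le_ciSup (hbdd v) g) (le_ciSup (hbdd w) g))
    · intro v
      simp only [hN, Matrix.mulVec_neg, norm_neg]
    · intro g v
      refine ciSup_le fun g' => ?_
      rw [Matrix.mulVec_mulVec, ← map_mul]
      exact le_ciSup (hbdd v) (g' * g)
  let fl : ℕ → Fin k → Fin k → ℂ := fun i a b => ρ (x ^ i) a b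
  have hmem : ∀ i : ℕ, ∃ y ∈ ht.toFinset, dist (fl i) y < η / 2 := by
    intro i
    have : fl i ∈ Metric.closedBall (0 : Fin k → Fin k → ℂ) C' := by
      rw [mem_closedBall_zero_iff, pi_norm_le_iff_of_nonneg (by positivity)]
      intro a
      rw [pi_norm_le_iff_of_nonneg (by positivity)]
      exact fun b => hρ' _ a b
    have := hcov this
    simp only [Set.mem_iUnion, Metric.mem_ball] at this
    obtain ⟨y, hy, hy'⟩ := this
    exact ⟨y, by simpa using hy, hy'⟩
  choose y hy hy' using hmem
  obtain ⟨i, hi, j, hj, hij, hyij⟩ := Finset.exists_ne_map_eq_of_card_lt_of_maps_to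
    (s := Finset.range (M + 1)) (t := ht.toFinset) (by simp [hM]) (f := y) (fun i _ => hy i)
  have key : ∀ i j, i < j → j ≤ M → y i = y j → ∃ j, 1 ≤ j ∧ j ≤ M ∧ Bdd N (ρ (x ^ j) - 1) (1 / 8) := by
    intro i j hij hj hyij
    refine ⟨j - i, by omega, by omega, by norm_num, fun v => ?_⟩
    have e1 : ρ (x ^ i) * (ρ (x ^ (j - i)) - 1) = ρ (x ^ j) - ρ (x ^ i) := by
      rw [mul_sub, ← map_mul, ← pow_add, Nat.add_sub_cancel' hij.le, mul_one]
    have e0 : ρ (x ^ i)⁻¹ * (ρ (x ^ j) - ρ (x ^ i)) = ρ (x ^ (j - i)) - 1 := by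
      rw [← e1, ← mul_assoc, ← map_mul]; simp
    have e2 : ∀ a b, ‖(ρ (x ^ j) - ρ (x ^ i)) a b‖ ≤ η := by
      intro a b
      have h1 := hy' i
      have h2 := hy' j
      rw [hyij] at h1
      have h3 : dist (fl j) (fl i) ≤ η := by
        refine (dist_triangle_right _ _ (y j)).trans ?_
        linarith
      have h4 := (dist_le_pi_dist _ _ b).trans ((dist_le_pi_dist _ _ a).trans h3)
      rwa [dist_eq_norm] at h4
    rw [← e0, ← Matrix.mulVec_mulVec]
    refine (hNN.inv _ _).trans ((hNle _).trans ?_)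
    have h5 := hmv _ η hηpos.le e2 v
    have h6 := hleN v
    calc A * ‖(ρ (x ^ j) - ρ (x ^ i)).mulVec v‖ ≤ A * (k * η * ‖v‖) := by gcongr
      _ = 1 / 8 * ‖v‖ := by rw [hη]; field_simp
      _ ≤ 1 / 8 * N v := by gcongr
  obtain ⟨j, hj1, hjM, hjB⟩ : ∃ j, 1 ≤ j ∧ j ≤ M ∧ Bdd N (ρ (x ^ j) - 1) (1 / 8) := by
    simp only [Finset.mem_range] at hi hj
    rcases lt_or_gt_of_ne hij with h | h
    · exact key i j h (by omega) hyij
    · exact key j i h (by omega) hyij.symm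
  have hfin := (hNN.law hl hj1 hjM hjB r).mul (hNN.rho u)
  set X := (ρ (c (M + r)) - 1) * ρ u
  have hent : ∀ i, ‖X i i‖ ≤ 1 / 4 * (1 / 2) ^ r * A := by
    intro i
    have h1 := hfin.2 (Pi.single i 1)
    have h2 := (hleN _).trans h1
    have h3 := norm_le_pi_norm (X.mulVec (Pi.single i 1)) i
    rw [Matrix.mulVec_single_one] at h3
    have h4 := hNle (Pi.single i (1 : ℂ))
    have h5 : ‖(Pi.single i (1 : ℂ) : Fin k → ℂ)‖ = 1 := by rw [Pi.norm_single]; simp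
    rw [h5, mul_one] at h4
    rw [Matrix.mulVec_single_one] at h2
    refine h3.trans (h2.trans ?_)
    rw [mul_one]
    gcongr
  rw [Matrix.trace]
  refine (norm_sum_le _ _).trans ((Finset.sum_le_card_nsmul _ _ _ fun i _ => hent i).trans ?_)
  simp only [Finset.card_univ, Fintype.card_fin, nsmul_eq_mul]
  have h7 : (1 / 2 : ℝ) ^ r * (k * A) ≤ δ := by
    rw [lt_div_iff₀ (by positivity)] at hr
    exact hr.le
  have h8 : 0 ≤ (1 / 2 : ℝ) ^ r * (k * A) := by positivity
  linarith

end
end USG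
end PartP9

section PartP5a
set_option linter.unusedVariables false
set_option linter.unusedSectionVars false
open Module Pointwise Cardinal

namespace USG

/-- Embedding lemma -/
lemma exists_embed {R K Ω : Type} [CommRing R] [IsDomain R] [Field K] [Field Ω] [IsAlgClosed Ω] [Countable R] [Countable K]
    (hΩ : Uncountable Ω) (i : R →+* K) (j : R →+* Ω) (hi : Function.Injective i)
    (hj : Function.Injective j) : ∃ φ : K →+* Ω, ∀ r, φ (i r) = j r := by
  letI := i.toAlgebra
  letI := j.toAlgebra
  haveI : FaithfulSMul R K := (faithfulSMul_iff_algebraMap_injective R K).2 hi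
  haveI : FaithfulSMul R Ω := (faithfulSMul_iff_algebraMap_injective R Ω).2 hj
  obtain ⟨s, hs⟩ := exists_isTranscendenceBasis R K
  obtain ⟨t, ht⟩ := exists_isTranscendenceBasis R Ω
  have htc : ¬ Countable t := by
    intro hc
    have h1 := IsAlgClosed.cardinal_le_max_transcendence_basis' _ ht
    have h2 : #Ω ≤ ℵ₀ := h1.trans (max_le (max_le (mk_le_aleph0_iff.2 inferInstance) (mk_le_aleph0_iff.2 hc)) le_rfl)
    exact hΩ.not_countable (mk_le_aleph0_iff.1 h2)
  have hle : #s ≤ #t := by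
    have h1 : #s ≤ ℵ₀ := mk_le_aleph0_iff.2 inferInstance
    have h2 : ℵ₀ ≤ #t := le_of_lt (not_le.1 fun h => htc (mk_le_aleph0_iff.1 h))
    exact h1.trans h2
  obtain ⟨e⟩ := hle
  have hy : AlgebraicIndependent R (fun x : s => ((e x : t) : Ω)) := ht.1.comp e e.injective
  let A := Algebra.adjoin R (Set.range ((↑) : s → K))
  let ψ : A →ₐ[R] Ω := (MvPolynomial.aeval (fun x : s => ((e x : t) : Ω))).comp hs.1.aevalEquiv.symm.toAlgHom
  have hψ : Function.Injective ψ := by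
    have : Function.Injective (MvPolynomial.aeval (R := R) (fun x : s => ((e x : t) : Ω))) := hy
    exact this.comp hs.1.aevalEquiv.symm.injective
  letI : Algebra A Ω := ψ.toRingHom.toAlgebra
  haveI : FaithfulSMul A Ω := (faithfulSMul_iff_algebraMap_injective A Ω).2 hψ
  haveI : Algebra.IsAlgebraic A K := hs.isAlgebraic
  haveI : IsTorsionFree A Ω := inferInstance
  haveI : IsTorsionFree A K := inferInstance
  let φ : K →ₐ[A] Ω := IsAlgClosed.lift
  refine ⟨φ.toRingHom, fun r => ?_⟩
  have h1 : i r = algebraMap A K (algebraMap R A r) := by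
    rw [← IsScalarTower.algebraMap_apply]; rfl
  rw [h1]
  change φ _ = _
  rw [φ.commutes]
  change ψ _ = _
  rw [ψ.commutes]; rfl

/-- Transcendental version -/
lemma exists_embed_tr {F K Ω : Type} [Field F] [Field K] [Field Ω] [IsAlgClosed Ω] [Countable F] [Countable K]
    [Algebra F K] [Algebra F Ω]
    (hΩ : Uncountable Ω) (t : K) (β : Ω) (ht : Transcendental F t) (hβ : Transcendental F β) :
    ∃ φ : K →+* Ω, φ t = β := by
  haveI : Countable (Polynomial F) := by
    rw [← mk_le_aleph0_iff]
    exact (Polynomial.cardinalMk_le_max).trans (max_le (mk_le_aleph0_iff.2 inferInstance) le_rfl)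
  obtain ⟨φ, hφ⟩ := exists_embed hΩ (Polynomial.aeval (R := F) t).toRingHom
    (Polynomial.aeval (R := F) β).toRingHom (transcendental_iff_injective.1 ht)
    (transcendental_iff_injective.1 hβ)
  refine ⟨φ, ?_⟩
  have := hφ Polynomial.X
  simpa using this

/-- Algebraic version -/
lemma exists_embed_alg {F K Ω : Type} [Field F] [Field K] [Field Ω] [IsAlgClosed Ω] [Countable F] [Countable K]
    [Algebra F K] [Algebra F Ω]
    (hΩ : Uncountable Ω) (t : K) (β : Ω) (ht : IsIntegral F t) (hβ : Polynomial.aeval β (minpoly F t) = 0) :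
    ∃ φ : K →+* Ω, φ t = β := by
  have hirr := minpoly.irreducible ht
  haveI : Fact (Irreducible (minpoly F t)) := ⟨hirr⟩
  haveI : Countable (Polynomial F) := by
    rw [← mk_le_aleph0_iff]
    exact (Polynomial.cardinalMk_le_max).trans (max_le (mk_le_aleph0_iff.2 inferInstance) le_rfl)
  haveI : Countable (AdjoinRoot (minpoly F t)) := (AdjoinRoot.mk_surjective (g := minpoly F t)).countable
  obtain ⟨φ, hφ⟩ := exists_embed (R := AdjoinRoot (minpoly F t)) hΩ (AdjoinRoot.lift (algebraMap F K) t (by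
      rw [← Polynomial.aeval_def]; exact minpoly.aeval F t))
    (AdjoinRoot.lift (algebraMap F Ω) β (by rw [← Polynomial.aeval_def]; exact hβ))
      (RingHom.injective _) (RingHom.injective _)
  refine ⟨φ, ?_⟩
  have := hφ (AdjoinRoot.root _)
  simpa using this

/-- The absolute value on the algebraic closure. -/
lemma exists_abs (E : Type) [NontriviallyNormedField E] [CompleteSpace E] [IsUltrametricDist E] :
    Uncountable (AlgebraicClosure E) ∧ ∃ a : AbsoluteValue (AlgebraicClosure E) ℝ, IsNonarchimedean a ∧
      ∀ x : E, a (algebraMap E _ x) = ‖x‖ := by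
  constructor
  · have h1 : 𝔠 ≤ #E := continuum_le_cardinal_of_nontriviallyNormedField E
    have h2 : Uncountable E := by
      rw [← aleph0_lt_mk_iff]; exact aleph0_lt_continuum.trans_le h1
    exact (algebraMap E (AlgebraicClosure E)).injective.uncountable
  · refine ⟨⟨⟨spectralNorm E (AlgebraicClosure E), fun x y => ?_⟩, fun x => spectralNorm_nonneg x, fun x => ⟨fun h => ?_, fun h => ?_⟩, fun x y => ?_⟩, ?_, ?_⟩
    · exact spectralAlgNorm_mul x y
    · exact eq_zero_of_map_spectralNorm_eq_zero h (Algebra.IsAlgebraic.isAlgebraic x)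
    · change spectralNorm E (AlgebraicClosure E) x = 0
      rw [h]; exact spectralNorm_zero
    · have h1 := isNonarchimedean_spectralNorm (K := E) (L := AlgebraicClosure E) x y
      refine h1.trans (max_le_add_of_nonneg (spectralNorm_nonneg _) (spectralNorm_nonneg _))
    · exact isNonarchimedean_spectralNorm
    · exact spectralNorm_extends

lemma mprod_le {α : Type} (s : Multiset α) (f : α → ℝ) (h0 : ∀ x ∈ s, 0 ≤ f x) (h1 : ∀ x ∈ s, f x ≤ 1) :
    0 ≤ (s.map f).prod ∧ (s.map f).prod ≤ 1 := by
  induction s using Multiset.induction with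
  | empty => simp
  | cons a s ih =>
    have h := ih (fun x hx => h0 x (Multiset.mem_cons_of_mem hx)) (fun x hx => h1 x (Multiset.mem_cons_of_mem hx))
    have h2 := h0 a (Multiset.mem_cons_self a s)
    have h3 := h1 a (Multiset.mem_cons_self a s)
    rw [Multiset.map_cons, Multiset.prod_cons]
    exact ⟨mul_nonneg h2 h.1, mul_le_one₀ h3 h.1 h.2⟩

lemma mprod_lt {α : Type} (s : Multiset α) (f : α → ℝ) (h0 : ∀ x ∈ s, 0 ≤ f x) (h1 : ∀ x ∈ s, f x < 1)
    (hs : s ≠ 0) : (s.map f).prod < 1 := by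
  induction s using Multiset.induction with
  | empty => exact absurd rfl hs
  | cons a s ih =>
    have h := mprod_le s f (fun x hx => h0 x (Multiset.mem_cons_of_mem hx)) (fun x hx => (h1 x (Multiset.mem_cons_of_mem hx)).le)
    have h2 := h0 a (Multiset.mem_cons_self a s)
    have h3 := h1 a (Multiset.mem_cons_self a s)
    rw [Multiset.map_cons, Multiset.prod_cons]
    exact lt_of_le_of_lt (mul_le_of_le_one_right h2 h.2) h3

lemma abs_comp {K Ω : Type} [Field K] [Field Ω] (φ : K →+* Ω) (a : AbsoluteValue Ω ℝ)
    (ha : IsNonarchimedean a) : ∃ b : AbsoluteValue K ℝ, IsNonarchimedean b ∧ ∀ x, b x = a (φ x) := by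
  refine ⟨a.comp φ.injective, fun x y => ?_, fun x => rfl⟩
  change a (φ (x + y)) ≤ max (a (φ x)) (a (φ y))
  rw [map_add]
  exact ha _ _

lemma abs_coeff_zero {F Ω : Type} [Field F] [Field Ω] [IsAlgClosed Ω] [Algebra F Ω]
    (P : Polynomial F) (hP : P.Monic) (a : AbsoluteValue Ω ℝ) :
    a (algebraMap F Ω (P.coeff 0)) = ((P.aroots Ω).map a).prod := by
  have h1 : (P.map (algebraMap F Ω)).Splits := IsAlgClosed.splits _
  have h2 := h1.coeff_zero_eq_prod_roots_of_monic (hP.map _)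
  rw [Polynomial.coeff_map] at h2
  rw [h2, map_mul, map_pow, AbsoluteValue.map_neg, map_one, one_pow, one_mul]
  rw [← map_multiset_prod]

lemma place0 {K : Type} [Field K] [CharZero K] [Countable K] (Q : K) (hQ : Q ≠ 0) :
    (∃ ι : K →+* ℂ, 1 ≤ ‖ι Q‖) ∨ ∃ a : AbsoluteValue K ℝ, IsNonarchimedean a ∧ 1 < a Q := by
  have hC : Uncountable ℂ := by
    rw [← aleph0_lt_mk_iff, Cardinal.mk_complex]; exact aleph0_lt_continuum
  by_cases ht : IsAlgebraic ℚ Q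
  · have hIntg := ht.isIntegral
    set P := minpoly ℚ Q with hP
    have hPm : P.Monic := minpoly.monic hIntg
    set c := P.coeff 0 with hc
    have hc0 : c ≠ 0 := fun h => hQ ((minpoly.coeff_zero_eq_zero hIntg).1 h)
    by_cases hp : ∃ p : ℕ, ∃ _ : Fact p.Prime, 1 < ‖(c : ℚ_[p])‖
    · right
      obtain ⟨p, hpp, h1⟩ := hp
      obtain ⟨hunc, a, hna, hext⟩ := exists_abs ℚ_[p]
      have h2 := abs_coeff_zero (Ω := AlgebraicClosure ℚ_[p]) P hPm a
      have h3 : a (algebraMap ℚ (AlgebraicClosure ℚ_[p]) c) = ‖(c : ℚ_[p])‖ := by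
        rw [← hext]; congr 1
      rw [← hc, h3] at h2
      rw [h2] at h1
      have : ∃ β ∈ P.aroots (AlgebraicClosure ℚ_[p]), 1 < a β := by
        by_contra! hcon
        have h5 : ((P.aroots (AlgebraicClosure ℚ_[p])).map a).prod ≤ 1 := by
          exact (mprod_le _ _ (fun x _ => a.nonneg x) hcon).2
        linarith
      obtain ⟨β, hβ, hβ1⟩ := this
      obtain ⟨φ, hφ⟩ := exists_embed_alg hunc Q β hIntg (Polynomial.mem_aroots.1 hβ).2
      obtain ⟨b, hb, hb'⟩ := abs_comp φ a hna
      exact ⟨b, hb, by rw [hb', hφ]; exact hβ1⟩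
    · left
      push Not at hp
      have hden : c.den = 1 := by
        by_contra hne
        obtain ⟨p, hpp, hpd⟩ := Nat.exists_prime_and_dvd hne
        haveI : Fact p.Prime := ⟨hpp⟩
        have h1 := hp p ⟨hpp⟩
        have h3 : ‖((c.den : ℤ) : ℚ_[p])‖ < 1 := (Padic.norm_intCast_lt_one_iff).2 (by exact_mod_cast hpd)
        have h4 : (c : ℚ_[p]) * ((c.den : ℤ) : ℚ_[p]) = ((c.num : ℤ) : ℚ_[p]) := by
          have := Rat.mul_den_eq_num c
          exact_mod_cast congrArg (fun x : ℚ => (x : ℚ_[p])) this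
        have h5 : ‖((c.num : ℤ) : ℚ_[p])‖ < 1 := by
          rw [← h4, norm_mul]
          exact lt_of_le_of_lt (mul_le_of_le_one_left (norm_nonneg _) h1) h3
        have h6 := (Padic.norm_intCast_lt_one_iff).1 h5
        have h7 := c.reduced
        have h8 : p ∣ c.num.natAbs := Int.natCast_dvd.1 h6
        exact hpp.one_lt.ne' (Nat.dvd_one.1 (h7 ▸ Nat.dvd_gcd h8 hpd))
      have hcabs : (1 : ℝ) ≤ |(c : ℝ)| := by
        have h1 : c = c.num := by
          conv_lhs => rw [← Rat.num_div_den c, hden]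
          simp
        have h2 : c.num ≠ 0 := by simpa using hc0
        rw [h1]
        have := Int.one_le_abs h2
        exact_mod_cast this
      have h2 := abs_coeff_zero (Ω := ℂ) P hPm (NormedField.toAbsoluteValue ℂ)
      have : ∃ β ∈ P.aroots ℂ, 1 ≤ ‖β‖ := by
        by_contra! hcon
        have h5 := mprod_lt (P.aroots ℂ) (fun x => ‖x‖) (fun x _ => norm_nonneg x) hcon (by
          intro h0
          have h6 : (P.map (algebraMap ℚ ℂ)).Splits := IsAlgClosed.splits _
          have h7 := h6.natDegree_eq_card_roots
          rw [Polynomial.aroots] at h0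
          rw [h0, Polynomial.natDegree_map] at h7
          have := minpoly.natDegree_pos hIntg
          rw [Multiset.card_zero] at h7
          rw [← hP] at this
          omega)
        have h8 : (NormedField.toAbsoluteValue ℂ) (algebraMap ℚ ℂ c) = |(c : ℝ)| := by
          change ‖(algebraMap ℚ ℂ c)‖ = _
          rw [eq_ratCast, ← Complex.ofReal_ratCast, Complex.norm_real, Real.norm_eq_abs]
        rw [h8] at h2
        have h9 : ((P.aroots ℂ).map (NormedField.toAbsoluteValue ℂ)).prod = ((P.aroots ℂ).map (fun x => ‖x‖)).prod := rfl
        linarith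
      obtain ⟨β, hβ, hβ1⟩ := this
      obtain ⟨φ, hφ⟩ := exists_embed_alg hC Q β hIntg (Polynomial.mem_aroots.1 hβ).2
      exact ⟨φ, by rw [hφ]; exact hβ1⟩
  · left
    have hex : ∃ β : ℂ, Transcendental ℚ β ∧ 1 ≤ ‖β‖ := by
      obtain ⟨β, hβ⟩ : ∃ β : ℂ, Transcendental ℚ β := by
        by_contra! hcon
        have : Set.Countable {x : ℂ | IsAlgebraic ℚ x} := Algebraic.countable ℚ ℂ
        have h2 : {x : ℂ | IsAlgebraic ℚ x} = Set.univ := by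
          ext x; simpa [Transcendental] using hcon x
        rw [h2, Set.countable_univ_iff] at this
        exact hC.not_countable this
      by_cases h : 1 ≤ ‖β‖
      · exact ⟨β, hβ, h⟩
      · refine ⟨β⁻¹, fun hh => hβ (by simpa using hh.inv), ?_⟩
        rw [norm_inv]
        push Not at h
        refine (one_le_inv₀ (norm_pos_iff.2 ?_)).2 h.le
        rintro rfl
        exact hβ isAlgebraic_zero
    obtain ⟨β, hβ, hβ1⟩ := hex
    obtain ⟨φ, hφ⟩ := exists_embed_tr hC Q β ht hβ
    exact ⟨φ, by rw [hφ]; exact hβ1⟩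

/-- degree absolute value -/
noncomputable def degAbs (F : Type) [Field F] : AbsoluteValue (RatFunc F) ℝ where
  toFun f := by
    classical
    exact if f = 0 then 0 else (2 : ℝ) ^ (f.intDegree)
  map_mul' x y := by
    by_cases hx : x = 0
    · simp [hx]
    by_cases hy : y = 0
    · simp [hy]
    simp only [hx, hy, mul_eq_zero, or_self, if_false]
    rw [RatFunc.intDegree_mul hx hy, zpow_add₀ (by norm_num)]
  nonneg' x := by
    split_ifs <;> positivity
  eq_zero' x := by
    split_ifs with h
    · simp [h]
    · simp only [h, iff_false]
      positivity
  add_le' x y := by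
    by_cases hx : x = 0
    · subst hx; by_cases hy : y = 0 <;> simp [hy]
    by_cases hy : y = 0
    · subst hy; simp [hx]
    by_cases hxy : x + y = 0
    · simp only [hxy, if_true]
      split_ifs <;> positivity
    simp only [hx, hy, hxy, if_false]
    have h := RatFunc.intDegree_add_le hy hxy
    rcases le_max_iff.1 h with h | h
    · have := zpow_le_zpow_right₀ (a := (2 : ℝ)) (by norm_num) h
      have h2 : (0 : ℝ) < 2 ^ y.intDegree := by positivity
      linarith
    · have := zpow_le_zpow_right₀ (a := (2 : ℝ)) (by norm_num) h
      have h2 : (0 : ℝ) < 2 ^ x.intDegree := by positivity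
      linarith

lemma abs_alg_le {p : ℕ} [Fact p.Prime] {Ω : Type} [Field Ω] [Algebra (ZMod p) Ω] (a : AbsoluteValue Ω ℝ)
    (x : Ω) (hx : IsAlgebraic (ZMod p) x) (hx0 : x ≠ 0) : a x = 1 := by
  have h1 : FiniteDimensional (ZMod p) (IntermediateField.adjoin (ZMod p) {x}) :=
    IntermediateField.adjoin.finiteDimensional hx.isIntegral
  haveI : Finite (IntermediateField.adjoin (ZMod p) {x}) := Module.finite_of_finite (ZMod p)
  let y : (IntermediateField.adjoin (ZMod p) {x}) := ⟨x, IntermediateField.mem_adjoin_simple_self _ x⟩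
  have hy : y ≠ 0 := fun h => hx0 (congrArg Subtype.val h)
  have h2 := isOfFinOrder_of_finite (Units.mk0 y hy)
  obtain ⟨n, hn, h3⟩ := isOfFinOrder_iff_pow_eq_one.1 h2
  have h4 : y ^ n = 1 := by simpa using congrArg Units.val h3
  have h5 : x ^ n = 1 := congrArg Subtype.val h4
  have h6 : a x ^ n = 1 := by rw [← map_pow, h5, map_one]
  exact (pow_eq_one_iff_of_nonneg (a.nonneg x) hn.ne').1 h6

lemma placep {p : ℕ} [Fact p.Prime] {K : Type} [Field K] [Algebra (ZMod p) K] [Countable K] (t : K)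
    (ht : Transcendental (ZMod p) t) : ∃ a : AbsoluteValue K ℝ, IsNonarchimedean a ∧ 1 < a t := by
  let E := (degAbs (ZMod p)).Completion
  letI : NormedField E := inferInstance
  let x0 : E := ((WithAbs.toAbs (degAbs (ZMod p)) RatFunc.X : WithAbs (degAbs (ZMod p))) : UniformSpace.Completion _)
  have hx0 : ‖x0‖ = 2 := by
    refine (UniformSpace.Completion.norm_coe (WithAbs.toAbs (degAbs (ZMod p)) RatFunc.X)).trans ?_
    change degAbs (ZMod p) RatFunc.X = 2
    simp [degAbs, RatFunc.X_ne_zero]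
  letI : NontriviallyNormedField E := { (inferInstance : NormedField E) with
    non_trivial := ⟨x0, by rw [hx0]; norm_num⟩ }
  haveI : CompleteSpace E := inferInstanceAs (CompleteSpace (UniformSpace.Completion _))
  let ψ : ZMod p →+* E := (UniformSpace.Completion.coeRingHom (α := WithAbs (degAbs (ZMod p)))).comp
    ((WithAbs.equiv (degAbs (ZMod p))).symm.toRingHom.comp (RatFunc.C (K := ZMod p)))
  letI : Algebra (ZMod p) E := ψ.toAlgebra
  haveI : IsUltrametricDist E := by
    apply IsUltrametricDist.isUltrametricDist_of_forall_norm_natCast_le_one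
    intro n
    by_cases h0 : (n : E) = 0
    · rw [h0]; simp
    · have h1 : IsAlgebraic (ZMod p) (n : E) := isAlgebraic_natCast n
      exact (abs_alg_le (NormedField.toAbsoluteValue E) (n : E) h1 h0).le
  obtain ⟨hunc, a, hna, hext⟩ := exists_abs E
  letI : Algebra (ZMod p) (AlgebraicClosure E) := ((algebraMap E (AlgebraicClosure E)).comp ψ).toAlgebra
  have hβ : a (algebraMap E _ x0) = 2 := by rw [hext, hx0]
  have htr : Transcendental (ZMod p) (algebraMap E (AlgebraicClosure E) x0) := by
    intro h
    have := abs_alg_le a _ h (by intro h0; rw [h0, map_zero] at hβ; norm_num at hβ)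
    rw [hβ] at this; norm_num at this
  obtain ⟨φ, hφ⟩ := exists_embed_tr hunc t _ ht htr
  obtain ⟨b, hb, hb'⟩ := abs_comp φ a hna
  exact ⟨b, hb, by rw [hb', hφ, hβ]; norm_num⟩

end USG
end PartP5a

section PartP5b
set_option linter.unusedVariables false
set_option linter.unusedSectionVars false
open Module Pointwise

namespace USG

section
variable {K : Type} [Field K] {k : ℕ}

def gramM {D : ℕ} (w : Fin D → Mk k K) : Matrix (Fin D) (Fin D) K :=
  Matrix.of fun i j => (w i * w j).trace

lemma gramM_mulVec {D : ℕ} (w : Fin D → Mk k K) (γ : Fin D → K) (i : Fin D) :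
    (gramM w).mulVec γ i = (w i * ∑ j, γ j • w j).trace := by
  simp only [Matrix.mulVec, dotProduct, gramM, Matrix.of_apply, Finset.mul_sum, Matrix.trace_sum,
    Matrix.mul_smul, Matrix.trace_smul, smul_eq_mul]
  exact Finset.sum_congr rfl fun j _ => mul_comm _ _

lemma li_of_gram {D : ℕ} (w : Fin D → Mk k K) (h : (gramM w).det ≠ 0) : LinearIndependent K w := by
  rw [Fintype.linearIndependent_iff]
  intro γ hγ
  have h1 : (gramM w).mulVec γ = 0 := by
    ext i; rw [gramM_mulVec, hγ]; simp
  by_contra hne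
  push Not at hne
  obtain ⟨i, hi⟩ := hne
  exact h (Matrix.exists_mulVec_eq_zero_iff.1 ⟨γ, fun h0 => hi (by rw [h0]; rfl), h1⟩)

lemma span_of_li (w : Fin (k ^ 2) → Mk k K) (h : LinearIndependent K w) :
    Submodule.span K (Set.range w) = ⊤ := by
  apply h.span_eq_top_of_card_eq_finrank'
  rw [Module.finrank_matrix]; simp [sq]

lemma gram_ne_zero (w : Fin (k ^ 2) → Mk k K) (h : LinearIndependent K w) : (gramM w).det ≠ 0 := by
  intro h0
  obtain ⟨γ, hγ, h1⟩ := Matrix.exists_mulVec_eq_zero_iff.2 h0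
  set X := ∑ j, γ j • w j with hX
  have h2 : ∀ Y : Mk k K, (Y * X).trace = 0 := by
    intro Y
    have hY : Y ∈ Submodule.span K (Set.range w) := by rw [span_of_li w h]; trivial
    induction hY using Submodule.span_induction with
    | mem x hx =>
      obtain ⟨i, rfl⟩ := hx
      rw [← gramM_mulVec, h1]; rfl
    | zero => simp
    | add x y _ _ hx hy => rw [add_mul, Matrix.trace_add, hx, hy, add_zero]
    | smul c x _ hx => rw [Matrix.smul_mul, Matrix.trace_smul, hx, smul_zero]
  have h3 : X = 0 := by
    rw [Matrix.ext_iff_trace_mul_left]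
    intro Y; rw [h2, mul_zero, Matrix.trace_zero]
  rw [Fintype.linearIndependent_iff] at h
  exact hγ (funext fun i => h γ h3 i)

lemma expand (w : Fin (k ^ 2) → Mk k K) (h : (gramM w).det ≠ 0) (X : Mk k K) :
    ∃ γ : Fin (k ^ 2) → K, X = ∑ j, γ j • w j ∧
      ∀ i, (gramM w).det * γ i = ∑ j, (gramM w).adjugate i j * (w j * X).trace := by
  have hX : X ∈ Submodule.span K (Set.range w) := by
    rw [span_of_li w (li_of_gram w h)]; trivial
  obtain ⟨γ, hγ⟩ := (Submodule.mem_span_range_iff_exists_fun K).1 hX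
  refine ⟨γ, hγ.symm, fun i => ?_⟩
  have h1 : (gramM w).mulVec γ = fun j => (w j * X).trace := by
    ext j; rw [gramM_mulVec, hγ]
  have h2 := congrArg ((gramM w).adjugate.mulVec) h1
  rw [Matrix.mulVec_mulVec, Matrix.adjugate_mul, Matrix.smul_mulVec, Matrix.one_mulVec] at h2
  have := congrFun h2 i
  simpa [Matrix.mulVec, dotProduct] using this

lemma det_mem {n : ℕ} (R : Subfield K) (A : Matrix (Fin n) (Fin n) K) (h : ∀ i j, A i j ∈ R) :
    A.det ∈ R := by
  rw [Matrix.det_apply]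
  refine sum_mem fun σ _ => ?_
  rw [Units.smul_def, zsmul_eq_mul]
  exact mul_mem (intCast_mem R _) (prod_mem fun i _ => h _ _)

lemma adj_mem {n : ℕ} (R : Subfield K) (A : Matrix (Fin n) (Fin n) K) (h : ∀ i j, A i j ∈ R) (i j) :
    A.adjugate i j ∈ R := by
  rw [Matrix.adjugate_apply]
  refine det_mem R _ fun a b => ?_
  rw [Matrix.updateRow_apply]
  split_ifs
  · rw [Pi.single_apply]; split_ifs
    · exact one_mem R
    · exact zero_mem R
  · exact h a b

lemma adj_le {n : ℕ} (a : AbsoluteValue K ℝ) (A : Matrix (Fin n) (Fin n) K) {B : ℝ} (hB : 1 ≤ B)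
    (h : ∀ i j, a (A i j) ≤ B) (i j) : a (A.adjugate i j) ≤ (n.factorial : ℝ) * B ^ n := by
  rw [Matrix.adjugate_apply]
  have := Matrix.det_le (A := A.updateRow j (Pi.single i 1)) (abv := a) (x := B) (fun c d => by
    rw [Matrix.updateRow_apply]
    split_ifs
    · rw [Pi.single_apply]; split_ifs
      · rwa [map_one]
      · rw [map_zero]; linarith
    · exact h c d)
  simpa using this

/-- coefficient bound -/
lemma expand_le (a : AbsoluteValue K ℝ) (w : Fin (k ^ 2) → Mk k K) {B c0 : ℝ} (hB : 1 ≤ B) (hc : 0 < c0)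
    (h : c0 ≤ a (gramM w).det) (hw : ∀ i j, a (w i * w j).trace ≤ B) (X : Mk k K)
    (hX : ∀ i, a (w i * X).trace ≤ B) : ∃ γ : Fin (k ^ 2) → K, X = ∑ j, γ j • w j ∧
      ∀ i, a (γ i) ≤ (k ^ 2 : ℕ) * (((k ^ 2).factorial : ℝ) * B ^ (k ^ 2) * B) / c0 := by
  have h0 : (gramM w).det ≠ 0 := by
    intro h0; rw [h0, map_zero] at h; linarith
  obtain ⟨γ, h1, h2⟩ := expand w h0 X
  refine ⟨γ, h1, fun i => ?_⟩
  rw [le_div_iff₀ hc]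
  have h3 : a ((gramM w).det * γ i) ≤ (k ^ 2 : ℕ) * (((k ^ 2).factorial : ℝ) * B ^ (k ^ 2) * B) := by
    rw [h2]
    refine (a.sum_le _ _).trans ?_
    refine (Finset.sum_le_card_nsmul _ _ (((k ^ 2).factorial : ℝ) * B ^ (k ^ 2) * B) fun j _ => ?_).trans ?_
    · rw [map_mul]
      exact mul_le_mul (adj_le a _ hB (fun i j => hw i j) i j) (hX j) (a.nonneg _) (by positivity)
    · rw [Finset.card_univ, Fintype.card_fin, nsmul_eq_mul]
  rw [map_mul] at h3
  refine le_trans ?_ h3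
  rw [mul_comm]
  exact mul_le_mul_of_nonneg_right h (a.nonneg _)

lemma pow_fin {H : Type*} [Group H] {F : Set H} (h : F.Finite) (n : ℕ) : (F ^ n).Finite := by
  induction n with
  | zero => rw [pow_zero]; exact Set.finite_one
  | succ n ih => rw [pow_succ]; exact ih.mul h

/-- finiteness when traces are algebraic over the prime field -/
lemma finite_of_alg (p : ℕ) [Fact p.Prime] [Algebra (ZMod p) K] (F : Set (SLk k K)) (hfin : F.Finite)
    (h1 : 1 ∈ F) (hs : ∀ x ∈ F, x⁻¹ ∈ F) (w : Fin (k ^ 2) → SLk k K)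
    (hw : LinearIndependent K (fun i => (w i).1)) {N L : ℕ} (hwN : ∀ i, w i ∈ F ^ N) (hL : 2 * N + 1 ≤ L)
    (htr : ∀ g ∈ F ^ L, IsAlgebraic (ZMod p) g.1.trace) :
    (Subgroup.closure F : Set (SLk k K)).Finite := by
  set S : Set K := (fun g : SLk k K => g.1.trace) '' (F ^ L) with hS
  have hpowfin : (F ^ L).Finite := pow_fin hfin L
  have hSfin : S.Finite := hpowfin.image _
  haveI : Finite S := hSfin
  let R := IntermediateField.adjoin (ZMod p) S
  have hRfd : FiniteDimensional (ZMod p) R := by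
    apply IntermediateField.finiteDimensional_adjoin
    rintro _ ⟨g, hg, rfl⟩
    exact (htr g hg).isIntegral
  haveI hRfin : Finite R := Module.finite_of_finite (ZMod p)
  let R' : Subfield K := R.toSubfield
  have hsub : ∀ n ≤ L, ∀ g ∈ F ^ n, g.1.trace ∈ R' := by
    intro n hn g hg
    exact IntermediateField.subset_adjoin _ _ ⟨g, Set.pow_subset_pow_right h1 hn hg, rfl⟩
  have hg0 := gram_ne_zero _ hw
  have hgr : ∀ i j, gramM (fun i => (w i).1) i j ∈ R' := by
    intro i j
    refine hsub (N + N) (by omega) (w i * w j) ?_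
    rw [pow_add]; exact Set.mul_mem_mul (hwN i) (hwN j)
  -- lattice
  let Λ : Set (Mk k K) := {X | ∃ γ : Fin (k ^ 2) → K, (∀ i, γ i ∈ R') ∧ X = ∑ j, γ j • (w j).1}
  have hF : ∀ f ∈ F, ∀ i, f.1 * (w i).1 ∈ Λ := by
    intro f hf i
    obtain ⟨γ, hγ, hγ'⟩ := expand _ hg0 (f.1 * (w i).1)
    refine ⟨γ, fun j => ?_, hγ⟩
    have h2 : γ j = (gramM (fun i => (w i).1)).det⁻¹ * ∑ l, (gramM (fun i => (w i).1)).adjugate j l * ((w l).1 * (f.1 * (w i).1)).trace := by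
      rw [← hγ', inv_mul_cancel_left₀ hg0]
    rw [h2]
    refine mul_mem (inv_mem (det_mem R' _ hgr)) (sum_mem fun l _ => mul_mem (adj_mem R' _ hgr j l) ?_)
    refine hsub (N + (1 + N)) (by omega) (w l * (f * w i)) ?_
    rw [pow_add, pow_add, pow_one]
    exact Set.mul_mem_mul (hwN l) (Set.mul_mem_mul hf (hwN i))
  have hlat : ∀ g ∈ Subgroup.closure F, ∀ i, g.1 * (w i).1 ∈ Λ := by
    intro g hg
    induction hg using Subgroup.closure_induction_left with
    | one =>
      intro i
      exact hF 1 h1 i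
    | mul_left x hx y hy ih =>
      intro i
      obtain ⟨γ, hγ, hγ'⟩ := ih i
      have h3 : (x * y).1 * (w i).1 = ∑ j, γ j • (x.1 * (w j).1) := by
        change x.1 * y.1 * (w i).1 = _
        rw [mul_assoc, hγ', Finset.mul_sum]
        simp
      choose δ hδ hδ' using hF x hx
      refine ⟨fun l => ∑ j, γ j * δ j l, fun l => sum_mem fun j _ => mul_mem (hγ j) (hδ j l), ?_⟩
      rw [h3]
      simp_rw [hδ', Finset.smul_sum, Finset.sum_smul, smul_smul]
      rw [Finset.sum_comm]
    | inv_mul_cancel x hx y hy ih =>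
      have hx' := hs x hx
      intro i
      obtain ⟨γ, hγ, hγ'⟩ := ih i
      have h3 : (x⁻¹ * y).1 * (w i).1 = ∑ j, γ j • ((x⁻¹).1 * (w j).1) := by
        change (x⁻¹).1 * y.1 * (w i).1 = _
        rw [mul_assoc, hγ', Finset.mul_sum]
        simp
      choose δ hδ hδ' using hF x⁻¹ hx'
      refine ⟨fun l => ∑ j, γ j * δ j l, fun l => sum_mem fun j _ => mul_mem (hγ j) (hδ j l), ?_⟩
      rw [h3]
      simp_rw [hδ', Finset.smul_sum, Finset.sum_smul, smul_smul]
      rw [Finset.sum_comm]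
  refine finite_of_trace _ (Set.range fun i => (w i).1) (span_of_li _ hw) (R' : Set K) ?_ ?_
  · exact hRfin
  · rintro g hg _ ⟨i, rfl⟩
    obtain ⟨γ, hγ, hγ'⟩ := hlat g hg i
    change (g.1 * (w i).1).trace ∈ R'
    rw [hγ', Matrix.trace_sum]
    refine sum_mem fun j _ => ?_
    rw [Matrix.trace_smul]
    exact mul_mem (hγ j) (hsub N (by omega) _ (hwN j))

end
end USG
end PartP5b

section PartP6
set_option linter.unusedVariables false
set_option linter.unusedSectionVars false
open Module Pointwise

namespace USG

section
variable {K : Type} [Field K] {k : ℕ}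

lemma exists_li_fun {V : Type} [AddCommGroup V] [Module K V] [FiniteDimensional K V] {D n : ℕ} (u : Fin D → V)
    (h : Submodule.span K (Set.range u) = ⊤) (hn : finrank K V = n) : ∃ s : Fin n → Fin D, LinearIndependent K (u ∘ s) := by
  obtain ⟨b, hb, hsp, hli⟩ := exists_linearIndependent K (Set.range u)
  rw [h] at hsp
  have hfin : Finite b := hli.finite
  have B : Basis b K V := Basis.mk hli (by rw [Subtype.range_coe]; exact hsp.ge)
  have := Fintype.ofFinite b
  have hc : Fintype.card b = n := by rw [← hn, Module.finrank_eq_card_basis B]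
  let e : Fin n ≃ b := (Fintype.equivFinOfCardEq hc).symm
  choose t ht using fun x : b => hb x.2
  refine ⟨fun i => t (e i), ?_⟩
  have : u ∘ (fun i => t (e i)) = (fun x : b => (x : V)) ∘ e := by
    ext i; simp [ht]
  rw [this]
  exact hli.comp e e.injective

lemma conj_exists (hk : 0 < k) (a : AbsoluteValue K ℝ) {D : ℕ} (w : Fin D → Mk k K)
    (hw : Submodule.span K (Set.range w) = ⊤) : ∃ R : Mk k K, R.det ≠ 0 ∧ ∀ (X : Mk k K) (C : ℝ),
      (∀ i, ∃ γ : Fin D → K, X * w i = ∑ j, γ j • w j ∧ ∀ j, a (γ j) ≤ C) →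
      ∀ i j, a ((R⁻¹ * X * R) i j) ≤ D * C := by
  classical
  let v : Fin k → K := Pi.single ⟨0, hk⟩ 1
  let u : Fin D → Fin k → K := fun i => (w i).mulVec v
  have hu : Submodule.span K (Set.range u) = ⊤ := by
    rw [eq_top_iff]
    intro x _
    -- a matrix sending v to x
    let X : Mk k K := Matrix.of fun i j => if j = ⟨0, hk⟩ then x i else 0
    have hX : X.mulVec v = x := by
      ext i
      rw [Matrix.mulVec_single_one]; simp [X]
    obtain ⟨γ, hγ⟩ := (Submodule.mem_span_range_iff_exists_fun K).1 (by rw [hw]; trivial : X ∈ Submodule.span K (Set.range w))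
    rw [Submodule.mem_span_range_iff_exists_fun]
    refine ⟨γ, ?_⟩
    rw [← hX, ← hγ, Matrix.sum_mulVec]
    simp [u, Matrix.smul_mulVec]
  let Rs : (Fin k → Fin D) → Mk k K := fun s => (Matrix.of fun l => u (s l)).transpose
  obtain ⟨s0, hs0⟩ := exists_li_fun u hu (by simp : finrank K (Fin k → K) = k)
  haveI : Nonempty (Fin k → Fin D) := ⟨s0⟩
  obtain ⟨s, hs⟩ := Finite.exists_max (fun s => a (Rs s).det)
  have hdet0 : (Rs s0).det ≠ 0 := by
    have h1 : LinearIndependent K (Matrix.of fun l => u (s0 l)).row := hs0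
    rw [Matrix.linearIndependent_rows_iff_isUnit, Matrix.isUnit_iff_isUnit_det] at h1
    rw [Matrix.det_transpose]
    exact h1.ne_zero
  have hdet : (Rs s).det ≠ 0 := by
    intro h0
    have := hs s0
    rw [h0, map_zero] at this
    exact hdet0 (a.eq_zero.1 (le_antisymm this (a.nonneg _)))
  set R := Rs s with hR
  have hRu : IsUnit R.det := hdet.isUnit
  have hβ : ∀ j i, a ((R⁻¹.mulVec (u j)) i) ≤ 1 := by
    intro j i
    have h1 : R⁻¹.mulVec (u j) = R.det⁻¹ • R.cramer (u j) := by
      have h2 := R.mulVec_cramer (u j)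
      have h3 := congrArg (R⁻¹.mulVec) h2
      rw [Matrix.mulVec_mulVec, Matrix.nonsing_inv_mul _ hRu, Matrix.one_mulVec, Matrix.mulVec_smul] at h3
      rw [h3, smul_smul, inv_mul_cancel₀ hdet, one_smul]
    rw [h1, Pi.smul_apply, smul_eq_mul, Matrix.cramer_apply]
    have h4 : R.updateCol i (u j) = Rs (Function.update s i j) := by
      ext x y
      rw [Matrix.updateCol_apply]
      simp only [Rs, hR, Matrix.transpose_apply, Matrix.of_apply, Function.update_apply]
      split_ifs <;> rfl
    rw [h4, map_mul, map_inv₀, inv_mul_le_iff₀ (a.pos hdet), mul_one]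
    exact hs _
  refine ⟨R, hdet, fun X C hX i l => ?_⟩
  obtain ⟨γ, hγ, hγC⟩ := hX (s l)
  have h1 : (R⁻¹ * X * R) i l = ∑ j, γ j * (R⁻¹.mulVec (u j)) i := by
    have h2 : (R⁻¹ * X * R) i l = (R⁻¹.mulVec (X.mulVec (u (s l)))) i := by
      rw [Matrix.mulVec_mulVec]
      rfl
    have h3 : X.mulVec (u (s l)) = ∑ j, γ j • u j := by
      change X.mulVec ((w (s l)).mulVec v) = _
      rw [Matrix.mulVec_mulVec, hγ, Matrix.sum_mulVec]
      simp [u, Matrix.smul_mulVec]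
    rw [h2, h3, Matrix.mulVec_sum]
    simp [Matrix.mulVec_smul]
  rw [h1]
  refine (a.sum_le _ _).trans ((Finset.sum_le_card_nsmul _ _ C fun j _ => ?_).trans ?_)
  · rw [map_mul]
    exact (mul_le_of_le_one_right (a.nonneg _) (hβ j i)).trans (hγC j)
  · simp

end
end USG
end PartP6

section PartP6b
set_option linter.unusedVariables false
set_option linter.unusedSectionVars false
open Module Pointwise

namespace USG

/-- products of `q`-th powers -/
def ww {H : Type*} [Monoid H] {D E : ℕ} (q : ℕ) (y : Fin D → Fin E → H) (i : Fin D) : H :=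
  (List.ofFn fun j => y i j ^ q).prod

section
variable {K : Type} [Field K] {k : ℕ}

/-- the coercion as a monoid hom -/
def mcHom : SLk k K →* Mk k K where
  toFun x := x.1
  map_one' := rfl
  map_mul' _ _ := rfl

lemma Good.basis [IsAlgClosed K] {F : Set (SLk k K)} (hF : Good F) (q : ℕ) (hq : 0 < q) :
    ∃ y : Fin (k ^ 2) → Fin (k ^ 2) → SLk k K, (∀ i j, y i j ∈ F ^ ((k ^ 2) ^ q)) ∧
      LinearIndependent K (fun i => (ww q y i).1) := by
  classical
  have h := hF.pow_span q hq
  set S := (((fun x : SLk k K => x.1 ^ q) '' (F ^ ((k ^ 2) ^ q))) ^ (k ^ 2)) with hS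
  obtain ⟨b, hb, hsp, hli⟩ := exists_linearIndependent K S
  rw [h] at hsp
  have hfin : Finite b := hli.finite
  have B : Basis b K (Mk k K) := Basis.mk hli (by rw [Subtype.range_coe]; exact hsp.ge)
  have := Fintype.ofFinite b
  have hc : Fintype.card b = k ^ 2 := by
    rw [← Module.finrank_eq_card_basis B, Module.finrank_matrix]; simp [sq]
  let e : Fin (k ^ 2) ≃ b := (Fintype.equivFinOfCardEq hc).symm
  have hx : ∀ x : b, ∃ y : Fin (k ^ 2) → SLk k K, (∀ j, y j ∈ F ^ ((k ^ 2) ^ q)) ∧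
      ((List.ofFn fun j => y j ^ q).prod).1 = x.1 := by
    intro x
    obtain ⟨f, hf⟩ := Set.mem_pow.1 (hb x.2)
    choose y hy hy' using fun j => (f j).2
    refine ⟨y, hy, ?_⟩
    rw [← hf]
    change mcHom (List.ofFn fun j => y j ^ q).prod = _
    rw [map_list_prod, List.map_ofFn]
    congr 2
    ext1 j
    rw [← hy' j]
    change mcHom (y j ^ q) = _
    rw [map_pow]
    rfl
  choose y hy hy' using hx
  refine ⟨fun i => y (e i), fun i j => hy _ _, ?_⟩
  have : (fun i => (ww q (fun i => y (e i)) i).1) = (fun x : b => (x : Mk k K)) ∘ e := by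
    ext1 i; exact hy' (e i)
  rw [this]
  exact hli.comp e e.injective

lemma tr_le [IsAlgClosed K] (a : AbsoluteValue K ℝ) (g : Mk k K) (c : ℝ)
    (h : ∀ l ∈ g.charpoly.roots, a l ≤ c) (hc : 0 ≤ c) : a g.trace ≤ k * c := by
  rw [Matrix.trace_eq_sum_roots_charpoly]
  have key : ∀ s : Multiset K, (∀ l ∈ s, a l ≤ c) → a s.sum ≤ s.card * c := by
    intro s
    induction s using Multiset.induction_on with
    | empty => simp
    | cons x s ih =>
      intro hs
      rw [Multiset.sum_cons, Multiset.card_cons]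
      have h1 := hs x (Multiset.mem_cons_self x s)
      have h2 := ih fun l hl => hs l (Multiset.mem_cons_of_mem hl)
      have h3 := a.add_le x s.sum
      push_cast
      linarith
  refine (key _ h).trans (mul_le_mul_of_nonneg_right ?_ hc)
  have := g.charpoly.card_roots'
  rw [Matrix.charpoly_natDegree_eq_dim, Fintype.card_fin] at this
  exact_mod_cast this

/-- the unit ball of a nonarchimedean absolute value -/
def integ (a : AbsoluteValue K ℝ) (ha : IsNonarchimedean a) : Subring K where
  carrier := {x | a x ≤ 1}
  mul_mem' := by
    intro x y hx hy
    change a (x * y) ≤ 1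
    rw [map_mul]; exact mul_le_one₀ hx (a.nonneg _) hy
  one_mem' := by change a 1 ≤ 1; simp
  add_mem' := by
    intro x y hx hy
    exact (ha x y).trans (max_le hx hy)
  zero_mem' := by change a 0 ≤ 1; simp
  neg_mem' := by
    intro x hx
    change a (-x) ≤ 1
    rw [a.map_neg]; exact hx

lemma tr_integ [IsAlgClosed K] (a : AbsoluteValue K ℝ) (ha : IsNonarchimedean a) (g : Mk k K)
    (h : ∀ l ∈ g.charpoly.roots, a l ≤ 1) : g.trace ∈ integ a ha := by
  rw [Matrix.trace_eq_sum_roots_charpoly]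
  exact Subring.multiset_sum_mem _ _ h

lemma det_integ (R : Subring K) {n : ℕ} (A : Matrix (Fin n) (Fin n) K) (h : ∀ i j, A i j ∈ R) : A.det ∈ R := by
  rw [Matrix.det_apply]
  refine Subring.sum_mem _ fun s _ => ?_
  rw [Units.smul_def]
  exact zsmul_mem (Subring.prod_mem _ fun i _ => h _ _) _

lemma exists_resc (a : AbsoluteValue K ℝ) (s : ℝ) (hs : 0 < s) (h : IsNonarchimedean a ∨ s ≤ 1) :
    ∃ a' : AbsoluteValue K ℝ, ∀ x, a' x = a x ^ s := by
  refine ⟨⟨⟨fun x => a x ^ s, fun x y => ?_⟩, fun x => ?_, fun x => ?_, fun x y => ?_⟩, fun x => rfl⟩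
  · change a (x * y) ^ s = _
    rw [map_mul, Real.mul_rpow (a.nonneg _) (a.nonneg _)]
  · exact Real.rpow_nonneg (a.nonneg _) _
  · change a x ^ s = 0 ↔ _
    rw [Real.rpow_eq_zero (a.nonneg _) hs.ne', a.eq_zero]
  · change a (x + y) ^ s ≤ a x ^ s + a y ^ s
    rcases h with h | h
    · have h1 := Real.rpow_nonneg (a.nonneg x) s
      have h2 := Real.rpow_nonneg (a.nonneg y) s
      rcases le_max_iff.1 (h x y) with h3 | h3
      · have := Real.rpow_le_rpow (a.nonneg _) h3 hs.le
        linarith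
      · have := Real.rpow_le_rpow (a.nonneg _) h3 hs.le
        linarith
    · exact (Real.rpow_le_rpow (a.nonneg _) (a.add_le x y) hs.le).trans
        (Real.rpow_add_le_add_rpow (a.nonneg _) (a.nonneg _) hs.le h)

/-- eigenvalue condition -/
def Eig (S : Set (SLk k K)) (l : K) : Prop := ∃ g ∈ S, l ∈ g.1.charpoly.roots

lemma exists_max_eig [IsAlgClosed K] (hk : 0 < k) (S : Set (SLk k K)) (hS : S.Finite) (h1 : 1 ∈ S)
    (a : AbsoluteValue K ℝ) : ∃ l, Eig S l ∧ ∀ l', Eig S l' → a l' ≤ a l := by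
  classical
  have hfin : {l | Eig S l}.Finite := by
    have : {l | Eig S l} = ⋃ g ∈ S, {l | l ∈ g.1.charpoly.roots} := by
      ext l; simp only [Eig, Set.mem_iUnion, Set.mem_setOf_eq, exists_prop]
    rw [this]
    refine hS.biUnion fun g _ => ?_
    have : {l | l ∈ g.1.charpoly.roots} = (g.1.charpoly.roots.toFinset : Set K) := by ext l; simp
    rw [this]
    exact Finset.finite_toSet _
  have hne : {l | Eig S l}.Nonempty := by
    obtain ⟨l, hl⟩ := IsAlgClosed.exists_root (1 : Mk k K).charpoly (by
      rw [Matrix.charpoly_degree_eq_dim, Fintype.card_fin]; exact_mod_cast hk.ne')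
    exact ⟨l, 1, h1, (Polynomial.mem_roots (Matrix.charpoly_monic _).ne_zero).2 hl⟩
  obtain ⟨l, hl, hl'⟩ := Set.exists_max_image _ (fun l => a l) hfin hne
  exact ⟨l, hl, fun l' h => hl' l' h⟩

def PlaceOK (S : Set (SLk k K)) (Q : K) : Prop :=
  ∃ a : AbsoluteValue K ℝ, (∀ l, Eig S l → a l ≤ Real.exp 1) ∧ 1 ≤ a Q ∧
    ((∃ l, Eig S l ∧ a l = Real.exp 1) ∨ ∃ ι : K →+* ℂ, ∀ x, a x = ‖ι x‖)

lemma place_resc [IsAlgClosed K] (hk : 0 < k) (S : Set (SLk k K)) (hS : S.Finite) (h1 : 1 ∈ S)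
    (Q : K) (a : AbsoluteValue K ℝ) (hQ : 1 ≤ a Q) (l0 : K) (hl0 : Eig S l0) (h0 : 1 < a l0)
    (h : IsNonarchimedean a ∨ Real.exp 1 ≤ a l0) : PlaceOK S Q := by
  obtain ⟨l, hl, hmax⟩ := exists_max_eig hk S hS h1 a
  have hl1 : 1 < a l := h0.trans_le (hmax _ hl0)
  have hlog : 0 < Real.log (a l) := Real.log_pos hl1
  set s := (Real.log (a l))⁻¹ with hs
  have hs0 : 0 < s := inv_pos.2 hlog
  obtain ⟨a', ha'⟩ := exists_resc a s hs0 (by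
    rcases h with h | h
    · exact Or.inl h
    · right
      have h2 : Real.exp 1 ≤ a l := h.trans (hmax _ hl0)
      rw [hs]
      refine inv_le_one_of_one_le₀ ?_
      rw [Real.le_log_iff_exp_le (by linarith)]
      exact h2)
  have hle : a' l = Real.exp 1 := by
    rw [ha', Real.rpow_def_of_pos (by linarith), hs, mul_inv_cancel₀ hlog.ne']
  refine ⟨a', fun l' h' => ?_, ?_, Or.inl ⟨l, hl, hle⟩⟩
  · rw [← hle, ha', ha']
    exact Real.rpow_le_rpow (a.nonneg _) (hmax _ h') hs0.le
  · rw [ha']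
    exact Real.one_le_rpow hQ hs0.le

lemma place_exists [IsAlgClosed K] [Countable K] (hk : 0 < k) (S : Set (SLk k K)) (hS : S.Finite) (h1 : 1 ∈ S)
    (Q : K) (hQ : Q ≠ 0) (hIntg : ∀ (R : Subring K), (∀ g ∈ S, g.1.trace ∈ R) → Q ∈ R)
    (htr : ∀ (p : ℕ) [Fact p.Prime] [Algebra (ZMod p) K], ∃ g ∈ S, Transcendental (ZMod p) g.1.trace) :
    PlaceOK S Q := by
  have hna : ∀ (a : AbsoluteValue K ℝ) (ha : IsNonarchimedean a), 1 ≤ a Q →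
      (1 < a Q ∨ ∃ g ∈ S, 1 < a g.1.trace) → PlaceOK S Q := by
    intro a ha hQ1 h
    by_cases hcon : ∀ l, Eig S l → a l ≤ 1
    · exfalso
      have h2 : ∀ g ∈ S, g.1.trace ∈ integ a ha := fun g hg =>
        tr_integ a ha _ fun l hl => hcon l ⟨g, hg, hl⟩
      rcases h with h | ⟨g, hg, h⟩
      · exact absurd (hIntg _ h2) (not_le.2 h)
      · exact absurd (h2 g hg) (not_le.2 h)
    · push Not at hcon
      obtain ⟨l, hl, h3⟩ := hcon
      exact place_resc hk S hS h1 Q a hQ1 l hl h3 (Or.inl ha)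
  obtain ⟨p, hp⟩ := CharP.exists K
  rcases CharP.char_is_prime_or_zero K p with hpp | rfl
  · haveI : Fact p.Prime := ⟨hpp⟩
    letI : Algebra (ZMod p) K := ZMod.algebra K p
    by_cases hal : IsAlgebraic (ZMod p) Q
    · obtain ⟨g, hg, ht⟩ := htr p
      obtain ⟨a, ha, ha1⟩ := placep _ ht
      exact hna a ha (abs_alg_le a Q hal hQ).ge (Or.inr ⟨g, hg, ha1⟩)
    · obtain ⟨a, ha, ha1⟩ := placep Q hal
      exact hna a ha ha1.le (Or.inl ha1)
  · haveI : CharZero K := CharP.charP_to_charZero K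
    rcases place0 Q hQ with ⟨ι, hι⟩ | ⟨a, ha, ha1⟩
    · let a : AbsoluteValue K ℝ := (NormedField.toAbsoluteValue ℂ).comp ι.injective
      have ha : ∀ x, a x = ‖ι x‖ := fun x => rfl
      by_cases hcon : ∀ l, Eig S l → a l ≤ Real.exp 1
      · exact ⟨a, hcon, hι, Or.inr ⟨ι, ha⟩⟩
      · push Not at hcon
        obtain ⟨l, hl, h3⟩ := hcon
        refine place_resc hk S hS h1 Q a hι l hl (lt_trans ?_ h3) (Or.inr h3.le)
        exact Real.one_lt_exp_iff.2 one_pos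
    · exact hna a ha ha1.le (Or.inl ha1)

/-- the data at level `n` -/
structure NData (M r N : ℕ) (C0 c0 : ℝ) (F : Set (SLk k K)) (a : AbsoluteValue K ℝ) (R : Mk k K)
    (y : Fin (k ^ 2) → Fin (k ^ 2) → SLk k K) (x : SLk k K) (c g h : ℕ → SLk k K) (i0 : Fin (k ^ 2)) : Prop where
  hR : R.det ≠ 0
  hy : ∀ i j, y i j ∈ F ^ ((k ^ 2) ^ k.factorial)
  law : Law M x c g h
  hg : ∀ j, g j ∈ F ^ ((k ^ 2) ^ 4)
  hh : ∀ j, h j ∈ F ^ ((k ^ 2) ^ 4)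
  hc : ∀ j, c j ∈ F ^ (lawLen k M j)
  ent : ∀ f ∈ F, ∀ i j, a ((R⁻¹ * f.1 * R) i j) ≤ C0
  gram : c0 ≤ a (gramM (fun i => (ww k.factorial y i).1)).det
  big : 1 ≤ a ((gramM (fun i => (ww k.factorial y i).1)).det *
    (((c (M + r)).1 - 1) * (ww k.factorial y i0).1).trace)
  alt : (∃ l, Eig (F ^ N) l ∧ a l = Real.exp 1) ∨ ∃ ι : K →+* ℂ, ∀ x, a x = ‖ι x‖

lemma ww_mem {H : Type*} [Group H] {F : Set H} {D E q m : ℕ} (y : Fin D → Fin E → H)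
    (hy : ∀ i j, y i j ∈ F ^ m) (i : Fin D) : ww q y i ∈ F ^ (m * q * E) := by
  rw [pow_mul, Set.mem_pow]
  exact ⟨fun j => ⟨y i j ^ q, by rw [pow_mul]; exact Set.pow_mem_pow (hy i j)⟩, rfl⟩

theorem theoremN (k : ℕ) (hk : 0 < k) : ∃ C0 c0 : ℝ, 0 < c0 ∧ 1 ≤ C0 ∧ ∀ M r : ℕ, ∃ N : ℕ, ∀ (K : Type) [Field K]
    [IsAlgClosed K] [Countable K] (F : Set (SLk k K)), F.Finite → Good F →
      ∃ a R y x c g h i0, NData M r N C0 c0 F a R y x c g h i0 := by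
  set q := k.factorial with hq
  set c0 : ℝ := 1 / (2 * k * Real.exp 1) with hc0
  set B : ℝ := k * Real.exp 1 with hB
  set C1 : ℝ := (k ^ 2 : ℕ) * (((k ^ 2).factorial : ℝ) * B ^ (k ^ 2) * B) / c0 with hC1
  have hk1 : (1 : ℝ) ≤ k := by exact_mod_cast hk
  have he1 : 1 < Real.exp 1 := Real.one_lt_exp_iff.2 one_pos
  have hc0p : 0 < c0 := by positivity
  have hB1 : 1 ≤ B := by rw [hB]; nlinarith
  refine ⟨max 1 ((k ^ 2 : ℕ) * C1), c0, hc0p, le_max_left _ _, fun M r => ?_⟩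
  set N1 := (k ^ 2) ^ q * q * (k ^ 2) with hN1
  refine ⟨(k ^ 2) ^ q + 2 * N1 + 1 + (lawLen k M (M + r) + N1), fun K _ _ _ F hfin hF => ?_⟩
  set N := (k ^ 2) ^ q + 2 * N1 + 1 + (lawLen k M (M + r) + N1) with hN
  obtain ⟨y, hy, hli⟩ := hF.basis q (Nat.factorial_pos k)
  obtain ⟨x, c, g, h, hlaw, hg, hh, hc, hsc⟩ := hF.law M
  set w : Fin (k ^ 2) → Mk k K := fun i => (ww q y i).1 with hw
  have hwN : ∀ i, ww q y i ∈ F ^ N1 := fun i => ww_mem y hy i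
  have mono : ∀ {m : ℕ}, m ≤ N → F ^ m ⊆ F ^ N := fun hm => Set.pow_subset_pow_right hF.one hm
  have hspan := span_of_li w hli
  have hQ1 := gram_ne_zero w hli
  -- the test word
  obtain ⟨i0, hT⟩ : ∃ i0, (((c (M + r)).1 - 1) * w i0).trace ≠ 0 := by
    by_contra hcon
    push Not at hcon
    apply hsc (M + r)
    have h0 : (c (M + r)).1 - 1 = 0 := by
      rw [Matrix.ext_iff_trace_mul_right]
      intro X
      rw [Matrix.zero_mul, Matrix.trace_zero]
      obtain ⟨γ, hγ⟩ := (Submodule.mem_span_range_iff_exists_fun K).1 (by rw [hspan]; trivial : X ∈ Submodule.span K (Set.range w))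
      rw [← hγ, Matrix.mul_sum, Matrix.trace_sum]
      refine Finset.sum_eq_zero fun i _ => ?_
      rw [Matrix.mul_smul, Matrix.trace_smul, hcon, smul_zero]
    rw [sc_iff]
    exact ⟨1, by rw [one_smul]; exact (sub_eq_zero.1 h0).symm⟩
  set T := (((c (M + r)).1 - 1) * w i0).trace with hTdef
  set Q1 := (gramM w).det with hQ1def
  have htrT : T = (c (M + r) * ww q y i0).1.trace - (ww q y i0).1.trace := by
    rw [hTdef, Matrix.sub_mul, Matrix.one_mul, Matrix.trace_sub]; rfl
  have hcw : c (M + r) * ww q y i0 ∈ F ^ N := by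
    refine mono (m := lawLen k M (M + r) + N1) (by omega) ?_
    rw [pow_add]
    exact Set.mul_mem_mul (hc _) (hwN _)
  have hw1 : ∀ i, ww q y i ∈ F ^ N := fun i => mono (m := N1) (by omega) (hwN i)
  have hww : ∀ i j, ww q y i * ww q y j ∈ F ^ N := fun i j => by
    refine mono (m := N1 + N1) (by omega) ?_
    rw [pow_add]
    exact Set.mul_mem_mul (hwN _) (hwN _)
  have hwfw : ∀ f ∈ F, ∀ i j, ww q y i * (f * ww q y j) ∈ F ^ N := fun f hf i j => by
    refine mono (m := N1 + (1 + N1)) (by omega) ?_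
    rw [pow_add, pow_add, pow_one]
    exact Set.mul_mem_mul (hwN _) (Set.mul_mem_mul hf (hwN _))
  have hQ : Q1 * T ≠ 0 := mul_ne_zero hQ1 hT
  obtain ⟨a, hae, haQ, halt⟩ := place_exists hk (F ^ N) (pow_fin hfin N) (Set.one_mem_pow hF.one) (Q1 * T) hQ
    (fun S hS => S.mul_mem (det_integ S _ fun i j => hS _ (hww i j)) (by
      rw [htrT]; exact S.sub_mem (hS _ hcw) (hS _ (hw1 _))))
    (by
      intro p _ _
      by_contra hcon
      push Not at hcon
      exact hF.inf (finite_of_alg p F hfin hF.one hF.symm (fun i => ww q y i) hli hwN (L := N) (by omega)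
        fun g hg => by
          have := hcon g hg
          rwa [Transcendental, not_not] at this))
  have htr : ∀ g ∈ F ^ N, a g.1.trace ≤ B := fun g hg =>
    tr_le a g.1 _ (fun l hl => hae l ⟨g, hg, hl⟩) (Real.exp_pos 1).le
  have haT : a T ≤ 2 * k * Real.exp 1 := by
    rw [htrT]
    have h1 := a.sub_le_add (c (M + r) * ww q y i0).1.trace (ww q y i0).1.trace
    have h2 := htr _ hcw
    have h3 := htr _ (hw1 i0)
    linarith
  have hgram : c0 ≤ a Q1 := by
    rw [hc0, div_le_iff₀ (by positivity)]
    rw [map_mul] at haQ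
    exact haQ.trans (mul_le_mul_of_nonneg_left haT (a.nonneg _))
  obtain ⟨R, hR, hRC⟩ := conj_exists hk a w hspan
  refine ⟨a, R, y, x, c, g, h, i0, hR, hy, hlaw, hg, hh, hc,
    fun f hf i j => (hRC f.1 C1 (fun l => ?_) i j).trans (le_max_right _ _), hgram, haQ, halt⟩
  exact expand_le a w hB1 hc0p hgram (fun i j => htr _ (hww i j)) (f.1 * w l) fun i => htr _ (hwfw f hf i l)

end
end USG
end PartP6b

section PartP10a
set_option linter.unusedVariables false
set_option linter.unusedSectionVars false
open Module Pointwise Filter Topology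

namespace USG

/-- a set of vectors closed under nonzero scalars -/
def IsCone {k : ℕ} {K : Type} [Field K] (A : Set (Fin k → K)) : Prop :=
  ∀ v ∈ A, ∀ c : K, c ≠ 0 → c • v ∈ A

/-- image under a matrix -/
def mim {k : ℕ} {K : Type} [Field K] (g : SLk k K) (A : Set (Fin k → K)) : Set (Fin k → K) :=
  (fun v => g.1.mulVec v) '' A

structure FAP {k : ℕ} {K : Type} [Field K] (m : Set (Fin k → K) → ℝ) : Prop where
  nonneg : ∀ A, 0 ≤ m A
  add : ∀ A A', Disjoint A A' → m (A ∪ A') = m A + m A'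
  univ : m Set.univ = 1
  zero : m {0} = 0

section
variable {K : Type} [Field K] {k : ℕ}

lemma mim_cone (g : SLk k K) {A : Set (Fin k → K)} (hA : IsCone A) : IsCone (mim g A) := by
  rintro _ ⟨v, hv, rfl⟩ c hc
  exact ⟨c • v, hA v hv c hc, by simp only [Matrix.mulVec_smul]⟩

lemma mim_mul (g h : SLk k K) (A : Set (Fin k → K)) : mim (g * h) A = mim g (mim h A) := by
  simp only [mim, Set.image_image]
  congr 1
  ext1 v
  rw [Matrix.mulVec_mulVec]; rfl

lemma mim_one (A : Set (Fin k → K)) : mim (1 : SLk k K) A = A := by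
  simp [mim]

lemma mem_mim (g : SLk k K) (A : Set (Fin k → K)) (v : Fin k → K) :
    v ∈ mim g A ↔ (g⁻¹).1.mulVec v ∈ A := by
  constructor
  · rintro ⟨u, hu, rfl⟩
    have : (g⁻¹).1.mulVec (g.1.mulVec u) = u := by
      rw [Matrix.mulVec_mulVec]
      change ((g⁻¹ * g : SLk k K).1).mulVec u = u
      rw [inv_mul_cancel]; exact Matrix.one_mulVec u
    simpa only [this] using hu
  · intro h
    refine ⟨_, h, ?_⟩
    change g.1.mulVec ((g⁻¹).1.mulVec v) = v
    rw [Matrix.mulVec_mulVec]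
    change ((g * g⁻¹ : SLk k K).1).mulVec v = v
    rw [mul_inv_cancel]; exact Matrix.one_mulVec v

lemma minv_pow (F : Set (SLk k K)) (m : Set (Fin k → K) → ℝ) (ε : ℝ)
    (h : ∀ σ ∈ F, ∀ A, IsCone A → |m (mim σ A) - m A| ≤ ε) (l : ℕ) :
    ∀ g ∈ F ^ l, ∀ A, IsCone A → |m (mim g A) - m A| ≤ l * ε := by
  induction l with
  | zero =>
    intro g hg A hA
    rw [pow_zero, Set.mem_one] at hg
    subst hg
    simp [mim_one]
  | succ l ih =>
    intro g hg A hA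
    rw [pow_succ] at hg
    obtain ⟨g1, h1, s, hs, rfl⟩ := hg
    have e1 := ih g1 h1 _ (mim_cone s hA)
    have e2 := h s hs A hA
    change |m (mim (g1 * s) A) - m A| ≤ _
    rw [mim_mul]
    have := abs_sub_le (m (mim g1 (mim s A))) (m (mim s A)) (m A)
    push_cast
    linarith

lemma FAP.mono {m : Set (Fin k → K) → ℝ} (hm : FAP m) {A A' : Set (Fin k → K)} (h : A ⊆ A') : m A ≤ m A' := by
  rw [← Set.union_sdiff_cancel h, hm.add _ _ Set.disjoint_sdiff_right]
  linarith [hm.nonneg (A' \ A)]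

noncomputable def conjR (R : Mk k K) (hR : R.det ≠ 0) : SLk k K →* SLk k K where
  toFun g := ⟨R⁻¹ * g.1 * R, by
    rw [Matrix.det_mul, Matrix.det_mul, g.2, mul_one, ← Matrix.det_mul,
      Matrix.nonsing_inv_mul _ hR.isUnit, Matrix.det_one]⟩
  map_one' := by
    apply Subtype.ext
    change R⁻¹ * 1 * R = 1
    rw [mul_one, Matrix.nonsing_inv_mul _ hR.isUnit]
  map_mul' g h := by
    apply Subtype.ext
    change R⁻¹ * (g.1 * h.1) * R = (R⁻¹ * g.1 * R) * (R⁻¹ * h.1 * R)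
    have := Matrix.mul_nonsing_inv R hR.isUnit
    simp only [mul_assoc]
    rw [← mul_assoc R R⁻¹, this, one_mul]

lemma conjR_val (R : Mk k K) (hR : R.det ≠ 0) (g : SLk k K) : (conjR R hR g).1 = R⁻¹ * g.1 * R := rfl

lemma conjR_trace (R : Mk k K) (hR : R.det ≠ 0) (X : Mk k K) : (R⁻¹ * X * R).trace = X.trace := by
  rw [Matrix.trace_mul_comm, ← mul_assoc, Matrix.mul_nonsing_inv R hR.isUnit, one_mul]

lemma ent_pow (a : AbsoluteValue K ℝ) (hk : 0 < k) (F : Set (SLk k K)) (R : Mk k K) (hR : R.det ≠ 0) (C0 : ℝ)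
    (hC0 : 1 ≤ C0)
    (h : ∀ f ∈ F, ∀ i j, a ((R⁻¹ * f.1 * R) i j) ≤ C0) (l : ℕ) :
    ∀ g ∈ F ^ l, ∀ i j, a ((conjR R hR g).1 i j) ≤ (k * C0) ^ l := by
  induction l with
  | zero =>
    intro g hg i j
    rw [pow_zero, Set.mem_one] at hg
    subst hg
    rw [map_one, pow_zero]
    change a ((1 : Mk k K) i j) ≤ 1
    rw [Matrix.one_apply]
    split_ifs <;> simp
  | succ l ih =>
    intro g hg i j
    rw [pow_succ] at hg
    obtain ⟨g1, h1, s, hs, rfl⟩ := hg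
    change a ((conjR R hR (g1 * s)).1 i j) ≤ _
    rw [map_mul]
    change a (((conjR R hR g1).1 * (conjR R hR s).1) i j) ≤ _
    rw [Matrix.mul_apply]
    have hC : 0 ≤ C0 := by linarith
    refine (a.sum_le _ _).trans ((Finset.sum_le_card_nsmul _ _ ((k * C0) ^ l * C0) fun t _ => ?_).trans ?_)
    · rw [map_mul]
      exact mul_le_mul (ih g1 h1 _ _) (h s hs _ _) (a.nonneg _) (by positivity)
    · rw [Finset.card_univ, Fintype.card_fin, nsmul_eq_mul, pow_succ]
      apply le_of_eq; ring

end

/-- a sequence of counterexamples -/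
structure SD (k M r N : ℕ) (C0 c0 : ℝ) (K : ℕ → Type) [∀ n, Field (K n)] where
  hk : 0 < k
  hC0 : 1 ≤ C0
  hc0 : 0 < c0
  F : ∀ n, Set (SLk k (K n))
  good : ∀ n, Good (F n)
  a : ∀ n, AbsoluteValue (K n) ℝ
  R : ∀ n, Mk k (K n)
  y : ∀ n, Fin (k ^ 2) → Fin (k ^ 2) → SLk k (K n)
  x : ∀ n, SLk k (K n)
  c : ∀ n, ℕ → SLk k (K n)
  g : ∀ n, ℕ → SLk k (K n)
  h : ∀ n, ℕ → SLk k (K n)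
  i0 : ∀ n : ℕ, Fin (k ^ 2)
  nd : ∀ n, NData M r N C0 c0 (F n) (a n) (R n) (y n) (x n) (c n) (g n) (h n) (i0 n)
  m : ∀ n, Set (Fin k → K n) → ℝ
  fap : ∀ n, FAP (m n)
  inv : ∀ n, ∀ σ ∈ F n, ∀ A, IsCone A → |m n (mim σ A) - m n A| ≤ 1 / ((n : ℝ) + 1)

namespace SD
section
variable {k M r N : ℕ} {C0 c0 : ℝ} {K : ℕ → Type} [∀ n, Field (K n)] (S : SD k M r N C0 c0 K)

/-- bounded word sequences -/
def B : Subgroup (∀ n, SLk k (K n)) where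
  carrier := {g | ∃ l, ∀ n, g n ∈ S.F n ^ l}
  mul_mem' := by
    rintro g h ⟨l, hl⟩ ⟨l', hl'⟩
    exact ⟨l + l', fun n => by rw [pow_add]; exact Set.mul_mem_mul (hl n) (hl' n)⟩
  one_mem' := ⟨0, fun n => by simp⟩
  inv_mem' := by
    rintro g ⟨l, hl⟩
    exact ⟨l, fun n => pow_inv_mem (S.good n).symm (hl n)⟩

/-- conjugated action -/
noncomputable def gam : S.B →* ∀ n, Matrix.SpecialLinearGroup (Fin k) (K n) where
  toFun g n := conjR (S.R n) (S.nd n).hR (g.1 n)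
  map_one' := by funext n; exact map_one (conjR (S.R n) (S.nd n).hR)
  map_mul' g h := by funext n; exact map_mul (conjR (S.R n) (S.nd n).hR) (g.1 n) (h.1 n)

lemma gam_apply (g : S.B) (n : ℕ) : S.gam g n = conjR (S.R n) (S.nd n).hR (g.1 n) := rfl

/-- pull back -/
def pb (A : Set (XX k K)) (n : ℕ) : Set (Fin k → K n) := {x | (⟨n, (S.R n)⁻¹.mulVec x⟩ : XX k K) ∈ A}

lemma m_le_one (n : ℕ) (A : Set (Fin k → K n)) : S.m n A ≤ 1 := by
  rw [← (S.fap n).univ]; exact (S.fap n).mono (Set.subset_univ _)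

lemma exists_lim (U : Ultrafilter ℕ) (A : Set (XX k K)) : ∃ x, Tendsto (fun n => S.m n (S.pb A n)) U (𝓝 x) := by
  refine exists_ulim U _ 1 (Eventually.of_forall fun n => ?_)
  rw [abs_of_nonneg ((S.fap n).nonneg _)]
  exact S.m_le_one n _

/-- limit measure -/
noncomputable def ML (U : Ultrafilter ℕ) (A : Set (XX k K)) : ℝ := (S.exists_lim U A).choose

lemma ML_lim (U : Ultrafilter ℕ) (A : Set (XX k K)) :
    Tendsto (fun n => S.m n (S.pb A n)) U (𝓝 (S.ML U A)) := (S.exists_lim U A).choose_spec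

lemma pb_cone {A : Set (XX k K)} (hA : IsConeX A) (n : ℕ) : IsCone (S.pb A n) := by
  intro v hv c hc
  change (⟨n, (S.R n)⁻¹.mulVec (c • v)⟩ : XX k K) ∈ A
  rw [Matrix.mulVec_smul]
  exact hA _ hv c hc

lemma pb_act (g : S.B) (A : Set (XX k K)) (n : ℕ) :
    S.pb (actX S.gam g '' A) n = mim (g.1 n) (S.pb A n) := by
  have hR := (S.nd n).hR
  have h1 := Matrix.mul_nonsing_inv (S.R n) hR.isUnit
  have h2 := Matrix.nonsing_inv_mul (S.R n) hR.isUnit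
  ext v
  constructor
  · rintro ⟨⟨n', u⟩, hu, he⟩
    obtain rfl : n' = n := congrArg Sigma.fst he
    have he' := eq_of_heq (Sigma.mk.inj he).2
    refine ⟨(S.R n').mulVec u, ?_, ?_⟩
    · change (⟨n', (S.R n')⁻¹.mulVec ((S.R n').mulVec u)⟩ : XX k K) ∈ A
      rw [Matrix.mulVec_mulVec, h2, Matrix.one_mulVec]; exact hu
    · change (g.1 n').1.mulVec ((S.R n').mulVec u) = v
      have h3 : ((S.R n')⁻¹ * (g.1 n').1 * S.R n').mulVec u = (S.R n')⁻¹.mulVec v := he'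
      have h4 := congrArg (S.R n').mulVec h3
      rw [Matrix.mulVec_mulVec, Matrix.mulVec_mulVec, h1, Matrix.one_mulVec, ← mul_assoc, ← mul_assoc, h1, one_mul] at h4
      rw [Matrix.mulVec_mulVec, h4]
  · rintro ⟨u, hu, rfl⟩
    refine ⟨_, hu, ?_⟩
    change (⟨n, ((S.R n)⁻¹ * (g.1 n).1 * S.R n).mulVec ((S.R n)⁻¹.mulVec u)⟩ : XX k K) =
      ⟨n, (S.R n)⁻¹.mulVec ((g.1 n).1.mulVec u)⟩
    congr 1
    rw [Matrix.mulVec_mulVec, Matrix.mulVec_mulVec, mul_assoc, h1, mul_one]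

lemma hyp_lim : Tendsto (fun n : ℕ => 1 / ((n : ℝ) + 1)) (hyperfilter ℕ : Filter ℕ) (𝓝 0) :=
  (tendsto_one_div_add_atTop_nhds_zero_nat (𝕜 := ℝ)).mono_left Nat.hyperfilter_le_atTop

/-- the limit system -/
noncomputable def toLim {L : Type} [Field L] (b : AbsoluteValue L ℝ) (st : bdd K S.a (hyperfilter ℕ) →+* L)
    (hsurj : Function.Surjective st)
    (hlim : ∀ x : bdd K S.a (hyperfilter ℕ), Tendsto (fun n => S.a n (x.1 n)) (hyperfilter ℕ : Filter ℕ) (𝓝 (b (st x)))) :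
    LimSys S.a (hyperfilter ℕ) b st k S.B where
  γ := S.gam
  bd := by
    rintro ⟨g, l, hl⟩
    exact ⟨_, fun n i j => ent_pow (S.a n) S.hk (S.F n) (S.R n) (S.nd n).hR C0 S.hC0 (S.nd n).ent l _ (hl n) i j⟩
  surj := hsurj
  lim := hlim
  M := S.ML (hyperfilter ℕ)
  nonneg A := ge_of_tendsto' (S.ML_lim _ A) fun n => (S.fap n).nonneg _
  add A A' hd := by
    refine tendsto_nhds_unique (S.ML_lim _ _) (((S.ML_lim _ A).add (S.ML_lim _ A')).congr fun n => ?_)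
    rw [← (S.fap n).add]
    · rfl
    · rw [Set.disjoint_left] at hd ⊢
      intro v h1 h2
      exact hd h1 h2
  univ := by
    refine tendsto_nhds_unique (S.ML_lim _ _) (tendsto_const_nhds.congr fun n => ?_)
    exact ((S.fap n).univ).symm
  mono A A' h := by
    refine le_of_tendsto_of_tendsto (S.ML_lim _ A) (S.ML_lim _ A') ?_
    filter_upwards [h] with n hn
    exact (S.fap n).mono fun v hv => hn _ hv
  zero := by
    refine tendsto_nhds_unique (S.ML_lim _ _) (tendsto_const_nhds.congr fun n => ?_)
    have : S.pb {p | p.2 = 0} n = {0} := by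
      ext v
      rw [Set.mem_singleton_iff]
      change (S.R n)⁻¹.mulVec v = 0 ↔ v = 0
      constructor
      · intro h
        have := congrArg (S.R n).mulVec h
        rwa [Matrix.mulVec_mulVec, Matrix.mul_nonsing_inv (S.R n) (S.nd n).hR.isUnit, Matrix.one_mulVec,
          Matrix.mulVec_zero] at this
      · rintro rfl; simp
    rw [this]; exact ((S.fap n).zero).symm
  inv := by
    rintro ⟨g, l, hl⟩ A hA
    have h1 := (S.ML_lim (hyperfilter ℕ) (actX S.gam ⟨g, l, hl⟩ '' A)).sub (S.ML_lim (hyperfilter ℕ) A)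
    have h2 : Tendsto (fun n => S.m n (S.pb (actX S.gam ⟨g, l, hl⟩ '' A) n) - S.m n (S.pb A n)) (hyperfilter ℕ : Filter ℕ) (𝓝 0) := by
      refine squeeze_zero_norm (a := fun n : ℕ => (l : ℝ) * (1 / ((n : ℝ) + 1))) (fun n => ?_)
        (by simpa using hyp_lim.const_mul (l : ℝ))
      rw [Real.norm_eq_abs, pb_act]
      exact minv_pow (S.F n) (S.m n) _ (S.inv n) l _ (hl n) _ (S.pb_cone hA n)
    have := tendsto_nhds_unique h1 h2
    linarith

end
end SD
end USG
end PartP10a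

section PartP10b
set_option linter.unusedVariables false
set_option linter.unusedSectionVars false
open Module Pointwise Filter Topology

namespace USG

lemma ww_map {H H' : Type*} [Monoid H] [Monoid H'] (φ : H →* H') {D E q : ℕ} (y : Fin D → Fin E → H) (i : Fin D) :
    φ (ww q y i) = ww q (fun i j => φ (y i j)) i := by
  rw [ww, ww, map_list_prod, List.map_ofFn]
  congr 2
  ext1 j
  exact map_pow φ _ _

/-- Gram matrix over a ring -/
def gramR {R : Type*} [CommRing R] {k D : ℕ} (w : Fin D → Matrix (Fin k) (Fin k) R) : Matrix (Fin D) (Fin D) R :=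
  Matrix.of fun i j => (w i * w j).trace

lemma map_trace' {R E : Type*} [CommRing R] [CommRing E] {k : ℕ} (φ : R →+* E) (X : Matrix (Fin k) (Fin k) R) :
    φ X.trace = (X.map φ).trace := by
  simp [Matrix.trace]

lemma gramR_map {R : Type*} [CommRing R] {E : Type} [Field E] {k D : ℕ} (w : Fin D → Matrix (Fin k) (Fin k) R)
    (φ : R →+* E) : φ (gramR w).det = (gramM (fun i => (w i).map φ)).det := by
  rw [RingHom.map_det]
  congr 1
  ext i j
  change φ (w i * w j).trace = ((w i).map φ * (w j).map φ).trace
  rw [map_trace', Matrix.map_mul]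

lemma gram_conj {K : Type} [Field K] {k D : ℕ} (R : Mk k K) (hR : R.det ≠ 0) (w : Fin D → SLk k K) :
    gramM (fun i => (conjR R hR (w i)).1) = gramM (fun i => (w i).1) := by
  ext i j
  change ((conjR R hR (w i)).1 * (conjR R hR (w j)).1).trace = ((w i).1 * (w j).1).trace
  have : (conjR R hR (w i)).1 * (conjR R hR (w j)).1 = (conjR R hR (w i * w j)).1 := by rw [map_mul]; rfl
  rw [this, conjR_val, conjR_trace _ hR]; rfl

namespace SD
section
variable {k M r N : ℕ} {C0 c0 : ℝ} {K : ℕ → Type} [∀ n, Field (K n)] (S : SD k M r N C0 c0 K)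

/-- evaluation of bounded sequences -/
noncomputable def ev (n : ℕ) : bdd K S.a (hyperfilter ℕ) →+* K n :=
  (Pi.evalRingHom (fun n => K n) n).comp (bdd K S.a (hyperfilter ℕ)).subtype

lemma ev_apply (n : ℕ) (x : bdd K S.a (hyperfilter ℕ)) : S.ev n x = x.1 n := rfl

/-- evaluation of words -/
def evB (n : ℕ) : S.B →* SLk k (K n) := (Pi.evalMonoidHom (fun n => SLk k (K n)) n).comp S.B.subtype

lemma evB_apply (n : ℕ) (g : S.B) : S.evB n g = g.1 n := rfl

/-- the sequence y -/
def yB (i j : Fin (k ^ 2)) : S.B := ⟨fun n => S.y n i j, _, fun n => (S.nd n).hy i j⟩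

def wB (i : Fin (k ^ 2)) : S.B := ww k.factorial S.yB i

lemma wB_ev (n : ℕ) (i : Fin (k ^ 2)) : (S.wB i).1 n = ww k.factorial (S.y n) i := by
  rw [← S.evB_apply, wB, ww_map]; rfl

variable {L : Type} [Field L] {b : AbsoluteValue L ℝ} {st : bdd K S.a (hyperfilter ℕ) →+* L}
    (hsurj : Function.Surjective st)
    (hlim : ∀ x : bdd K S.a (hyperfilter ℕ), Tendsto (fun n => S.a n (x.1 n)) (hyperfilter ℕ : Filter ℕ) (𝓝 (b (st x))))

lemma gO_ev (g : S.B) (n : ℕ) : ((S.toLim b st hsurj hlim).gO g).map (S.ev n) = (conjR (S.R n) (S.nd n).hR (g.1 n)).1 := rfl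

lemma gram_ev (n : ℕ) : (gramR (fun i => (S.toLim b st hsurj hlim).gO (S.wB i))).det.1 n =
    (gramM (fun i => (ww k.factorial (S.y n) i).1)).det := by
  rw [← S.ev_apply, gramR_map]
  simp only [gO_ev]
  rw [gram_conj]
  simp only [wB_ev]

lemma gram_lim : c0 ≤ b (gramM (fun i => (S.toLim b st hsurj hlim).θ (S.wB i))).det := by
  have h := hlim (gramR (fun i => (S.toLim b st hsurj hlim).gO (S.wB i))).det
  rw [gramR_map] at h
  refine ge_of_tendsto' h fun n => ?_
  rw [gram_ev]
  exact (S.nd n).gram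

lemma hspan (W : Submodule L (Fin k → L))
    (hW : ∀ x : S.B, W.map ((S.toLim b st hsurj hlim).ρ (x ^ k.factorial)) ≤ W) : W = ⊥ ∨ W = ⊤ := by
  classical
  set D := S.toLim b st hsurj hlim with hD
  have hg : (gramM (fun i => D.θ (S.wB i))).det ≠ 0 := by
    intro h0
    have := S.gram_lim hsurj hlim
    rw [← hD, h0, map_zero] at this
    linarith [S.hc0]
  have hsp := span_of_li _ (li_of_gram _ hg)
  have h1 : ∀ (x : S.B), ∀ v ∈ W, Matrix.vecMul v (D.θ (x ^ k.factorial)) ∈ W := by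
    intro x v hv
    have := hW x⁻¹ (Submodule.mem_map_of_mem hv)
    rwa [D.ρ_apply, inv_pow, inv_inv] at this
  have h2 : ∀ (l : List S.B), ∀ v ∈ W, Matrix.vecMul v (D.θ ((l.map fun x => x ^ k.factorial).prod)) ∈ W := by
    intro l
    induction l with
    | nil => intro v hv; simpa using hv
    | cons x l ih =>
      intro v hv
      rw [List.map_cons, List.prod_cons, map_mul, ← Matrix.vecMul_vecMul]
      exact ih _ (h1 x v hv)
  have h3 : ∀ i, ∀ v ∈ W, Matrix.vecMul v (D.θ (S.wB i)) ∈ W := by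
    intro i v hv
    have := h2 (List.ofFn fun j => S.yB i j) v hv
    rw [List.map_ofFn] at this
    exact this
  have h4 : ∀ X : Mk k L, ∀ v ∈ W, Matrix.vecMul v X ∈ W := by
    intro X v hv
    obtain ⟨γ, hγ⟩ := (Submodule.mem_span_range_iff_exists_fun L).1 (by rw [hsp]; trivial :
      X ∈ Submodule.span L (Set.range fun i => D.θ (S.wB i)))
    rw [← hγ, Matrix.vecMul_sum]
    refine W.sum_mem fun i _ => ?_
    rw [Matrix.vecMul_smul]
    exact W.smul_mem _ (h3 i v hv)
  by_cases hb : W = ⊥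
  · exact Or.inl hb
  right
  obtain ⟨v, hv, hv0⟩ := W.ne_bot_iff.1 hb
  obtain ⟨t, ht⟩ := Function.ne_iff.1 hv0
  rw [eq_top_iff]
  intro u _
  have := h4 (Matrix.of fun i j => if i = t then (v t)⁻¹ * u j else 0) v hv
  convert this using 1
  ext j
  have ht' : v t ≠ 0 := ht
  simp [Matrix.vecMul, dotProduct, ht']

lemma roots_one [IsAlgClosed L] (g : S.B) (l : L) (hl : l ∈ ((S.toLim b st hsurj hlim).θ g).charpoly.roots) : b l = 1 := by
  set D := S.toLim b st hsurj hlim with hD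
  refine D.abs_eigen (S.hspan hsurj hlim) g⁻¹ l ?_
  have h1 : D.ρ g⁻¹ = Matrix.toLin' (D.θ g).transpose := by
    apply LinearMap.ext
    intro v
    rw [D.ρ_apply, inv_inv, Matrix.toLin'_apply, Matrix.mulVec_transpose]
  rw [h1, Module.End.hasEigenvalue_iff_isRoot_charpoly, Matrix.charpoly_toLin', Matrix.charpoly_transpose]
  exact Polynomial.isRoot_of_mem_roots hl

lemma tr_bound [IsAlgClosed L] (g : S.B) : b ((S.toLim b st hsurj hlim).θ g).trace ≤ k := by
  have := tr_le b ((S.toLim b st hsurj hlim).θ g) 1 (fun l hl => (S.roots_one hsurj hlim g l hl).le) zero_le_one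
  simpa using this

lemma case_one [IsAlgClosed L] (hsurj : Function.Surjective st)
    (hlim : ∀ x : bdd K S.a (hyperfilter ℕ), Tendsto (fun n => S.a n (x.1 n)) (hyperfilter ℕ : Filter ℕ) (𝓝 (b (st x))))
    (h : ∀ᶠ n in (hyperfilter ℕ : Filter ℕ), ∃ l, Eig (S.F n ^ N) l ∧ S.a n l = Real.exp 1) : False := by
  classical
  set D := S.toLim b st hsurj hlim with hD
  have h' : ∀ n, ∃ (l : K n) (g : SLk k (K n)), g ∈ S.F n ^ N ∧ S.a n l ≤ Real.exp 1 ∧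
      ((∃ l, Eig (S.F n ^ N) l ∧ S.a n l = Real.exp 1) → l ∈ g.1.charpoly.roots ∧ S.a n l = Real.exp 1) := by
    intro n
    by_cases hn : ∃ l, Eig (S.F n ^ N) l ∧ S.a n l = Real.exp 1
    · obtain ⟨l, ⟨g, hg, hl⟩, he⟩ := hn
      exact ⟨l, g, hg, he.le, fun _ => ⟨hl, he⟩⟩
    · exact ⟨0, 1, Set.one_mem_pow (S.good n).one, by simp [Real.exp_nonneg], fun h => absurd h hn⟩
  choose l g hg hle hP using h'
  let gB : S.B := ⟨g, N, hg⟩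
  let lb : bdd K S.a (hyperfilter ℕ) := ⟨l, Real.exp 1, Eventually.of_forall hle⟩
  have hb1 : b (st lb) = Real.exp 1 := by
    refine tendsto_nhds_unique (hlim lb) (tendsto_const_nhds.congr' ?_)
    filter_upwards [h] with n hn
    exact (hP n hn).2.symm
  have hb2 : st lb ∈ (D.θ gB).charpoly.roots := by
    rw [Polynomial.mem_roots (Matrix.charpoly_monic _).ne_zero, Polynomial.IsRoot, Matrix.eval_charpoly]
    let X : Matrix (Fin k) (Fin k) (bdd K S.a (hyperfilter ℕ)) := Matrix.scalar (Fin k) lb - D.gO gB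
    have e1 : Matrix.scalar (Fin k) (st lb) - D.θ gB = X.map st := by
      ext i j
      simp only [X, Matrix.sub_apply, Matrix.map_apply, map_sub, Matrix.scalar_apply, Matrix.diagonal_apply]
      rw [D.θ_apply]
      split_ifs <;> simp
    rw [e1]
    have e2 : (X.map st).det = st X.det := by rw [RingHom.map_det]; rfl
    rw [e2]
    apply b.eq_zero.1
    refine tendsto_nhds_unique (hlim X.det) (tendsto_const_nhds.congr' ?_)
    filter_upwards [h] with n hn
    have e3 : X.det.1 n = (X.map (S.ev n)).det := by
      rw [← S.ev_apply, RingHom.map_det]; rfl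
    have hR := (S.nd n).hR
    have e4 : X.map (S.ev n) = (S.R n)⁻¹ * (Matrix.scalar (Fin k) (l n) - (g n).1) * S.R n := by
      have e5 : X.map (S.ev n) = Matrix.scalar (Fin k) (l n) - (conjR (S.R n) (S.nd n).hR (g n)).1 := by
        ext i j
        simp only [X, Matrix.sub_apply, Matrix.map_apply, map_sub, Matrix.scalar_apply, Matrix.diagonal_apply]
        congr 1
        split_ifs
        · rfl
        · exact map_zero _
      rw [e5, conjR_val, mul_sub, sub_mul]
      congr 1
      rw [← (Matrix.scalar_commute (l n) (fun r => mul_comm _ _) _).eq, mul_assoc, Matrix.nonsing_inv_mul _ hR.isUnit, mul_one]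
    have e6 : (Matrix.scalar (Fin k) (l n) - (g n).1).det = 0 := by
      have := (hP n hn).1
      rwa [Polynomial.mem_roots (Matrix.charpoly_monic _).ne_zero, Polynomial.IsRoot, Matrix.eval_charpoly] at this
    rw [e3, e4, Matrix.det_mul, Matrix.det_mul, e6]
    simp
  have := S.roots_one hsurj hlim gB _ hb2
  rw [hb1] at this
  have := Real.one_lt_exp_iff.2 one_pos
  linarith

end
end SD
end USG
end PartP10b

section PartP10c
set_option linter.unusedVariables false
set_option linter.unusedSectionVars false
open Module Pointwise Filter Topology

namespace USG

lemma exists_ulimC (U : Ultrafilter ℕ) (f : ℕ → ℂ) (C : ℝ) (h : ∀ᶠ n in U, ‖f n‖ ≤ C) :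
    ∃ x, Tendsto f U (𝓝 x) := by
  have hc : IsCompact (Metric.closedBall (0 : ℂ) C) := isCompact_closedBall _ _
  have h1 : (U.map f : Filter ℂ) ≤ 𝓟 (Metric.closedBall (0 : ℂ) C) := by
    rw [le_principal_iff]
    exact h.mono fun n hn => by simpa using hn
  obtain ⟨x, -, hx⟩ := hc.ultrafilter_le_nhds (U.map f) h1
  exact ⟨x, hx⟩

lemma exists_jO {K : ℕ → Type} [∀ n, Field (K n)] (a : ∀ n, AbsoluteValue (K n) ℝ) (U : Ultrafilter ℕ)
    (h : ∀ᶠ n in U, ∃ ι : K n →+* ℂ, ∀ x, a n x = ‖ι x‖) :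
    ∃ j : bdd K a U →+* ℂ, ∀ x, Tendsto (fun n => a n (x.1 n)) U (𝓝 ‖j x‖) := by
  classical
  have h' : ∀ n, ∃ E : K n → ℂ, (∃ ι : K n →+* ℂ, ∀ x, a n x = ‖ι x‖) →
      ∃ ι : K n →+* ℂ, (∀ x, a n x = ‖ι x‖) ∧ ∀ x, E x = ι x := by
    intro n
    by_cases hn : ∃ ι : K n →+* ℂ, ∀ x, a n x = ‖ι x‖
    · obtain ⟨ι, hι⟩ := hn
      exact ⟨ι, fun _ => ⟨ι, hι, fun _ => rfl⟩⟩
    · exact ⟨fun _ => 0, fun h => absurd h hn⟩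
  choose E hE using h'
  have hE' : ∀ᶠ n in U, ∃ ι : K n →+* ℂ, (∀ x, a n x = ‖ι x‖) ∧ ∀ x, E n x = ι x :=
    h.mono fun n hn => hE n hn
  have hl : ∀ x : bdd K a U, ∃ z, Tendsto (fun n => E n (x.1 n)) U (𝓝 z) := by
    rintro ⟨x, C, hC⟩
    refine exists_ulimC U _ C ?_
    filter_upwards [hC, hE'] with n h1 ⟨ι, h2, h3⟩
    rw [h3, ← h2]; exact h1
  choose j hj using hl
  refine ⟨⟨⟨⟨j, ?_⟩, ?_⟩, ?_, ?_⟩, fun x => ?_⟩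
  · refine tendsto_nhds_unique (hj 1) (tendsto_const_nhds.congr' ?_)
    filter_upwards [hE'] with n ⟨ι, h2, h3⟩
    rw [h3]; exact (map_one ι).symm
  · intro x y
    refine tendsto_nhds_unique (hj (x * y)) (((hj x).mul (hj y)).congr' ?_)
    filter_upwards [hE'] with n ⟨ι, h2, h3⟩
    rw [h3, h3, h3]; exact (map_mul ι _ _).symm
  · refine tendsto_nhds_unique (hj 0) (tendsto_const_nhds.congr' ?_)
    filter_upwards [hE'] with n ⟨ι, h2, h3⟩
    rw [h3]; exact (map_zero ι).symm
  · intro x y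
    refine tendsto_nhds_unique (hj (x + y)) (((hj x).add (hj y)).congr' ?_)
    filter_upwards [hE'] with n ⟨ι, h2, h3⟩
    rw [h3, h3, h3]; exact (map_add ι _ _).symm
  · refine ((hj x).norm).congr' ?_
    filter_upwards [hE'] with n ⟨ι, h2, h3⟩
    rw [h3, h2]

/-- bound for the coefficients -/
noncomputable def Cg (k : ℕ) (c0 : ℝ) : ℝ := (k ^ 2 : ℕ) * (((k ^ 2).factorial : ℝ) * (k : ℝ) ^ (k ^ 2) * (k : ℝ)) / c0

/-- bound for the entries -/
noncomputable def C2 (k : ℕ) (C0 c0 : ℝ) : ℝ :=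
  (k ^ 2 : ℕ) * (Cg k c0 * (k * C0) ^ ((k ^ 2) ^ k.factorial * k.factorial * k ^ 2))

namespace SD
section
variable {k M r N : ℕ} {C0 c0 : ℝ} {K : ℕ → Type} [∀ n, Field (K n)] (S : SD k M r N C0 c0 K)

def cB (j : ℕ) : S.B := ⟨fun n => S.c n j, _, fun n => (S.nd n).hc j⟩
def gB (j : ℕ) : S.B := ⟨fun n => S.g n j, _, fun n => (S.nd n).hg j⟩
def hB (j : ℕ) : S.B := ⟨fun n => S.h n j, _, fun n => (S.nd n).hh j⟩

lemma lawB : Law M (S.cB 0) S.cB S.gB S.hB where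
  zero := rfl
  step j hj := by
    apply Subtype.ext
    funext n
    have := (S.nd n).law.step j hj
    rw [← (S.nd n).law.zero] at this
    exact this
  step' j hj := by
    apply Subtype.ext
    funext n
    exact (S.nd n).law.step' j hj

def uB : S.B := ⟨fun n => ww k.factorial (S.y n) (S.i0 n), _, fun n => ww_mem (S.y n) (S.nd n).hy (S.i0 n)⟩

variable {L : Type} [Field L] {b : AbsoluteValue L ℝ} {st : bdd K S.a (hyperfilter ℕ) →+* L}

lemma case_two [IsAlgClosed L] (hsurj : Function.Surjective st)
    (hlim : ∀ x : bdd K S.a (hyperfilter ℕ), Tendsto (fun n => S.a n (x.1 n)) (hyperfilter ℕ : Filter ℕ) (𝓝 (b (st x))))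
    (h : ∀ᶠ n in (hyperfilter ℕ : Filter ℕ), ∃ ι : K n →+* ℂ, ∀ x, S.a n x = ‖ι x‖) (δ : ℝ)
    (hal : ∀ (H : Type) [Group H]
      (ρ : H →* Matrix (Fin k) (Fin k) ℂ), (∀ g i j, ‖ρ g i j‖ ≤ C2 k C0 c0) →
      ∀ (x : H) (c g l : ℕ → H), Law M x c g l → ∀ u : H,
        ‖((ρ (c (M + r)) - 1) * ρ u).trace‖ ≤ δ)
    (hδ : ((k ^ 2).factorial * (k : ℝ) ^ (k ^ 2)) * δ < 1) : False := by
  classical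
  set D := S.toLim b st hsurj hlim with hD
  obtain ⟨j, hj⟩ := exists_jO S.a (hyperfilter ℕ) h
  have hk1 : (1 : ℝ) ≤ k := by exact_mod_cast S.hk
  have hjb : ∀ x, ‖j x‖ = b (st x) := fun x => tendsto_nhds_unique (hj x) (hlim x)
  let ρ : S.B →* Matrix (Fin k) (Fin k) ℂ :=
    (j.mapMatrix : Matrix (Fin k) (Fin k) (bdd K S.a (hyperfilter ℕ)) →+* Matrix (Fin k) (Fin k) ℂ).toMonoidHom.comp D.gO
  have hρ : ∀ g, ρ g = (D.gO g).map j := fun g => rfl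
  let nv : AbsoluteValue ℂ ℝ := NormedField.toAbsoluteValue ℂ
  have hnv : ∀ z, nv z = ‖z‖ := fun z => rfl
  have htr : ∀ g, nv (ρ g).trace ≤ k := by
    intro g
    rw [hnv, hρ, ← map_trace', hjb, map_trace']
    exact S.tr_bound hsurj hlim g
  have hww : ∀ i l, nv (ρ (S.wB i) * ρ (S.wB l)).trace ≤ k := fun i l => by
    rw [← map_mul]; exact htr _
  have hgr : c0 ≤ nv (gramM (fun i => ρ (S.wB i))).det := by
    have := S.gram_lim hsurj hlim
    have e := gramR_map (fun i => D.gO (S.wB i)) j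
    have e' := gramR_map (fun i => D.gO (S.wB i)) st
    change c0 ≤ b (gramM (fun i => (D.gO (S.wB i)).map st)).det at this
    rw [← e', ← hjb, e] at this
    exact this
  have hwent : ∀ i s t, ‖ρ (S.wB i) s t‖ ≤ (k * C0) ^ ((k ^ 2) ^ k.factorial * k.factorial * k ^ 2) := by
    intro i s t
    refine le_of_tendsto' (hj (D.gO (S.wB i) s t)) fun n => ?_
    have := ent_pow (S.a n) S.hk (S.F n) (S.R n) (S.nd n).hR C0 S.hC0 (S.nd n).ent _ _ (ww_mem (q := k.factorial) (S.y n) (S.nd n).hy i) s t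
    rw [← wB_ev] at this
    exact this
  have hent : ∀ g s t, ‖ρ g s t‖ ≤ C2 k C0 c0 := by
    intro g s t
    obtain ⟨γ, hγ, hγ'⟩ := expand_le nv (fun i => ρ (S.wB i)) hk1 S.hc0 hgr hww (ρ g)
      (fun i => by rw [← map_mul]; exact htr _)
    rw [hγ, Matrix.sum_apply]
    refine (norm_sum_le _ _).trans ((Finset.sum_le_card_nsmul _ _
      (Cg k c0 * (k * C0) ^ ((k ^ 2) ^ k.factorial * k.factorial * k ^ 2)) fun i _ => ?_).trans ?_)
    · rw [Matrix.smul_apply, smul_eq_mul, norm_mul]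
      refine mul_le_mul (hγ' i) (hwent i s t) (norm_nonneg _) ?_
      have := S.hc0
      rw [Cg]; positivity
    · rw [Finset.card_univ, Fintype.card_fin, nsmul_eq_mul, C2]
  have h1 := hal S.B ρ hent _ _ _ _ S.lawB S.uB
  have h2 : ‖(gramM (fun i => ρ (S.wB i))).det‖ ≤ (k ^ 2).factorial * (k : ℝ) ^ (k ^ 2) := by
    have := Matrix.det_le (A := gramM (fun i => ρ (S.wB i))) (abv := nv) (x := (k : ℝ)) (fun i l => hww i l)
    rw [Fintype.card_fin, nsmul_eq_mul] at this
    exact this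
  have h3 : 1 ≤ ‖(gramM (fun i => ρ (S.wB i))).det * ((ρ (S.cB (M + r)) - 1) * ρ S.uB).trace‖ := by
    let Z : bdd K S.a (hyperfilter ℕ) := (gramR (fun i => D.gO (S.wB i))).det *
      ((D.gO (S.cB (M + r)) - 1) * D.gO S.uB).trace
    have e1 : j Z = (gramM (fun i => ρ (S.wB i))).det * ((ρ (S.cB (M + r)) - 1) * ρ S.uB).trace := by
      rw [map_mul, gramR_map, map_trace', Matrix.map_mul, Matrix.map_sub _ (map_sub j), Matrix.map_one _ (map_zero j) (map_one j)]
      rfl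
    rw [← e1]
    refine ge_of_tendsto' (hj Z) fun n => ?_
    have e2 : Z.1 n = (gramM (fun i => (ww k.factorial (S.y n) i).1)).det *
        (((S.c n (M + r)).1 - 1) * (ww k.factorial (S.y n) (S.i0 n)).1).trace := by
      rw [← S.ev_apply, map_mul, S.ev_apply, gram_ev, map_trace', Matrix.map_mul, Matrix.map_sub _ (map_sub _),
        Matrix.map_one _ (map_zero _) (map_one _), gO_ev, gO_ev]
      congr 1
      rw [conjR_val, conjR_val]
      have hR := (S.nd n).hR
      have e3 : ((S.R n)⁻¹ * ((S.cB (M + r)).1 n).1 * S.R n - 1) * ((S.R n)⁻¹ * (S.uB.1 n).1 * S.R n) =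
          (S.R n)⁻¹ * ((((S.cB (M + r)).1 n).1 - 1) * (S.uB.1 n).1) * S.R n := by
        have e4 : (S.R n)⁻¹ * ((S.cB (M + r)).1 n).1 * S.R n - 1 = (S.R n)⁻¹ * (((S.cB (M + r)).1 n).1 - 1) * S.R n := by
          rw [mul_sub, sub_mul, mul_one, Matrix.nonsing_inv_mul _ hR.isUnit]
        rw [e4]
        simp only [mul_assoc]
        rw [← mul_assoc (S.R n) (S.R n)⁻¹, Matrix.mul_nonsing_inv _ hR.isUnit, one_mul]
      rw [e3, conjR_trace _ hR]
      rfl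
    rw [e2]
    exact (S.nd n).big
  rw [norm_mul] at h3
  have := mul_le_mul h2 h1 (norm_nonneg _) (by positivity)
  linarith

end
end SD

theorem theoremM (k : ℕ) (hk : 0 < k) : ∃ ε : ℝ, 0 < ε ∧ ∀ (K : Type) [Field K] [IsAlgClosed K] [Countable K]
    (F : Set (SLk k K)), F.Finite → Good F → ∀ m : Set (Fin k → K) → ℝ, FAP m →
      ∃ σ ∈ F, ∃ A, IsCone A ∧ ε < |m (mim σ A) - m A| := by
  by_contra hcon
  push Not at hcon
  obtain ⟨C0, c0, hc0, hC0, hN⟩ := theoremN k hk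
  set X : ℝ := (k ^ 2).factorial * (k : ℝ) ^ (k ^ 2) with hX
  have hXp : 0 < X := by positivity
  obtain ⟨M, r, hal⟩ := almost_law k (C2 k C0 c0) (1 / (2 * X)) (by positivity)
  obtain ⟨N, hN⟩ := hN M r
  choose K i1 i2 i3 F hfin hgood m hm hinv using fun n : ℕ => hcon (1 / ((n : ℝ) + 1)) (by positivity)
  choose a R y x c g h i0 nd using fun n => hN (K n) (F n) (hfin n) (hgood n)
  let S : SD k M r N C0 c0 K := ⟨hk, hC0, hc0, F, hgood, a, R, y, x, c, g, h, i0, nd, m, hm, hinv⟩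
  obtain ⟨L, _, _, b, st, hsurj, hlim⟩ := exists_ultra K a (hyperfilter ℕ)
  have hor : ∀ᶠ n in (hyperfilter ℕ : Filter ℕ), (∃ l, Eig (S.F n ^ N) l ∧ S.a n l = Real.exp 1) ∨
      ∃ ι : K n →+* ℂ, ∀ x, S.a n x = ‖ι x‖ := Eventually.of_forall fun n => (nd n).alt
  rw [Ultrafilter.eventually_or] at hor
  rcases hor with hor | hor
  · exact S.case_one hsurj hlim hor
  · refine S.case_two hsurj hlim hor _ hal ?_
    rw [← hX]
    field_simp
    norm_num

end USG
end PartP10c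

section PartP1
set_option linter.unusedVariables false
set_option linter.unusedSectionVars false

namespace USG

section
variable {G : Type} [Group G]

/-- ambient derived series -/
def ds (H : Subgroup G) : ℕ → Subgroup G
  | 0 => H
  | n + 1 => ⁅ds H n, ds H n⁆

lemma ds_mono {H H' : Subgroup G} (h : H ≤ H') (n : ℕ) : ds H n ≤ ds H' n := by
  induction n with
  | zero => exact h
  | succ n ih => exact Subgroup.commutator_mono ih ih

lemma ds_succ_le (H : Subgroup G) (n : ℕ) : ds H (n + 1) ≤ ds H n := by
  change ⁅ds H n, ds H n⁆ ≤ _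
  rw [Subgroup.commutator_le]
  intro a ha b hb
  exact mul_mem (mul_mem (mul_mem ha hb) (inv_mem ha)) (inv_mem hb)

lemma ds_anti (H : Subgroup G) {m n : ℕ} (h : m ≤ n) : ds H n ≤ ds H m := by
  induction h with
  | refl => exact le_rfl
  | step _ ih => exact (ds_succ_le H _).trans ih

/-- virtually solvable modulo `N` -/
def VSQ (H : Subgroup G) (N : Set G) : Prop :=
  ∃ H0 ≤ H, H0.relIndex H ≠ 0 ∧ ∃ n, (ds H0 n : Set G) ⊆ N

lemma VSQ.mono {H : Subgroup G} {N N' : Set G} (h : VSQ H N) (hN : N ⊆ N') : VSQ H N' := by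
  obtain ⟨H0, h1, h2, n, h3⟩ := h
  exact ⟨H0, h1, h2, n, h3.trans hN⟩

lemma VSQ.inter {H : Subgroup G} {N N' : Set G} (h : VSQ H N) (h' : VSQ H N') : VSQ H (N ∩ N') := by
  obtain ⟨H0, h1, h2, n, h3⟩ := h
  obtain ⟨H1, h1', h2', n', h3'⟩ := h'
  refine ⟨H0 ⊓ H1, inf_le_left.trans h1, Subgroup.relIndex_inf_ne_zero h2 h2', max n n', ?_⟩
  intro x hx
  exact ⟨h3 (ds_mono inf_le_left _ (ds_anti _ (le_max_left _ _) hx)),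
    h3' (ds_mono inf_le_right _ (ds_anti _ (le_max_right _ _) hx))⟩

lemma VSQ.of_le {H H1 : Subgroup G} {N : Set G} (hle : H1 ≤ H) (hi : H1.relIndex H ≠ 0) (h : VSQ H1 N) : VSQ H N := by
  obtain ⟨H0, h1, h2, n, h3⟩ := h
  refine ⟨H0, h1.trans hle, ?_, n, h3⟩
  rw [← Subgroup.relIndex_mul_relIndex _ _ _ h1 hle]
  exact mul_ne_zero h2 hi

lemma VSQ.comm {H : Subgroup G} {N : Set G} (h : VSQ H N) (N' : Subgroup G)
    (hc : ∀ a ∈ N, ∀ b ∈ N, a * b * a⁻¹ * b⁻¹ ∈ N') : VSQ H (N' : Set G) := by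
  obtain ⟨H0, h1, h2, n, h3⟩ := h
  refine ⟨H0, h1, h2, n + 1, ?_⟩
  change ⁅ds H0 n, ds H0 n⁆ ≤ N'
  rw [Subgroup.commutator_le]
  intro a ha b hb
  exact hc a (h3 ha) b (h3 hb)

lemma VSQ.self (H : Subgroup G) {N : Set G} (h : (H : Set G) ⊆ N) : VSQ H N :=
  ⟨H, le_rfl, by simp, 0, h⟩

lemma VSQ.of_inter {H : Subgroup G} {N : Set G} (h : VSQ H N) : VSQ H ((H : Set G) ∩ N) :=
  (VSQ.self H (le_refl _)).inter h

lemma VSQ.iInter {H : Subgroup G} {ι : Type*} (s : Finset ι) (N : ι → Set G) (h : ∀ i ∈ s, VSQ H (N i)) :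
    VSQ H {g | ∀ i ∈ s, g ∈ N i} := by
  classical
  induction s using Finset.induction_on with
  | empty => exact VSQ.self H (by intro x _; simp)
  | insert i s hi ih =>
    refine ((h i (by simp)).inter (ih fun j hj => h j (by simp [hj]))).mono ?_
    rintro x ⟨h1, h2⟩ j hj
    rcases Finset.mem_insert.1 hj with rfl | hj
    · exact h1
    · exact h2 j hj

lemma ds_map (H : Subgroup G) (n : ℕ) : ds H n = (derivedSeries H n).map H.subtype := by
  induction n with
  | zero => rw [derivedSeries_zero, ← MonoidHom.range_eq_map, Subgroup.range_subtype]; rfl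
  | succ n ih =>
    rw [derivedSeries_succ, Subgroup.map_commutator, ← ih]; rfl

lemma solvable_of_ds (H : Subgroup G) (n : ℕ) (h : ds H n ≤ ⊥) : IsSolvable H := by
  refine ⟨⟨n, ?_⟩⟩
  rw [ds_map, Subgroup.map_le_iff_le_comap] at h
  rw [eq_bot_iff]
  refine h.trans ?_
  intro x hx
  simpa using hx

end
end USG
end PartP1

section PartP2a
set_option linter.unusedVariables false
set_option linter.unusedSectionVars false
open Module

namespace USG

section
variable {K V : Type} [Field K] [IsAlgClosed K] [AddCommGroup V] [Module K V] [FiniteDimensional K V]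

lemma schur_sub (A : Subalgebra K (End K V)) (U : Submodule A V) [IsSimpleModule A U]
    (f : U →ₗ[A] U) : ∃ c : K, ∀ u : U, f u = c • u := by
  have : FiniteDimensional K U := inferInstanceAs (FiniteDimensional K (U.restrictScalars K))
  obtain ⟨c, hc⟩ := (IsSimpleModule.algebraMap_end_bijective_of_isAlgClosed (A := A) (V := U) K).2 f
  exact ⟨c, fun u => by rw [← hc]; rfl⟩

lemma burnside_top (A : Subalgebra K (End K V)) [IsSimpleModule A V] : A = ⊤ := by
  rw [eq_top_iff]
  intro g _
  have hs : ∀ f : End A V, ∃ c : K, ∀ v, f v = c • v := by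
    intro f
    obtain ⟨c, hc⟩ := (IsSimpleModule.algebraMap_end_bijective_of_isAlgClosed (A := A) (V := V) K).2 f
    exact ⟨c, fun u => by rw [← hc]; rfl⟩
  let g' : End (End A V) V :=
    { toFun := g
      map_add' := g.map_add
      map_smul' := by
        intro f v
        obtain ⟨c, hc⟩ := hs f
        change g (f v) = f (g v)
        rw [hc, hc, map_smul] }
  let b := Module.finBasis K V
  classical
  obtain ⟨r, hr⟩ := jacobson_density (R := A) g' (Finset.univ.image b)
  have : g = r.1 := by
    refine b.ext fun i => ?_
    exact hr (b i) (by simp)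
  rw [this]
  exact r.2

lemma comp_card (A : Subalgebra K (End K V)) :
    Finite (isotypicComponents A V) ∧ Nat.card (isotypicComponents A V) ≤ finrank K V := by
  have h := sSupIndep_isotypicComponents A V
  rw [sSupIndep_iff] at h
  choose w hw hw0 using fun c : isotypicComponents A V =>
    Submodule.exists_mem_ne_zero_of_ne_bot (bot_lt_isotypicComponents c.2).ne'
  have hl : LinearIndependent K w := by
    rw [linearIndependent_iff']
    intro s g hg i hi
    have := (iSupIndep_iff_finset_sum_eq_zero_imp_eq_zero (fun c : isotypicComponents A V => c.1)).1 h s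
      (fun c => g c • w c) ?_ hg i hi
    · exact (smul_eq_zero.1 this).resolve_right (hw0 i)
    · intro c _
      exact (c.1.restrictScalars K).smul_mem _ (hw c)
  have : Finite (isotypicComponents A V) := hl.finite
  refine ⟨this, ?_⟩
  have := Fintype.ofFinite (isotypicComponents A V)
  rw [Nat.card_eq_fintype_card]
  exact hl.fintype_card_le_finrank

lemma iso_of_comp_eq (A : Subalgebra K (End K V)) (U U' : Submodule A V) [IsSimpleModule A U] [IsSimpleModule A U']
    (h : isotypicComponent A V U = isotypicComponent A V U') : Nonempty (U ≃ₗ[A] U') :=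
  isIsotypicOfType_submodule_iff.mp (.isotypicComponent A V U') _ (h ▸ U.le_isotypicComponent)

end
end USG
end PartP2a

section PartP2b
set_option linter.unusedVariables false
set_option linter.unusedSectionVars false
open Module

namespace USG

section
variable {G : Type} [Group G] {K : Type} [Field K]

/-- projective representation of `H` -/
def PR {V : Type} [AddCommGroup V] [Module K V] (H : Subgroup G) (t : G → End K V) : Prop :=
  (∀ h ∈ H, Function.Injective (t h)) ∧
    ∀ g ∈ H, ∀ h ∈ H, ∃ c : K, c ≠ 0 ∧ ∀ v, t (g * h) v = c • t g (t h v)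

/-- projective kernel -/
def kerP {V : Type} [AddCommGroup V] [Module K V] (H : Subgroup G) (t : G → End K V) : Set G :=
  {h | h ∈ H ∧ ∃ c : K, c ≠ 0 ∧ ∀ v, t h v = c • v}

/-- smaller representations are virtually solvable -/
def SM (K : Type) [Field K] (H : Subgroup G) (k : ℕ) : Prop :=
  ∀ H1 ≤ H, H1.relIndex H ≠ 0 → H1.relIndex H ≤ k → ∀ (U : Type) [AddCommGroup U] [Module K U]
    [FiniteDimensional K U], finrank K U < k → ∀ t : G → End K U, PR H1 t → VSQ H1 (kerP H1 t)

variable {V : Type} [AddCommGroup V] [Module K V] {H : Subgroup G} {t : G → End K V}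

lemma PR.one (ht : PR H t) : ∃ c : K, c ≠ 0 ∧ ∀ v, t 1 v = c • v := by
  obtain ⟨c, hc, h⟩ := ht.2 1 H.one_mem 1 H.one_mem
  refine ⟨c⁻¹, inv_ne_zero hc, fun v => ?_⟩
  have h1 := h v
  rw [mul_one, ← map_smul] at h1
  have h2 := ht.1 1 H.one_mem h1
  conv_rhs => rw [h2]
  rw [smul_smul, inv_mul_cancel₀ hc, one_smul]

lemma PR.inv (ht : PR H t) {h : G} (hh : h ∈ H) : ∃ c : K, c ≠ 0 ∧ ∀ v, t h⁻¹ (t h v) = c • v := by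
  obtain ⟨c, hc, h1⟩ := ht.2 h⁻¹ (H.inv_mem hh) h hh
  obtain ⟨b, hb, h2⟩ := ht.one
  refine ⟨c⁻¹ * b, mul_ne_zero (inv_ne_zero hc) hb, fun v => ?_⟩
  have h3 := h1 v
  rw [inv_mul_cancel, h2] at h3
  rw [mul_smul, h3, smul_smul, inv_mul_cancel₀ hc, one_smul]

lemma PR.comm_rel (ht : PR H t) {a b : G} (ha : a ∈ H) (hb : b ∈ H) :
    ∃ c : K, c ≠ 0 ∧ ∀ v, t (a * b * a⁻¹ * b⁻¹) (t b (t a v)) = c • t a (t b v) := by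
  have hm : a * b * a⁻¹ * b⁻¹ ∈ H :=
    H.mul_mem (H.mul_mem (H.mul_mem ha hb) (H.inv_mem ha)) (H.inv_mem hb)
  obtain ⟨c1, h1, e1⟩ := ht.2 a ha b hb
  obtain ⟨c2, h2, e2⟩ := ht.2 b hb a ha
  obtain ⟨c3, h3, e3⟩ := ht.2 _ hm _ (H.mul_mem hb ha)
  refine ⟨(c3 * c2)⁻¹ * c1, mul_ne_zero (inv_ne_zero (mul_ne_zero h3 h2)) h1, fun v => ?_⟩
  have e := e3 v
  rw [show a * b * a⁻¹ * b⁻¹ * (b * a) = a * b by group, e1, e2, map_smul, smul_smul] at e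
  rw [mul_smul, e, smul_smul, inv_mul_cancel₀ (mul_ne_zero h3 h2), one_smul]

lemma PR.surj [FiniteDimensional K V] (ht : PR H t) {h : G} (hh : h ∈ H) : Function.Surjective (t h) :=
  LinearMap.injective_iff_surjective.1 (ht.1 h hh)

lemma PR.comm_ker [FiniteDimensional K V] (ht : PR H t) {a b : G} (ha : a ∈ H) (hb : b ∈ H)
    (h : ∀ v, t a (t b v) = t b (t a v)) : a * b * a⁻¹ * b⁻¹ ∈ kerP H t := by
  refine ⟨H.mul_mem (H.mul_mem (H.mul_mem ha hb) (H.inv_mem ha)) (H.inv_mem hb), ?_⟩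
  obtain ⟨c, hc, e⟩ := ht.comm_rel ha hb
  refine ⟨c, hc, fun v => ?_⟩
  obtain ⟨v, rfl⟩ := ht.surj hb v
  obtain ⟨v, rfl⟩ := ht.surj ha v
  rw [e, h]

/-- elements represented in a subalgebra -/
def subg (ht : PR H t) (A : Subalgebra K (End K V)) : Subgroup G where
  carrier := {h | h ∈ H ∧ t h ∈ A ∧ t h⁻¹ ∈ A}
  one_mem' := by
    obtain ⟨c, hc, h⟩ := ht.one
    have : t 1 ∈ A := by
      have : t 1 = c • (1 : End K V) := by ext v; simp [h]
      rw [this]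
      exact A.smul_mem A.one_mem c
    exact ⟨H.one_mem, this, by rwa [inv_one]⟩
  mul_mem' := by
    have key : ∀ a ∈ H, ∀ b ∈ H, t a ∈ A → t b ∈ A → t (a * b) ∈ A := by
      intro a ha b hb h1 h2
      obtain ⟨c, hc, h⟩ := ht.2 a ha b hb
      have : t (a * b) = c • (t a * t b) := by ext v; simp [h]
      rw [this]
      exact A.smul_mem (A.mul_mem h1 h2) c
    rintro a b ⟨h1, h2, h3⟩ ⟨h4, h5, h6⟩
    refine ⟨H.mul_mem h1 h4, key _ h1 _ h4 h2 h5, ?_⟩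
    rw [mul_inv_rev]
    exact key _ (H.inv_mem h4) _ (H.inv_mem h1) h6 h3
  inv_mem' := by
    rintro a ⟨h1, h2, h3⟩
    exact ⟨H.inv_mem h1, h3, by rwa [inv_inv]⟩

lemma comm_inv (a b : G) : (a * b * a⁻¹ * b⁻¹)⁻¹ = b * a * b⁻¹ * a⁻¹ := by group

lemma mem_bot_of (x : End K V) (h : ∃ c : K, c ≠ 0 ∧ ∀ v, x v = c • v) : x ∈ (⊥ : Subalgebra K (End K V)) := by
  obtain ⟨c, _, h⟩ := h
  rw [Algebra.mem_bot]
  exact ⟨c, by ext v; rw [h]; rfl⟩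

lemma ker_of_bot (ht : PR H t) {h : G} (hh : h ∈ H) (hb : t h ∈ (⊥ : Subalgebra K (End K V))) : h ∈ kerP H t := by
  refine ⟨hh, ?_⟩
  rw [Algebra.mem_bot] at hb
  obtain ⟨c, hc⟩ := hb
  have h1 : ∀ v, t h v = c • v := fun v => by rw [← hc]; rfl
  by_cases h0 : c = 0
  · refine ⟨1, one_ne_zero, fun v => ?_⟩
    have : v = 0 := ht.1 h hh (by rw [h1, h0, zero_smul, map_zero])
    simp [this]
  · exact ⟨c, h0, h1⟩

/-- commutators landing in the kernel -/
lemma VSQ.to_ker [FiniteDimensional K V] (ht : PR H t) {N : Set G} (h : VSQ H N) (hN : N ⊆ H)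
    (hc : ∀ a ∈ N, ∀ b ∈ N, ∀ v, t a (t b v) = t b (t a v)) : VSQ H (kerP H t) := by
  refine (h.comm (subg ht ⊥) ?_).mono ?_
  · intro a ha b hb
    have h1 := ht.comm_ker (hN ha) (hN hb) (hc a ha b hb)
    have h2 := ht.comm_ker (hN hb) (hN ha) (hc b hb a ha)
    exact ⟨h1.1, mem_bot_of _ h1.2, by rw [comm_inv]; exact mem_bot_of _ h2.2⟩
  · rintro x ⟨h1, h2, h3⟩
    exact ker_of_bot ht h1 h2

/-- block algebra -/
def blk (W : Submodule K V) : Subalgebra K (End K V) where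
  carrier := {x | ∃ c : K, (∀ w ∈ W, x w = c • w) ∧ ∀ v, x v - c • v ∈ W}
  mul_mem' := by
    rintro x y ⟨c, h1, h2⟩ ⟨d, h3, h4⟩
    refine ⟨c * d, fun w hw => ?_, fun v => ?_⟩
    · rw [Module.End.mul_apply, h3 w hw, map_smul, h1 w hw, smul_smul, mul_comm]
    · have e : (x * y) v - (c * d) • v = (x (y v) - c • y v) + c • (y v - d • v) := by
        rw [Module.End.mul_apply, smul_sub, smul_smul]; abel
      rw [e]
      exact W.add_mem (h2 _) (W.smul_mem _ (h4 _))
  add_mem' := by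
    rintro x y ⟨c, h1, h2⟩ ⟨d, h3, h4⟩
    refine ⟨c + d, fun w hw => ?_, fun v => ?_⟩
    · rw [LinearMap.add_apply, h1 w hw, h3 w hw, add_smul]
    · have e : (x + y) v - (c + d) • v = (x v - c • v) + (y v - d • v) := by
        rw [LinearMap.add_apply, add_smul]; abel
      rw [e]
      exact W.add_mem (h2 _) (h4 _)
  algebraMap_mem' := by
    intro c
    exact ⟨c, fun w hw => rfl, fun v => by
      have : (algebraMap K (End K V) c) v = c • v := rfl
      rw [this, sub_self]; exact W.zero_mem⟩

lemma red_case [FiniteDimensional K V] (ht : PR H t) (hSM : SM K H (finrank K V)) (h0 : 1 ≤ finrank K V) (W : Submodule K V)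
    (hW0 : W ≠ ⊥) (hW1 : W ≠ ⊤) (hW : ∀ h ∈ H, ∀ w ∈ W, t h w ∈ W) : VSQ H (kerP H t) := by
  -- restriction
  obtain ⟨p, hp⟩ := LinearMap.exists_leftInverse_of_injective W.subtype (by simp)
  obtain ⟨s, hs⟩ := LinearMap.exists_rightInverse_of_surjective W.mkQ (by simp)
  have hp' : ∀ w : W, p w.1 = w := fun w => LinearMap.congr_fun hp w
  have hs' : ∀ q : V ⧸ W, W.mkQ (s q) = q := fun q => LinearMap.congr_fun hs q
  set tW : G → End K W := fun g => p ∘ₗ t g ∘ₗ W.subtype with htW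
  set tQ : G → End K (V ⧸ W) := fun g => W.mkQ ∘ₗ t g ∘ₗ s with htQ
  have eW : ∀ h ∈ H, ∀ w : W, (tW h w : V) = t h w := by
    intro h hh w
    have := hp' ⟨t h w, hW h hh w w.2⟩
    exact congrArg Subtype.val this
  have eQ : ∀ h ∈ H, ∀ v : V, tQ h (W.mkQ v) = W.mkQ (t h v) := by
    intro h hh v
    have h1 : W.mkQ (s (W.mkQ v)) = W.mkQ v := hs' _
    have h2 : s (W.mkQ v) - v ∈ W := (Submodule.Quotient.eq W).1 h1
    refine (Submodule.Quotient.eq W).2 ?_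
    have := hW h hh _ h2
    rwa [map_sub] at this
  have inv_mem : ∀ h ∈ H, ∀ v, t h v ∈ W → v ∈ W := by
    intro h hh v hv
    obtain ⟨c, hc, e⟩ := ht.inv hh
    have := hW _ (H.inv_mem hh) _ hv
    rw [e] at this
    exact (W.smul_mem_iff hc).1 this
  have pW : PR H tW := by
    refine ⟨fun h hh a b hab => ?_, fun g hg h hh => ?_⟩
    · refine Subtype.ext (ht.1 h hh ?_)
      rw [← eW h hh, ← eW h hh, hab]
    · obtain ⟨c, hc, e⟩ := ht.2 g hg h hh
      refine ⟨c, hc, fun v => Subtype.ext ?_⟩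
      rw [eW _ (H.mul_mem hg hh), e, Submodule.coe_smul, eW g hg, eW h hh]
  have pQ : PR H tQ := by
    refine ⟨fun h hh a b hab => ?_, fun g hg h hh => ?_⟩
    · obtain ⟨a, rfl⟩ := W.mkQ_surjective a
      obtain ⟨b, rfl⟩ := W.mkQ_surjective b
      rw [eQ h hh, eQ h hh] at hab
      refine (Submodule.Quotient.eq W).2 (inv_mem h hh _ ?_)
      rw [map_sub]
      exact (Submodule.Quotient.eq W).1 hab
    · obtain ⟨c, hc, e⟩ := ht.2 g hg h hh
      refine ⟨c, hc, fun v => ?_⟩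
      obtain ⟨v, rfl⟩ := W.mkQ_surjective v
      rw [eQ _ (H.mul_mem hg hh), e, eQ h hh, eQ g hg, map_smul]
  have r1 : H.relIndex H = 1 := Subgroup.relIndex_self H
  have v1 := hSM H le_rfl (by omega) (by omega) W (Submodule.finrank_lt hW1) tW pW
  have v2 := hSM H le_rfl (by omega) (by omega) (V ⧸ W) (by
    have h1 := W.finrank_quotient_add_finrank
    have h2 : finrank K W ≠ 0 := fun h => hW0 (Submodule.finrank_eq_zero.1 h)
    omega) tQ pQ
  have v3 := (v1.inter v2).comm (subg ht (blk W)) (by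
    have key : ∀ a ∈ kerP H tW ∩ kerP H tQ, ∀ b ∈ kerP H tW ∩ kerP H tQ, a * b * a⁻¹ * b⁻¹ ∈ H ∧ t (a * b * a⁻¹ * b⁻¹) ∈ blk W := by
      rintro a ⟨⟨ha, α, hα, e1⟩, -, α', hα', e2⟩ b ⟨⟨hb, β, hβ, e3⟩, -, β', hβ', e4⟩
      have e1' : ∀ w ∈ W, t a w = α • w := fun w hw => by
        rw [← eW a ha ⟨w, hw⟩, e1]; rfl
      have e3' : ∀ w ∈ W, t b w = β • w := fun w hw => by
        rw [← eW b hb ⟨w, hw⟩, e3]; rfl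
      have e2' : ∀ v, W.mkQ (t a v) = α' • W.mkQ v := fun v => by rw [← eQ a ha, e2]
      have e4' : ∀ v, W.mkQ (t b v) = β' • W.mkQ v := fun v => by rw [← eQ b hb, e4]
      have hm : a * b * a⁻¹ * b⁻¹ ∈ H :=
        H.mul_mem (H.mul_mem (H.mul_mem ha hb) (H.inv_mem ha)) (H.inv_mem hb)
      obtain ⟨c, hc, e⟩ := ht.comm_rel ha hb
      refine ⟨hm, c, fun w hw => ?_, fun v => ?_⟩
      · have := e w
        rw [e1' w hw, e3' w hw, map_smul, map_smul, map_smul, e1' w hw, e3' w hw, map_smul, smul_smul, smul_smul, smul_smul] at this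
        have h2 := congrArg (fun z => (α * β)⁻¹ • z) this
        simp only [smul_smul] at h2
        rw [show (α * β)⁻¹ * (α * β) = 1 from inv_mul_cancel₀ (mul_ne_zero hα hβ), one_smul] at h2
        rw [h2]
        congr 1
        field_simp
      · have := congrArg W.mkQ (e v)
        rw [← eQ _ hm, e4', e2', map_smul, map_smul, eQ _ hm, map_smul, e2', e4', smul_smul, smul_smul, smul_smul] at this
        have h2 := congrArg (fun z => (β' * α')⁻¹ • z) this
        simp only [smul_smul] at h2
        rw [inv_mul_cancel₀ (mul_ne_zero hβ' hα'), one_smul] at h2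
        refine (Submodule.Quotient.eq W).1 ?_
        change W.mkQ _ = W.mkQ _
        rw [h2, map_smul]
        congr 1
        field_simp
    intro a ha b hb
    have h1 := key a ha b hb
    have h2 := key b hb a ha
    exact ⟨h1.1, h1.2, by rw [comm_inv]; exact h2.2⟩)
  refine v3.to_ker ht (fun x hx => hx.1) ?_
  rintro a ⟨_, ⟨α, h1, h2⟩, _⟩ b ⟨_, ⟨β, h3, h4⟩, _⟩ v
  have g1 := h1 _ (h4 v)
  have g2 := h3 _ (h2 v)
  rw [map_sub, map_smul, smul_sub, sub_eq_iff_eq_add] at g1 g2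
  rw [g1, g2, smul_comm β α v]
  abel
end
end USG
end PartP2b

section PartP2c
set_option linter.unusedVariables false
set_option linter.unusedSectionVars false
open Module

namespace USG

lemma relIndex_le_card {G : Type} [Group G] (S H : Subgroup G) {X : Type} [Finite X] (φ : H → X)
    (h : ∀ a b : H, φ a = φ b → (b.1)⁻¹ * a.1 ∈ S) : S.relIndex H ≠ 0 ∧ S.relIndex H ≤ Nat.card X := by
  have hinj : Function.Injective (fun q : H ⧸ S.subgroupOf H => φ q.out) := by
    intro a b hab
    have := h _ _ hab
    rw [← a.out_eq', ← b.out_eq']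
    refine (QuotientGroup.eq.2 ?_).symm
    exact this
  have hf : Finite (H ⧸ S.subgroupOf H) := Finite.of_injective _ hinj
  refine ⟨?_, Nat.card_le_card_of_injective _ hinj⟩
  exact Nat.card_pos.ne'

section
variable {K V : Type} [Field K] [AddCommGroup V] [Module K V]

/-- `T` normalizes `A` -/
def Nm (A : Subalgebra K (End K V)) (T : End K V) : Prop :=
  Function.Injective T ∧ (∀ x ∈ A, ∃ y ∈ A, ∀ v, T (x v) = y (T v)) ∧
    (∀ y ∈ A, ∃ x ∈ A, ∀ v, T (x v) = y (T v))

/-- twisted submodule -/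
def tw {A : Subalgebra K (End K V)} {T : End K V} (hT : Nm A T) (U : Submodule A V) : Submodule A V where
  carrier := T '' U
  add_mem' := by
    rintro _ _ ⟨a, ha, rfl⟩ ⟨b, hb, rfl⟩
    exact ⟨a + b, U.add_mem ha hb, map_add _ _ _⟩
  zero_mem' := ⟨0, U.zero_mem, map_zero _⟩
  smul_mem' := by
    rintro y _ ⟨a, ha, rfl⟩
    obtain ⟨x, hx, e⟩ := hT.2.2 y.1 y.2
    exact ⟨x a, U.smul_mem ⟨x, hx⟩ ha, e a⟩

lemma tw_simple {A : Subalgebra K (End K V)} {T : End K V} (hT : Nm A T) (U : Submodule A V) [hU : IsSimpleModule A U] :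
    IsSimpleModule A (tw hT U) := by
  rw [isSimpleModule_iff_isAtom] at hU ⊢
  rw [isAtom_iff_le_of_ge] at hU ⊢
  refine ⟨fun h => hU.1 ?_, fun X hX hle => ?_⟩
  · rw [Submodule.eq_bot_iff] at h ⊢
    intro u hu
    have := h (T u) ⟨u, hu, rfl⟩
    exact hT.1 (by rw [this, map_zero])
  · let Y : Submodule A V :=
      { carrier := {v | T v ∈ X}
        add_mem' := fun {a b} ha hb => by
          change T (a + b) ∈ X
          rw [map_add]; exact X.add_mem ha hb
        zero_mem' := by change T 0 ∈ X; rw [map_zero]; exact X.zero_mem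
        smul_mem' := by
          rintro x a ha
          obtain ⟨y, hy, e⟩ := hT.2.1 x.1 x.2
          change T (x.1 a) ∈ X
          rw [e]
          exact X.smul_mem ⟨y, hy⟩ ha }
    have hY : U ≤ Y := by
      refine hU.2 Y ?_ ?_
      · obtain ⟨z, hz, hz0⟩ := Submodule.exists_mem_ne_zero_of_ne_bot hX
        obtain ⟨u, hu, rfl⟩ := hle hz
        refine fun h => hz0 ?_
        have : u ∈ Y := hz
        rw [h] at this
        rw [(Submodule.mem_bot A).1 this, map_zero]
      · intro v hv
        obtain ⟨u, hu, e⟩ := hle hv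
        rwa [← hT.1 e]
    rintro _ ⟨u, hu, rfl⟩
    exact hY hu

lemma tw_equiv {A : Subalgebra K (End K V)} {T : End K V} (hT : Nm A T) (U : Submodule A V) :
    ∃ e : U ≃ₗ[K] tw hT U, ∀ u, (e u : V) = T u := by
  let f : U →ₗ[K] tw hT U :=
    { toFun := fun u => ⟨T u, ⟨u, u.2, rfl⟩⟩
      map_add' := fun a b => Subtype.ext (map_add T _ _)
      map_smul' := fun c a => Subtype.ext (map_smul T c _) }
  have hf : Function.Bijective f := by
    constructor
    · intro a b h
      exact Subtype.ext (hT.1 (congrArg Subtype.val h))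
    · rintro ⟨_, u, hu, rfl⟩
      exact ⟨⟨u, hu⟩, rfl⟩
  exact ⟨LinearEquiv.ofBijective f hf, fun u => rfl⟩
end

section
variable {G : Type} [Group G] {K : Type} [Field K] {V : Type} [AddCommGroup V] [Module K V]
  [FiniteDimensional K V] {H : Subgroup G} {t : G → End K V}

lemma ad_comp (ht : PR H t) {g h : G} (hg : g ∈ H) (hh : h ∈ H) {x y z : End K V}
    (e : ∀ v, t h (x v) = y (t h v)) :
    (∀ v, t (g * h) (x v) = z (t (g * h) v)) ↔ ∀ v, t g (y v) = z (t g v) := by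
  obtain ⟨c, hc, ec⟩ := ht.2 g hg h hh
  constructor
  · intro h1 v
    obtain ⟨v, rfl⟩ := ht.surj hh v
    have h2 := h1 v
    rw [ec, ec, map_smul, e] at h2
    exact smul_right_injective V hc h2
  · intro h1 v
    rw [ec, ec, map_smul, e, h1]

/-- twisting intertwiner -/
def Th (t : G → End K V) (A : Subalgebra K (End K V)) (U : Submodule A V) (h : G) (θ : U ≃ₗ[K] U) : Prop :=
  ∀ x y : A, (∀ v, t h (x.1 v) = y.1 (t h v)) → ∀ u : U, θ (x • u) = y • θ u

/-- stabilizer of the isomorphism class -/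
def stb (ht : PR H t) (A : Subalgebra K (End K V)) (hA : ∀ h ∈ H, Nm A (t h)) (U : Submodule A V) : Subgroup G where
  carrier := {h | h ∈ H ∧ ∃ θ, Th t A U h θ}
  one_mem' := by
    refine ⟨H.one_mem, LinearEquiv.refl K U, ?_⟩
    intro x y h u
    obtain ⟨c, hc, e⟩ := ht.one
    refine Subtype.ext ?_
    have := h u
    rw [e, e, map_smul] at this
    exact smul_right_injective V hc this
  mul_mem' := by
    rintro a b ⟨ha, θ, h1⟩ ⟨hb, θ', h2⟩
    refine ⟨H.mul_mem ha hb, θ'.trans θ, ?_⟩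
    intro x z h u
    obtain ⟨y, hy, e⟩ := (hA b hb).2.1 x.1 x.2
    have h3 := (ad_comp ht ha hb e).1 h
    rw [LinearEquiv.trans_apply, LinearEquiv.trans_apply, h2 x ⟨y, hy⟩ e, h1 ⟨y, hy⟩ z h3]
  inv_mem' := by
    rintro a ⟨ha, θ, h1⟩
    refine ⟨H.inv_mem ha, θ.symm, ?_⟩
    intro x y h u
    have h2 := (ad_comp (z := x.1) ht ha (H.inv_mem ha) h).1 (by
      intro v
      obtain ⟨c, hc, e⟩ := ht.one
      rw [mul_inv_cancel, e, e, map_smul])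
    rw [LinearEquiv.symm_apply_eq, h1 y x h2, LinearEquiv.apply_symm_apply]

set_option synthInstance.maxHeartbeats 400000 in
lemma stb_index (ht : PR H t) (A : Subalgebra K (End K V)) (hA : ∀ h ∈ H, Nm A (t h)) (U : Submodule A V)
    [IsAlgClosed K] [IsSimpleModule A U] :
    (stb ht A hA U).relIndex H ≠ 0 ∧ (stb ht A hA U).relIndex H ≤ finrank K V := by
  obtain ⟨h1, h2⟩ := comp_card A
  have hs : ∀ h : H, IsSimpleModule A (tw (hA h.1 h.2) U) := fun h => tw_simple _ U
  let φ : H → isotypicComponents A V := fun h => ⟨isotypicComponent A V (tw (hA h.1 h.2) U),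
    ⟨tw (hA h.1 h.2) U, hs h, rfl⟩⟩
  obtain ⟨h3, h4⟩ := relIndex_le_card (stb ht A hA U) H φ (by
    intro h g hab
    have hgh : g.1⁻¹ * h.1 ∈ H := H.mul_mem (H.inv_mem g.2) h.2
    have h5 := congrArg Subtype.val hab
    have := hs h
    have := hs g
    obtain ⟨ψ⟩ := iso_of_comp_eq A _ _ h5
    obtain ⟨eh, heh⟩ := tw_equiv (hA h.1 h.2) U
    obtain ⟨eg, heg⟩ := tw_equiv (hA g.1 g.2) U
    refine ⟨hgh, eh.trans ((ψ.restrictScalars K).trans eg.symm), ?_⟩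
    intro x y e u
    obtain ⟨z, hz, ez⟩ := (hA h.1 h.2).2.1 x.1 x.2
    have e2 := (ad_comp (z := z) ht g.2 hgh e).1 (by rw [mul_inv_cancel_left]; exact ez)
    simp only [LinearEquiv.trans_apply, LinearEquiv.restrictScalars_apply]
    rw [LinearEquiv.symm_apply_eq]
    have e3 : eh (x • u : U) = (⟨z, hz⟩ : A) • eh u := by
      refine Subtype.ext ?_
      rw [heh]
      change t h.1 (x.1 u) = z (eh u : V)
      rw [heh, ez]
    rw [e3, map_smul]
    refine Subtype.ext ?_
    rw [heg]
    change z (ψ (eh u) : V) = t g.1 (y.1 _)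
    rw [e2, ← heg, LinearEquiv.apply_symm_apply])
  exact ⟨h3, h4.trans h2⟩

lemma simple_case [IsAlgClosed K] (ht : PR H t) (A : Subalgebra K (End K V)) (hA : ∀ h ∈ H, Nm A (t h))
    (hSM : SM K H (finrank K V)) (hA1 : A ≠ ⊤)
    (U : Submodule A V) [hU : IsSimpleModule A U] :
    VSQ H {h | h ∈ H ∧ ∀ x y : A, (∀ v, t h (x.1 v) = y.1 (t h v)) → ∀ u : U, x.1 u = y.1 u} := by
  classical
  obtain ⟨i1, i2⟩ := stb_index ht A hA U
  set S := stb ht A hA U with hS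
  have hle : S ≤ H := fun x hx => hx.1
  have fdU : FiniteDimensional K U := inferInstanceAs (FiniteDimensional K (U.restrictScalars K))
  have hlt : finrank K U < finrank K V := by
    refine Submodule.finrank_lt (s := U.restrictScalars K) fun h => hA1 ?_
    have : U = ⊤ := by
      rw [eq_top_iff]; intro v _
      have : v ∈ U.restrictScalars K := by rw [h]; trivial
      exact this
    subst this
    have : IsSimpleModule A V :=
      (isSimpleModule_iff A V).2 (isSimpleOrder_iff_isAtom_top.2 (isSimpleModule_iff_isAtom.1 hU))
    exact burnside_top A
  have hex : ∀ g, ∃ θ : U ≃ₗ[K] U, g ∈ S → Th t A U g θ := by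
    intro g
    by_cases hg : g ∈ S
    · obtain ⟨θ, h⟩ := hg.2
      exact ⟨θ, fun _ => h⟩
    · exact ⟨LinearEquiv.refl K U, fun h => absurd h hg⟩
  choose θ hθ using hex
  have nt : Nontrivial U := IsSimpleModule.nontrivial A U
  have pr : PR (K := K) (V := U) S (fun g => (θ g).toLinearMap) := by
    refine ⟨fun h _ => (θ h).injective, fun g hg h hh => ?_⟩
    have hgh := S.mul_mem hg hh
    let f : U →ₗ[A] U :=
      { toFun := fun u => (θ h).symm ((θ g).symm (θ (g * h) u))
        map_add' := by intro a b; simp only [map_add]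
        map_smul' := by
          intro x u
          obtain ⟨y, hy, ey⟩ := (hA h (hle hh)).2.1 x.1 x.2
          obtain ⟨z, hz, ez⟩ := (hA g (hle hg)).2.1 y hy
          have e3 := (ad_comp ht (hle hg) (hle hh) ey).2 ez
          simp only [RingHom.id_apply]
          rw [LinearEquiv.symm_apply_eq, LinearEquiv.symm_apply_eq, hθ _ hgh x ⟨z, hz⟩ e3,
            hθ _ hh x ⟨y, hy⟩ ey, LinearEquiv.apply_symm_apply, hθ _ hg ⟨y, hy⟩ ⟨z, hz⟩ ez,
            LinearEquiv.apply_symm_apply] }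
    obtain ⟨c, hc⟩ := schur_sub A U f
    have hc' : ∀ u, θ (g * h) u = c • θ g (θ h u) := by
      intro u
      have h1 : (θ h).symm ((θ g).symm (θ (g * h) u)) = c • u := hc u
      rw [LinearEquiv.symm_apply_eq, LinearEquiv.symm_apply_eq] at h1
      rw [h1, map_smul, map_smul]
    refine ⟨c, fun h0 => ?_, hc'⟩
    obtain ⟨u, hu⟩ := exists_ne (0 : U)
    have := hc' u
    rw [h0, zero_smul] at this
    exact hu ((LinearEquiv.map_eq_zero_iff _).1 this)
  have key := hSM S hle i1 i2 U hlt _ pr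
  refine (VSQ.of_le hle i1 key).mono ?_
  rintro h ⟨hh, c, hc, e⟩
  refine ⟨hle hh, fun x y hxy u => ?_⟩
  have h1 := hθ h hh x y hxy u
  have e' : ∀ u, θ h u = c • u := e
  rw [e', e'] at h1
  have h2 : c • x.1 (u : V) = y.1 (c • (u : V)) := congrArg Subtype.val h1
  rw [map_smul] at h2
  exact smul_right_injective V hc h2

/-- irreducibility -/
def Irr (H : Subgroup G) (t : G → End K V) : Prop :=
  ∀ W : Submodule K V, (∀ h ∈ H, ∀ w ∈ W, t h w ∈ W) → W = ⊥ ∨ W = ⊤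

lemma irr_case [IsAlgClosed K] (ht : PR H t) (A : Subalgebra K (End K V)) (hA : ∀ h ∈ H, Nm A (t h))
    (hSM : SM K H (finrank K V)) (hA1 : A ≠ ⊤) (hirr : Irr H t) (h0 : 1 ≤ finrank K V) :
    VSQ H {h | h ∈ H ∧ ∀ x ∈ A, ∀ v, t h (x v) = x (t h v)} := by
  let D : V → Set G := fun w => {h | h ∈ H ∧ ∀ x y : A, (∀ v, t h (x.1 v) = y.1 (t h v)) → x.1 w = y.1 w}
  let S : Submodule K V :=
    { carrier := {w | VSQ H (D w)}
      zero_mem' := VSQ.self H fun h hh => ⟨hh, fun x y _ => by rw [map_zero, map_zero]⟩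
      add_mem' := by
        intro a b ha hb
        refine (VSQ.inter ha hb).mono ?_
        rintro h ⟨⟨h1, h2⟩, -, h3⟩
        exact ⟨h1, fun x y e => by rw [map_add, map_add, h2 x y e, h3 x y e]⟩
      smul_mem' := by
        intro c a ha
        refine VSQ.mono ha ?_
        rintro h ⟨h1, h2⟩
        exact ⟨h1, fun x y e => by rw [map_smul, map_smul, h2 x y e]⟩ }
  let W : Submodule K V := ⨆ U : {U : Submodule A V // IsSimpleModule A U}, U.1.restrictScalars K
  have hWS : W ≤ S := by
    refine iSup_le ?_
    rintro ⟨U, hU⟩ u hu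
    refine (simple_case ht A hA hSM hA1 U).mono ?_
    rintro h ⟨h1, h2⟩
    exact ⟨h1, fun x y e => h2 x y e ⟨u, hu⟩⟩
  have nt : Nontrivial V := Module.nontrivial_of_finrank_pos (R := K) h0
  have hW0 : W ≠ ⊥ := by
    have : IsArtinian A V := isArtinian_of_tower K inferInstance
    have hat : IsAtomic (Submodule A V) := isAtomic_of_orderBot_wellFounded_lt (wellFounded_lt)
    obtain ⟨U, hU, _⟩ := (hat.eq_bot_or_exists_atom_le ⊤).resolve_left top_ne_bot
    have hU' := isSimpleModule_iff_isAtom.2 hU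
    intro h
    have h1 : U.restrictScalars K ≤ W :=
      le_iSup (fun U : {U : Submodule A V // IsSimpleModule A U} => U.1.restrictScalars K) ⟨U, hU'⟩
    rw [h] at h1
    refine hU.1 ?_
    rw [Submodule.eq_bot_iff]
    intro u hu
    exact (Submodule.mem_bot K).1 (h1 hu)
  have hWi : ∀ h ∈ H, ∀ w ∈ W, t h w ∈ W := by
    intro h hh w hw
    refine Submodule.iSup_induction _ (motive := fun w => t h w ∈ W) hw ?_ ?_ ?_
    · rintro ⟨U, hU⟩ u hu
      have h1 : (tw (hA h hh) U).restrictScalars K ≤ W :=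
        le_iSup (fun U : {U : Submodule A V // IsSimpleModule A U} => U.1.restrictScalars K)
          ⟨tw (hA h hh) U, tw_simple _ U⟩
      exact h1 ⟨u, hu, rfl⟩
    · rw [map_zero]; exact W.zero_mem
    · intro a b ha hb
      rw [map_add]; exact W.add_mem ha hb
  have hW : W = ⊤ := (hirr W hWi).resolve_left hW0
  let b := Module.finBasis K V
  have h1 := VSQ.iInter (H := H) Finset.univ (fun i => D (b i)) (fun i _ => hWS (by rw [hW]; trivial))
  refine (h1.of_inter).mono ?_
  rintro h ⟨hh, h2⟩
  refine ⟨hh, fun x hx v => ?_⟩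
  obtain ⟨y, hy, e⟩ := (hA h hh).2.1 x hx
  have : x = y := b.ext fun i => (h2 i (Finset.mem_univ _)).2 ⟨x, hx⟩ ⟨y, hy⟩ e
  rw [e, this]

/-- every normal subgroup is scalar or spanning -/
def StarP (H : Subgroup G) (t : G → End K V) : Prop :=
  ∀ N : Subgroup G, N ≤ H → (∀ g ∈ H, ∀ n ∈ N, g * n * g⁻¹ ∈ N) →
    (∀ n ∈ N, n ∈ kerP H t) ∨ Submodule.span K (t '' (N : Set G)) = ⊤

lemma nm_of (ht : PR H t) (A : Subalgebra K (End K V)) (h1 : ∀ h ∈ H, ∀ x ∈ A, ∃ y ∈ A, ∀ v, t h (x v) = y (t h v)) :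
    ∀ h ∈ H, Nm A (t h) := by
  intro h hh
  refine ⟨ht.1 h hh, h1 h hh, ?_⟩
  intro y hy
  obtain ⟨x, hx, e⟩ := h1 _ (H.inv_mem hh) y hy
  refine ⟨x, hx, ?_⟩
  refine (ad_comp (z := y) ht hh (H.inv_mem hh) e).1 ?_
  obtain ⟨c, hc, ec⟩ := ht.one
  intro v
  rw [mul_inv_cancel, ec, ec, map_smul]

lemma nm_centralizer (ht : PR H t) (A : Subalgebra K (End K V)) (hA : ∀ h ∈ H, Nm A (t h)) :
    ∀ h ∈ H, Nm (Subalgebra.centralizer K (A : Set (End K V))) (t h) := by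
  refine nm_of ht _ ?_
  intro h hh x hx
  let e := LinearEquiv.ofBijective (t h) ⟨ht.1 h hh, ht.surj hh⟩
  have he : ∀ v, e v = t h v := fun v => rfl
  refine ⟨e.toLinearMap ∘ₗ x ∘ₗ e.symm.toLinearMap, ?_, ?_⟩
  · rw [Subalgebra.mem_centralizer_iff] at hx ⊢
    intro a ha
    obtain ⟨a', ha', ea⟩ := (hA h hh).2.2 a ha
    ext v
    obtain ⟨v, rfl⟩ := e.surjective v
    have h1 := LinearMap.congr_fun (hx a' ha') v
    simp only [Module.End.mul_apply] at h1
    simp only [Module.End.mul_apply, LinearMap.comp_apply, LinearEquiv.coe_coe, LinearEquiv.symm_apply_apply]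
    rw [he (x v), ← ea (x v), h1, he v, ← ea v, ← he (a' v), LinearEquiv.symm_apply_apply, he]
  · intro v
    simp only [LinearMap.comp_apply, LinearEquiv.coe_coe]
    rw [← he v, LinearEquiv.symm_apply_apply, he]

lemma step [IsAlgClosed K] (ht : PR H t) (hSM : SM K H (finrank K V)) (h0 : 1 ≤ finrank K V)
    (hst : ¬ StarP H t) : VSQ H (kerP H t) := by
  by_cases hirr : Irr H t
  swap
  · unfold Irr at hirr
    push Not at hirr
    obtain ⟨W, h1, h2, h3⟩ := hirr
    exact red_case ht hSM h0 W h2 h3 h1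
  unfold StarP at hst
  push Not at hst
  obtain ⟨N, hN, hnorm, ⟨n, hn, hnk⟩, hspan⟩ := hst
  obtain ⟨c1, hc1, e1⟩ := ht.one
  let A : Subalgebra K (End K V) := Submodule.toSubalgebra (Submodule.span K (t '' (N : Set G)))
    (by
      have : (1 : End K V) = c1⁻¹ • t 1 := by
        ext v
        rw [LinearMap.smul_apply, e1, smul_smul, inv_mul_cancel₀ hc1, one_smul]; rfl
      rw [this]
      exact Submodule.smul_mem _ _ (Submodule.subset_span ⟨1, N.one_mem, rfl⟩))
    (by
      intro x y hx hy
      have h1 := Submodule.mul_mem_mul hx hy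
      rw [Submodule.span_mul_span] at h1
      refine (Submodule.span_le.2 ?_) h1
      rintro _ ⟨_, ⟨a, ha, rfl⟩, _, ⟨b, hb, rfl⟩, rfl⟩
      obtain ⟨c, hc, e⟩ := ht.2 a (hN ha) b (hN hb)
      have : t a * t b = c⁻¹ • t (a * b) := by
        ext v
        rw [LinearMap.smul_apply, e, smul_smul, inv_mul_cancel₀ hc, one_smul]; rfl
      change t a * t b ∈ _
      rw [this]
      exact Submodule.smul_mem _ _ (Submodule.subset_span ⟨a * b, N.mul_mem ha hb, rfl⟩))
  have hAm : ∀ x, x ∈ A ↔ x ∈ Submodule.span K (t '' (N : Set G)) := fun x => Iff.rfl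
  have hAt : ∀ g ∈ N, t g ∈ A := fun g hg => Submodule.subset_span ⟨g, hg, rfl⟩
  have hA : ∀ h ∈ H, Nm A (t h) := by
    refine nm_of ht A ?_
    intro h hh x hx
    rw [hAm] at hx
    induction hx using Submodule.span_induction with
    | mem x hx =>
      obtain ⟨m, hm, rfl⟩ := hx
      have hm' := hnorm h hh m hm
      obtain ⟨c, hc, e⟩ := ht.2 h hh m (hN hm)
      obtain ⟨c', hc', e'⟩ := ht.2 _ (hN hm') h hh
      refine ⟨(c⁻¹ * c') • t (h * m * h⁻¹), A.smul_mem (hAt _ hm') _, fun v => ?_⟩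
      rw [LinearMap.smul_apply, mul_smul, ← e', inv_mul_cancel_right, e, smul_smul, inv_mul_cancel₀ hc, one_smul]
    | zero => exact ⟨0, A.zero_mem, fun v => by simp⟩
    | add x y _ _ h1 h2 =>
      obtain ⟨x', hx', e1⟩ := h1
      obtain ⟨y', hy', e2⟩ := h2
      exact ⟨x' + y', A.add_mem hx' hy', fun v => by simp [e1, e2]⟩
    | smul c x _ h1 =>
      obtain ⟨x', hx', e1⟩ := h1
      exact ⟨c • x', A.smul_mem hx' c, fun v => by simp [e1]⟩
  have hA1 : A ≠ ⊤ := by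
    intro h
    apply hspan
    rw [eq_top_iff]
    intro x _
    rw [← hAm, h]
    trivial
  have hB := nm_centralizer ht A hA
  have hB1 : Subalgebra.centralizer K (A : Set (End K V)) ≠ ⊤ := by
    intro h
    apply hnk
    refine ker_of_bot ht (hN hn) ?_
    rw [← Algebra.IsCentral.center_eq_bot K (End K V), Subalgebra.mem_center_iff]
    intro b
    have hb : b ∈ Subalgebra.centralizer K (A : Set (End K V)) := by rw [h]; trivial
    exact ((Subalgebra.mem_centralizer_iff K).1 hb _ (hAt n hn)).symm
  have v1 := irr_case ht A hA hSM hA1 hirr h0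
  have v2 := irr_case ht _ hB hSM hB1 hirr h0
  refine (v1.inter v2).to_ker ht (fun x hx => hx.1.1) ?_
  rintro a ⟨⟨ha, h1⟩, -, h2⟩ b ⟨⟨hb, h3⟩, -, h4⟩ v
  refine h2 (t b) ?_ v
  rw [Subalgebra.mem_centralizer_iff]
  intro x hx
  ext v
  exact (h3 x hx v).symm
end
end USG
end PartP2c

section PartP3a
set_option linter.unusedVariables false
set_option linter.unusedSectionVars false
open Module Pointwise

namespace USG

lemma ind_star {G : Type} [Group G] {K : Type} [Field K] [IsAlgClosed K] (k : ℕ) :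
    ∀ (H : Subgroup G) (V : Type) [AddCommGroup V] [Module K V] [FiniteDimensional K V] (t : G → End K V),
      finrank K V = k → PR H t → ¬ VSQ H (kerP H t) →
      ∃ H' ≤ H, H'.relIndex H ≠ 0 ∧ H'.relIndex H ≤ k.factorial ∧
        ∃ (V' : Type) (_ : AddCommGroup V') (_ : Module K V') (_ : FiniteDimensional K V') (t' : G → End K V'),
          1 ≤ finrank K V' ∧ finrank K V' ≤ k ∧ PR H' t' ∧ StarP H' t' ∧ ¬ VSQ H' (kerP H' t') := by
  induction k using Nat.strong_induction_on with
  | _ k ih =>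
  intro H V _ _ _ t hk ht hns
  have h0 : 1 ≤ finrank K V := by
    by_contra h
    have h1 : finrank K V = 0 := by omega
    have : Subsingleton V := finrank_zero_iff.1 h1
    refine hns (VSQ.self H fun x hx => ⟨hx, 1, one_ne_zero, fun v => Subsingleton.elim _ _⟩)
  by_cases hst : StarP H t
  · refine ⟨H, le_rfl, by simp, ?_, V, _, _, inferInstance, t, h0, hk.le, ht, hst, hns⟩
    rw [Subgroup.relIndex_self]
    exact Nat.factorial_pos k
  · have hSM : ¬ SM K H (finrank K V) := fun h => hns (step ht h h0 hst)
    unfold SM at hSM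
    push Not at hSM
    obtain ⟨H1, hle, hi0, hik, U, _, _, _, hlt, t1, ht1, hns1⟩ := hSM
    rw [hk] at hik hlt h0
    obtain ⟨H', hle', hi', hi'', V', i1, i2, i3, t', h1, h2, h3⟩ := ih _ hlt H1 U t1 rfl ht1 hns1
    have e := Subgroup.relIndex_mul_relIndex _ _ _ hle' hle
    refine ⟨H', hle'.trans hle, ?_, ?_, V', i1, i2, i3, t', h1, h2.trans hlt.le, h3⟩
    · rw [← e]; exact mul_ne_zero hi' hi0
    · rw [← e]
      have h4 : (finrank K U).factorial ≤ (k - 1).factorial := Nat.factorial_le (by omega)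
      calc _ ≤ (k - 1).factorial * k := Nat.mul_le_mul (hi''.trans h4) hik
        _ = k.factorial := by rw [mul_comm, Nat.mul_factorial_pred (by omega)]

lemma exists_pow_of_gen {G : Type} [Group G] (E : Set G) (h1 : (1 : G) ∈ E) (hs : ∀ x ∈ E, x⁻¹ ∈ E)
    (hgen : Subgroup.closure E = ⊤) (g : G) : ∃ n, g ∈ E ^ n := by
  have hg : g ∈ Subgroup.closure E := by rw [hgen]; trivial
  induction hg using Subgroup.closure_induction with
  | mem x hx => exact ⟨1, by simpa using hx⟩
  | one => exact ⟨0, by simp⟩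
  | mul x y _ _ hx hy =>
    obtain ⟨m, hm⟩ := hx
    obtain ⟨n, hn⟩ := hy
    exact ⟨m + n, by rw [pow_add]; exact Set.mul_mem_mul hm hn⟩
  | inv x _ hx =>
    obtain ⟨m, hm⟩ := hx
    exact ⟨m, pow_inv_mem hs hm⟩

lemma coset_bound {G : Type} [Group G] (E : Set G) (h1 : (1 : G) ∈ E) (hs : ∀ x ∈ E, x⁻¹ ∈ E)
    (hgen : Subgroup.closure E = ⊤) (H : Subgroup G) (hi : H.index ≠ 0) (g : G) :
    ∃ r ∈ E ^ H.index, r⁻¹ * g ∈ H := by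
  have hfi : H.FiniteIndex := ⟨hi⟩
  have hf : Finite (G ⧸ H) := Subgroup.finite_quotient_of_finiteIndex
  let X : ℕ → Set (G ⧸ H) := fun n => (fun g : G => (g : G ⧸ H)) '' (E ^ n)
  have hmono : ∀ {m n}, m ≤ n → X m ⊆ X n := fun h => Set.image_mono (Set.pow_subset_pow_right h1 h)
  have hst : ∀ n, X (n + 1) = X n → ∀ m, n ≤ m → X m = X n := by
    intro n hn m hm
    induction m, hm using Nat.le_induction with
    | base => rfl
    | succ m hm ih =>
      refine Set.Subset.antisymm ?_ (hmono (by omega))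
      rintro _ ⟨x, hx, rfl⟩
      rw [pow_succ'] at hx
      obtain ⟨s, hsE, y, hy, rfl⟩ := hx
      have h2 : (y : G ⧸ H) ∈ X n := by rw [← ih]; exact ⟨y, hy, rfl⟩
      obtain ⟨z, hz, e⟩ := h2
      rw [← hn]
      refine ⟨s * z, by rw [pow_succ']; exact Set.mul_mem_mul hsE hz, ?_⟩
      have e' := QuotientGroup.eq.1 e
      refine QuotientGroup.eq.2 ?_
      convert e' using 1
      group
  have hex : ∃ n < H.index, X (n + 1) = X n := by
    by_contra hcon
    push Not at hcon
    have hcard : ∀ n ≤ H.index, n + 1 ≤ (X n).ncard := by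
      intro n
      induction n with
      | zero =>
        intro _
        have : (X 0).Nonempty := ⟨_, 1, by simp, rfl⟩
        have := this.ncard_pos (Set.toFinite _)
        omega
      | succ n ih =>
        intro hn
        have h2 : X n ⊂ X (n + 1) :=
          (hmono (Nat.le_succ n)).ssubset_of_ne (fun h => hcon n (by omega) h.symm)
        have h3 := Set.ncard_lt_ncard h2 (Set.toFinite _)
        have := ih (by omega)
        omega
    have h2 := hcard H.index le_rfl
    have h3 : (X H.index).ncard ≤ Nat.card (G ⧸ H) := by
      rw [← Set.ncard_univ]
      exact Set.ncard_le_ncard (Set.subset_univ _) (Set.toFinite _)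
    have : H.index = Nat.card (G ⧸ H) := rfl
    omega
  obtain ⟨n, hn, e⟩ := hex
  obtain ⟨m, hm⟩ := exists_pow_of_gen E h1 hs hgen g
  have h2 : (g : G ⧸ H) ∈ X (max m n) := hmono (le_max_left _ _) ⟨g, hm, rfl⟩
  rw [hst n e _ (le_max_right _ _)] at h2
  obtain ⟨r, hr, er⟩ := hmono hn.le h2
  exact ⟨r, hr, QuotientGroup.eq.1 er⟩

lemma gen_bound {G : Type} [Group G] (E : Set G) (h1 : (1 : G) ∈ E) (hs : ∀ x ∈ E, x⁻¹ ∈ E)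
    (hgen : Subgroup.closure E = ⊤) (H : Subgroup G) (hi : H.index ≠ 0) (c : ℕ) (hc : H.index ≤ c) :
    Subgroup.closure ((H : Set G) ∩ E ^ (2 * c + 1)) = H := by
  set L := Subgroup.closure ((H : Set G) ∩ E ^ (2 * c + 1)) with hL
  refine le_antisymm ((Subgroup.closure_le _).2 Set.inter_subset_left) ?_
  have hcos : ∀ g, ∃ r ∈ E ^ c, r⁻¹ * g ∈ H := by
    intro g
    obtain ⟨r, hr, h⟩ := coset_bound E h1 hs hgen H hi g
    exact ⟨r, Set.pow_subset_pow_right h1 hc hr, h⟩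
  have key : ∀ n, ∀ g ∈ E ^ n, ∃ r ∈ E ^ c, r⁻¹ * g ∈ L := by
    intro n
    induction n with
    | zero =>
      intro g hg
      rw [pow_zero, Set.mem_one] at hg
      subst hg
      exact ⟨1, Set.one_mem_pow h1, by simp [L.one_mem]⟩
    | succ n ih =>
      intro g hg
      rw [pow_succ'] at hg
      obtain ⟨s, hsE, y, hy, rfl⟩ := hg
      obtain ⟨e, he, hel⟩ := ih y hy
      obtain ⟨r, hr, hrH⟩ := hcos (s * e)
      refine ⟨r, hr, ?_⟩
      have h2 : r⁻¹ * (s * e) ∈ L := by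
        refine Subgroup.subset_closure ⟨hrH, ?_⟩
        have h3 : r⁻¹ * (s * e) ∈ E ^ c * (E ^ 1 * E ^ c) :=
          Set.mul_mem_mul (pow_inv_mem hs hr) (Set.mul_mem_mul (by simpa using hsE) he)
        rw [← pow_add, ← pow_add] at h3
        convert h3 using 2
        ring
      have h4 := L.mul_mem h2 hel
      convert h4 using 1
      simp only [mul_assoc, mul_inv_cancel_left]
  intro g hg
  obtain ⟨n, hn⟩ := exists_pow_of_gen E h1 hs hgen g
  obtain ⟨r, hr, hrl⟩ := key n g hn
  have hLH : L ≤ H := (Subgroup.closure_le _).2 Set.inter_subset_left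
  have h2 : r ∈ L := by
    refine Subgroup.subset_closure ⟨?_, Set.pow_subset_pow_right h1 (by omega) hr⟩
    have := H.mul_mem hg (H.inv_mem (hLH hrl))
    simpa using this
  have := L.mul_mem h2 hrl
  simpa using this

/-- left equivariant retraction to a subgroup -/
lemma exists_kappa {G : Type*} [Group G] (H : Subgroup G) : ∃ κ : G → H, ∀ (h : H) (g : G), κ (h * g) = h * κ g := by
  classical
  let s : Setoid G := QuotientGroup.rightRel H
  have hs : ∀ g : G, g * ((Quotient.mk s g).out)⁻¹ ∈ H := by
    intro g
    have h1 : s.r ((Quotient.mk s g).out) g := Quotient.mk_out (s := s) g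
    exact QuotientGroup.rightRel_apply.1 h1
  refine ⟨fun g => ⟨g * ((Quotient.mk s g).out)⁻¹, hs g⟩, ?_⟩
  intro h g
  have : Quotient.mk s ((h : G) * g) = Quotient.mk s g := by
    refine Quotient.sound ?_
    refine QuotientGroup.rightRel_apply.2 ?_
    simp
  refine Subtype.ext ?_
  simp only [this, Subgroup.coe_mul, mul_assoc]
end USG
end PartP3a

section PartP3b
set_option linter.unusedVariables false
set_option linter.unusedSectionVars false
open Module Pointwise

namespace USG

/-- finitely additive probability on a set -/
structure FA {G : Type*} (μ : Set G → ℝ) : Prop where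
  nonneg : ∀ A, 0 ≤ μ A
  add : ∀ A A', Disjoint A A' → μ (A ∪ A') = μ A + μ A'
  univ : μ Set.univ = 1

/-- left translate -/
def ltr {G : Type*} [Group G] (h : G) (A : Set G) : Set G := {g | h⁻¹ * g ∈ A}

lemma ltr_mul {G : Type*} [Group G] (a b : G) (A : Set G) : ltr (a * b) A = ltr a (ltr b A) := by
  ext g
  simp only [ltr, Set.mem_setOf_eq, mul_inv_rev, mul_assoc]

lemma ltr_one {G : Type*} [Group G] (A : Set G) : ltr 1 A = A := by
  ext g
  simp [ltr]

lemma ltr_pow {G : Type*} [Group G] (E : Set G) (μ : Set G → ℝ) (ε : ℝ)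
    (h : ∀ σ ∈ E, ∀ A, |μ (ltr σ A) - μ A| ≤ ε) (l : ℕ) :
    ∀ g ∈ E ^ l, ∀ A, |μ (ltr g A) - μ A| ≤ l * ε := by
  induction l with
  | zero =>
    intro g hg A
    rw [pow_zero, Set.mem_one] at hg
    subst hg
    simp [ltr_one]
  | succ l ih =>
    intro g hg A
    rw [pow_succ] at hg
    obtain ⟨g1, h1, s, hs, rfl⟩ := hg
    have e1 := ih g1 h1 (ltr s A)
    have e2 := h s hs A
    change |μ (ltr (g1 * s) A) - μ A| ≤ _
    rw [ltr_mul]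
    have := abs_sub_le (μ (ltr g1 (ltr s A))) (μ (ltr s A)) (μ A)
    push_cast
    linarith

section
variable {G : Type} [Group G] {K : Type} [Field K]

/-- matrix projective representation -/
structure PM {k : ℕ} (H : Subgroup G) (T : G → Mk k K) : Prop where
  mul : ∀ g ∈ H, ∀ h ∈ H, ∃ c : K, c ≠ 0 ∧ T (g * h) = c • (T g * T h)
  one : ∃ c : K, c ≠ 0 ∧ T 1 = c • 1
  det : ∀ h ∈ H, (T h).det ≠ 0

/-- `M` lifts `h` -/
def rel {k : ℕ} (T : G → Mk k K) (M : SLk k K) (h : G) : Prop := ∃ c : K, c ≠ 0 ∧ M.1 = c • T h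

variable {k : ℕ} {H : Subgroup G} {T : G → Mk k K}

lemma rel_mul (hT : PM H T) {g h : G} (hg : g ∈ H) (hh : h ∈ H) {M N : SLk k K} (h1 : rel T M g) (h2 : rel T N h) :
    rel T (M * N) (g * h) := by
  obtain ⟨a, ha, e1⟩ := h1
  obtain ⟨b, hb, e2⟩ := h2
  obtain ⟨c, hc, e3⟩ := hT.mul g hg h hh
  refine ⟨a * b * c⁻¹, mul_ne_zero (mul_ne_zero ha hb) (inv_ne_zero hc), ?_⟩
  change M.1 * N.1 = _
  rw [e1, e2, e3, smul_smul, inv_mul_cancel_right₀ hc, smul_mul_smul_comm]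

lemma rel_one (hT : PM H T) : rel T (1 : SLk k K) 1 := by
  obtain ⟨c, hc, e⟩ := hT.one
  refine ⟨c⁻¹, inv_ne_zero hc, ?_⟩
  rw [e, smul_smul, inv_mul_cancel₀ hc, one_smul]; rfl

lemma rel_inv (hT : PM H T) {h : G} (hh : h ∈ H) {M : SLk k K} (h1 : rel T M h) : rel T M⁻¹ h⁻¹ := by
  obtain ⟨a, ha, e1⟩ := h1
  obtain ⟨b, hb, e2⟩ := hT.one
  obtain ⟨c, hc, e3⟩ := hT.mul h hh h⁻¹ (H.inv_mem hh)
  rw [mul_inv_cancel, e2] at e3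
  have e4 : M.1 * T h⁻¹ = (a * c⁻¹ * b) • (1 : Mk k K) := by
    rw [mul_smul, e3, e1, smul_smul, inv_mul_cancel_right₀ hc, smul_mul_assoc]
  have hne : a * c⁻¹ * b ≠ 0 := mul_ne_zero (mul_ne_zero ha (inv_ne_zero hc)) hb
  refine ⟨(a * c⁻¹ * b)⁻¹, inv_ne_zero hne, ?_⟩
  have e5 : (M⁻¹).1 * M.1 = 1 := by
    change ((M⁻¹ * M : SLk k K)).1 = 1
    rw [inv_mul_cancel]; rfl
  have e6 : T h⁻¹ = (a * c⁻¹ * b) • (M⁻¹).1 := by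
    calc T h⁻¹ = (M⁻¹).1 * M.1 * T h⁻¹ := by rw [e5, one_mul]
      _ = _ := by rw [mul_assoc, e4, Algebra.mul_smul_comm, mul_one]
  rw [e6, smul_smul, inv_mul_cancel₀ hne, one_smul]

lemma rel_ex [IsAlgClosed K] (hk : 0 < k) (hT : PM H T) {h : G} (hh : h ∈ H) : ∃ M, rel T M h := by
  obtain ⟨c, hc⟩ := IsAlgClosed.exists_pow_nat_eq ((T h).det)⁻¹ hk
  have hd := hT.det h hh
  have hc0 : c ≠ 0 := by
    rintro rfl
    rw [zero_pow hk.ne'] at hc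
    exact inv_ne_zero hd hc.symm
  refine ⟨⟨c • T h, ?_⟩, c, hc0, rfl⟩
  rw [Matrix.det_smul, Fintype.card_fin, hc, inv_mul_cancel₀ hd]

lemma rel_sc (hT : PM H T) {M : SLk k K} (h1 : rel T M 1) : Sc M := by
  obtain ⟨a, ha, e⟩ := h1
  obtain ⟨b, hb, e2⟩ := hT.one
  rw [sc_iff]
  exact ⟨a * b, by rw [e, e2, smul_smul]⟩

lemma rel_fin (hT : PM H T) {h : G} (hh : h ∈ H) : {M : SLk k K | rel T M h}.Finite := by
  rcases Set.eq_empty_or_nonempty {M : SLk k K | rel T M h} with h0 | ⟨M0, h0⟩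
  · rw [h0]; exact Set.finite_empty
  · refine ((sc_finite (K := K) (k := k)).image (fun x => M0 * x)).subset ?_
    intro M hM
    refine ⟨M0⁻¹ * M, ?_, by simp⟩
    have := rel_mul hT (H.inv_mem hh) hh (rel_inv hT hh h0) hM
    rw [inv_mul_cancel] at this
    exact rel_sc hT this

/-- lifts of a subset -/
def lifts (T : G → Mk k K) (S : Set G) : Set (SLk k K) := {M | ∃ h ∈ S, rel T M h}

lemma closure_lifts [IsAlgClosed K] (hk : 0 < k) (hT : PM H T) (S : Set G) (hS : Subgroup.closure S = H) (h1 : (1 : G) ∈ S) :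
    (Subgroup.closure (lifts T S) : Set (SLk k K)) = lifts T (H : Set G) := by
  have hSH : S ⊆ H := by rw [← hS]; exact Subgroup.subset_closure
  apply Set.Subset.antisymm
  · intro M hM
    change M ∈ Subgroup.closure (lifts T S) at hM
    induction hM using Subgroup.closure_induction with
    | mem x hx =>
      obtain ⟨h, hh, hr⟩ := hx
      exact ⟨h, hSH hh, hr⟩
    | one => exact ⟨1, H.one_mem, rel_one hT⟩
    | mul x y _ _ hx hy =>
      obtain ⟨a, ha, hr⟩ := hx
      obtain ⟨b, hb, hr'⟩ := hy
      exact ⟨a * b, H.mul_mem ha hb, rel_mul hT ha hb hr hr'⟩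
    | inv x _ hx =>
      obtain ⟨a, ha, hr⟩ := hx
      exact ⟨a⁻¹, H.inv_mem ha, rel_inv hT ha hr⟩
  · rintro M ⟨h, hh, hr⟩
    have key : ∃ M' ∈ Subgroup.closure (lifts T S), rel T M' h := by
      have hh' : h ∈ Subgroup.closure S := by rw [hS]; exact hh
      clear hr hh
      induction hh' using Subgroup.closure_induction with
      | mem x hx =>
        obtain ⟨M', hM'⟩ := rel_ex hk hT (hSH hx)
        exact ⟨M', Subgroup.subset_closure ⟨x, hx, hM'⟩, hM'⟩
      | one => exact ⟨1, one_mem _, rel_one hT⟩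
      | mul x y hx' hy' hx hy =>
        obtain ⟨a, ha, hr⟩ := hx
        obtain ⟨b, hb, hr'⟩ := hy
        rw [hS] at hx' hy'
        exact ⟨a * b, mul_mem ha hb, rel_mul hT hx' hy' hr hr'⟩
      | inv x hx' hx =>
        obtain ⟨a, ha, hr⟩ := hx
        rw [hS] at hx'
        exact ⟨a⁻¹, inv_mem ha, rel_inv hT hx' hr⟩
    obtain ⟨M', hM', hr'⟩ := key
    have h2 := rel_mul hT hh (H.inv_mem hh) hr (rel_inv hT hh hr')
    rw [mul_inv_cancel] at h2
    have h3 : M * M'⁻¹ ∈ Subgroup.closure (lifts T S) := Subgroup.subset_closure ⟨1, h1, h2⟩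
    have h4 := mul_mem h3 hM'
    simpa using h4

end
end USG
end PartP3b

section PartP3c
set_option linter.unusedVariables false
set_option linter.unusedSectionVars false
open Module Pointwise

namespace USG

section
variable {G : Type} [Group G] {K : Type} [Field K]

lemma pm_of_pr {V : Type} [AddCommGroup V] [Module K V] [FiniteDimensional K V] {H : Subgroup G} {t : G → End K V}
    (ht : PR H t) {k : ℕ} (b : Basis (Fin k) K V) : PM H (fun g => LinearMap.toMatrix b b (t g)) := by
  have hmul : ∀ g ∈ H, ∀ h ∈ H, ∃ c : K, c ≠ 0 ∧
      LinearMap.toMatrix b b (t (g * h)) = c • (LinearMap.toMatrix b b (t g) * LinearMap.toMatrix b b (t h)) := by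
    intro g hg h hh
    obtain ⟨c, hc, e⟩ := ht.2 g hg h hh
    refine ⟨c, hc, ?_⟩
    rw [← LinearMap.toMatrix_mul, ← map_smul]
    congr 1
    ext v
    rw [e]; rfl
  have hone : ∃ c : K, c ≠ 0 ∧ LinearMap.toMatrix b b (t 1) = c • 1 := by
    obtain ⟨c, hc, e⟩ := ht.one
    refine ⟨c, hc, ?_⟩
    rw [← LinearMap.toMatrix_one b, ← map_smul]
    congr 1
    ext v
    rw [e]; rfl
  refine ⟨hmul, hone, ?_⟩
  intro h hh h0
  obtain ⟨c, hc, e⟩ := hmul h hh h⁻¹ (H.inv_mem hh)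
  obtain ⟨d, hd, e2⟩ := hone
  rw [mul_inv_cancel, e2] at e
  have := congrArg Matrix.det e
  rw [Matrix.det_smul, Matrix.det_smul, Matrix.det_mul, Matrix.det_one, h0, zero_mul, mul_zero, mul_one] at this
  exact pow_ne_zero _ hd this

lemma good_lifts [IsAlgClosed K] {V : Type} [AddCommGroup V] [Module K V] [FiniteDimensional K V] {H : Subgroup G} {t : G → End K V}
    (ht : PR H t) {k : ℕ} (hk : 0 < k) (b : Basis (Fin k) K V) (hst : StarP H t) (hns : ¬ VSQ H (kerP H t))
    (S : Set G) (hS : Subgroup.closure S = H) (h1 : (1 : G) ∈ S) (hsym : ∀ x ∈ S, x⁻¹ ∈ S) :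
    Good (lifts (fun g => LinearMap.toMatrix b b (t g)) S) := by
  set T : G → Mk k K := fun g => LinearMap.toMatrix b b (t g) with hTdef
  have hT : PM H T := pm_of_pr ht b
  have hcl := closure_lifts hk hT S hS h1
  have hSH : S ⊆ H := by rw [← hS]; exact Subgroup.subset_closure
  have hker : ∀ h ∈ H, ∀ M : SLk k K, rel T M h → Sc M → h ∈ kerP H t := by
    rintro h hh M ⟨c, hc, e⟩ hM
    refine ker_of_bot ht hh ?_
    obtain ⟨a, ha⟩ := (sc_iff M).1 hM
    rw [← ha] at e
    have e2 : T h = (c⁻¹ * a) • 1 := by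
      rw [mul_smul, e, smul_smul, inv_mul_cancel₀ hc, one_smul]
    have e3 : t h = (c⁻¹ * a) • 1 := by
      apply (LinearMap.toMatrix b b).injective
      rw [map_smul, LinearMap.toMatrix_one]
      exact e2
    rw [e3]
    exact Subalgebra.smul_mem _ (Subalgebra.one_mem _) _
  have hsc1 : Sc (1 : SLk k K) := (sc_iff _).2 ⟨1, one_smul _ _⟩
  refine ⟨⟨1, h1, rel_one hT⟩, ?_, ?_, ?_⟩
  · rintro M ⟨h, hh, hr⟩
    exact ⟨h⁻¹, hsym h hh, rel_inv hT (hSH hh) hr⟩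
  · rw [hcl]
    intro hfin
    apply hns
    choose φ hφ using fun h : H => rel_ex hk hT h.2
    have : Finite (lifts T (H : Set G)) := hfin
    obtain ⟨i1, i2⟩ := relIndex_le_card (subg ht ⊥) H (X := lifts T (H : Set G)) (fun h => ⟨φ h, h.1, h.2, hφ h⟩) (by
      intro a c hac
      have e : φ a = φ c := congrArg Subtype.val hac
      have key : ∀ a c : H, φ a = φ c → c.1⁻¹ * a.1 ∈ kerP H t := by
        intro a c e
        have h2 := rel_mul hT (H.inv_mem c.2) a.2 (rel_inv hT c.2 (hφ c)) (hφ a)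
        rw [e, inv_mul_cancel] at h2
        exact hker _ (H.mul_mem (H.inv_mem c.2) a.2) _ h2 hsc1
      have k1 := key a c e
      have k2 := key c a e.symm
      refine ⟨k1.1, mem_bot_of _ k1.2, ?_⟩
      rw [mul_inv_rev, inv_inv]
      exact mem_bot_of _ k2.2)
    refine ⟨subg ht ⊥, fun x hx => hx.1, i1, 0, ?_⟩
    rintro x ⟨hx, hx2, _⟩
    exact ker_of_bot ht hx hx2
  · intro N hN hnorm
    have hN' : ∀ M ∈ N, ∃ h ∈ H, rel T M h := by
      intro M hM
      have : M ∈ (Subgroup.closure (lifts T S) : Set (SLk k K)) := hN hM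
      rw [hcl] at this
      exact this
    let N' : Subgroup G :=
      { carrier := {h | h ∈ H ∧ ∃ M ∈ N, rel T M h}
        one_mem' := ⟨H.one_mem, 1, N.one_mem, rel_one hT⟩
        mul_mem' := by
          rintro x y ⟨hx, M, hM, r1⟩ ⟨hy, M', hM', r2⟩
          exact ⟨H.mul_mem hx hy, M * M', N.mul_mem hM hM', rel_mul hT hx hy r1 r2⟩
        inv_mem' := by
          rintro x ⟨hx, M, hM, r1⟩
          exact ⟨H.inv_mem hx, M⁻¹, N.inv_mem hM, rel_inv hT hx r1⟩ }
    have hst' := hst N' (fun x hx => hx.1) (by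
      rintro g hg n ⟨hn, M, hM, r⟩
      obtain ⟨X, hX⟩ := rel_ex hk hT hg
      have hXc : X ∈ Subgroup.closure (lifts T S) := by
        change X ∈ (Subgroup.closure (lifts T S) : Set (SLk k K))
        rw [hcl]
        exact ⟨g, hg, hX⟩
      exact ⟨H.mul_mem (H.mul_mem hg hn) (H.inv_mem hg), X * M * X⁻¹, hnorm X hXc M hM,
        rel_mul hT (H.mul_mem hg hn) (H.inv_mem hg) (rel_mul hT hg hn hX r) (rel_inv hT hg hX)⟩)
    rcases hst' with h2 | h2
    · left
      intro M hM
      obtain ⟨h, hh, c, hc, e⟩ := hN' M hM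
      obtain ⟨_, a, ha, e2⟩ := h2 h ⟨hh, M, hM, c, hc, e⟩
      rw [sc_iff]
      refine ⟨c * a, ?_⟩
      have e3 : t h = a • 1 := by
        ext v; rw [e2]; rfl
      have e4 : T h = a • 1 := by
        simp only [hTdef]
        rw [e3, map_smul, LinearMap.toMatrix_one]
      rw [e, e4, smul_smul]
    · right
      rw [eq_top_iff]
      intro X _
      have h3 : (LinearMap.toMatrix b b).symm X ∈ Submodule.span K (t '' (N' : Set G)) := by rw [h2]; trivial
      have h4 := Submodule.mem_map_of_mem (f := (LinearMap.toMatrix b b).toLinearMap) h3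
      rw [Submodule.map_span] at h4
      simp only [LinearEquiv.coe_coe, LinearEquiv.apply_symm_apply] at h4
      refine (Submodule.span_le.2 ?_) h4
      rintro _ ⟨_, ⟨h, ⟨hh, M, hM, c, hc, e⟩, rfl⟩, rfl⟩
      have : LinearMap.toMatrix b b (t h) = c⁻¹ • mc M := by
        change T h = c⁻¹ • M.1
        rw [e, smul_smul, inv_mul_cancel₀ hc, one_smul]
      change LinearMap.toMatrix b b (t h) ∈ _
      rw [this]
      exact Submodule.smul_mem _ _ (Submodule.subset_span ⟨M, hM, rfl⟩)

lemma core [IsAlgClosed K] {V : Type} [AddCommGroup V] [Module K V] [FiniteDimensional K V] {H : Subgroup G} {t : G → End K V}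
    (ht : PR H t) {k : ℕ} (hk : 0 < k) (hV : finrank K V = k) (hst : StarP H t) (hns : ¬ VSQ H (kerP H t))
    (F : Set G) (hF : F.Finite) (h1 : (1 : G) ∈ F) (hgen : Subgroup.closure F = ⊤) (c : ℕ) (hi : H.index ≠ 0) (hic : H.index ≤ c)
    (ε : ℝ) (hε : 0 < ε)
    (hM : ∀ F : Set (SLk k K), F.Finite → Good F → ∀ m : Set (Fin k → K) → ℝ, FAP m →
      ∃ σ ∈ F, ∃ A, IsCone A ∧ ε < |m (mim σ A) - m A|)
    (μ : Set G → ℝ) (hμ : FA μ) : ∃ σ ∈ F, ∃ A, ε / (2 * c + 1) < |μ (ltr σ A) - μ A| := by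
  by_contra hcon
  push Not at hcon
  let E : Set G := F ∪ F⁻¹
  have hE1 : (1 : G) ∈ E := Or.inl h1
  have hEs : ∀ x ∈ E, x⁻¹ ∈ E := by
    rintro x (hx | hx)
    · right; simpa using hx
    · left; exact hx
  have hEgen : Subgroup.closure E = ⊤ := by
    rw [eq_top_iff, ← hgen]
    exact Subgroup.closure_mono Set.subset_union_left
  have hEfin : E.Finite := hF.union hF.inv
  have hEinv : ∀ σ ∈ E, ∀ A, |μ (ltr σ A) - μ A| ≤ ε / (2 * c + 1) := by
    rintro σ (hσ | hσ) A
    · exact hcon σ hσ A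
    · have := hcon σ⁻¹ hσ (ltr σ A)
      rw [← ltr_mul, inv_mul_cancel, ltr_one, abs_sub_comm] at this
      exact this
  let S : Set G := (H : Set G) ∩ E ^ (2 * c + 1)
  have hS : Subgroup.closure S = H := gen_bound E hE1 hEs hEgen H hi c hic
  have hS1 : (1 : G) ∈ S := ⟨H.one_mem, Set.one_mem_pow hE1⟩
  have hSs : ∀ x ∈ S, x⁻¹ ∈ S := fun x hx => ⟨H.inv_mem hx.1, pow_inv_mem hEs hx.2⟩
  have hSfin : S.Finite := (pow_fin hEfin _).subset Set.inter_subset_right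
  let b : Basis (Fin k) K V := Module.finBasisOfFinrankEq K V hV
  have hgood := good_lifts ht hk b hst hns S hS hS1 hSs
  set T : G → Mk k K := fun g => LinearMap.toMatrix b b (t g) with hTdef
  have hT : PM H T := pm_of_pr ht b
  have hfin : (lifts T S).Finite := by
    have : lifts T S = ⋃ h ∈ S, {M | rel T M h} := by
      ext M; simp [lifts]
    rw [this]
    exact hSfin.biUnion fun h hh => rel_fin hT hh.1
  obtain ⟨κ, hκ⟩ := exists_kappa H
  have nt : Nontrivial V := Module.nontrivial_of_finrank_pos (R := K) (by omega)
  obtain ⟨v0, hv0⟩ := exists_ne (0 : V)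
  let p : G → (Fin k → K) := fun g => b.equivFun (t (κ g).1 v0)
  let m : Set (Fin k → K) → ℝ := fun A => μ (p ⁻¹' A)
  have hp0 : ∀ g, p g ≠ 0 := by
    intro g h
    have h2 : t (κ g).1 v0 = 0 := (LinearEquiv.map_eq_zero_iff _).1 h
    exact hv0 (ht.1 _ (κ g).2 (by rw [h2, map_zero]))
  have hempty : μ ∅ = 0 := by
    have := hμ.add ∅ ∅ (by simp)
    simp at this
    exact this
  have hm : FAP m := by
    refine ⟨fun A => hμ.nonneg _, fun A A' h => ?_, hμ.univ, ?_⟩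
    · change μ (p ⁻¹' (A ∪ A')) = _
      rw [Set.preimage_union]
      exact hμ.add _ _ (h.preimage p)
    · change μ (p ⁻¹' {0}) = 0
      have : p ⁻¹' {0} = ∅ := by
        ext g; simp [hp0 g]
      rw [this, hempty]
  obtain ⟨M, ⟨h, hh, hr⟩, A, hA, hlt⟩ := hM _ hfin hgood m hm
  have heq : p ⁻¹' (mim M A) = ltr h (p ⁻¹' A) := by
    ext g
    rw [Set.mem_preimage, mem_mim]
    change _ ↔ p (h⁻¹ * g) ∈ A
    obtain ⟨a, ha, e⟩ := rel_inv hT hh.1 hr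
    have hh' : h⁻¹ ∈ H := H.inv_mem hh.1
    have ek : (κ (h⁻¹ * g)).1 = h⁻¹ * (κ g).1 := congrArg Subtype.val (hκ ⟨h⁻¹, hh'⟩ g)
    obtain ⟨d, hd, e2⟩ := ht.2 _ hh' _ (κ g).2
    have e3 : p (h⁻¹ * g) = d • (T h⁻¹).mulVec (p g) := by
      change b.equivFun (t (κ (h⁻¹ * g)).1 v0) = _
      rw [ek, e2, map_smul]
      congr 1
      have := LinearMap.toMatrix_mulVec_repr b b (t h⁻¹) (t (κ g).1 v0)
      exact this.symm
    rw [e, e3, Matrix.smul_mulVec]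
    constructor
    · intro h3
      have := hA _ h3 (d * a⁻¹) (mul_ne_zero hd (inv_ne_zero ha))
      rwa [smul_smul, inv_mul_cancel_right₀ ha] at this
    · intro h3
      have := hA _ h3 (a * d⁻¹) (mul_ne_zero ha (inv_ne_zero hd))
      rwa [smul_smul, inv_mul_cancel_right₀ hd] at this
  have h3 := ltr_pow E μ _ hEinv (2 * c + 1) h hh.2 (p ⁻¹' A)
  rw [← heq] at h3
  have h4 : ((2 * c + 1 : ℕ) : ℝ) * (ε / (2 * c + 1)) = ε := by
    push_cast
    field_simp
  rw [h4] at h3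
  exact absurd h3 (not_le.2 hlt)

end
end USG
end PartP3c

section PartP3d
set_option linter.unusedVariables false
set_option linter.unusedSectionVars false
open Module Pointwise

namespace USG

theorem theoremA (d : ℕ) : ∃ ε : ℝ, 0 < ε ∧ ∀ (K : Type) [Field K] [IsAlgClosed K] [Countable K]
    (G : Type) [Group G] (F : Set G), F.Finite → 1 ∈ F → Subgroup.closure F = ⊤ →
    ∀ φ : G →* GL (Fin d) K, Function.Injective φ →
    (∀ H : Subgroup G, H.FiniteIndex → ¬ IsSolvable H) →
    ∀ μ : Set G → ℝ, FA μ → ∃ σ ∈ F, ∃ A, ε < |μ (ltr σ A) - μ A| := by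
  have hex : ∀ k : ℕ, ∃ ε : ℝ, 0 < ε ∧ (0 < k → ∀ (K : Type) [Field K] [IsAlgClosed K] [Countable K]
    (F : Set (SLk k K)), F.Finite → Good F → ∀ m : Set (Fin k → K) → ℝ, FAP m →
      ∃ σ ∈ F, ∃ A, IsCone A ∧ ε < |m (mim σ A) - m A|) := by
    intro k
    rcases Nat.eq_zero_or_pos k with h | h
    · exact ⟨1, one_pos, fun h' => by omega⟩
    · obtain ⟨ε, h1, h2⟩ := theoremM k h
      exact ⟨ε, h1, fun _ => h2⟩
  choose e he hM using hex
  have hne : (Finset.range (d + 1)).Nonempty := ⟨0, by simp⟩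
  obtain ⟨k0, hk0, hmin⟩ := Finset.exists_min_image (Finset.range (d + 1)) e hne
  refine ⟨e k0 / (2 * (d.factorial : ℕ) + 1), by have := he k0; positivity, ?_⟩
  intro K _ _ _ G _ F hF h1 hgen φ hφ hG μ hμ
  let t : G → End K (Fin d → K) := fun g => Matrix.mulVecLin (φ g).1
  have hmul : ∀ g h v, t (g * h) v = t g (t h v) := by
    intro g h v
    simp [t, Matrix.mulVec_mulVec]
  have hone : ∀ v, t 1 v = v := by
    intro v; simp [t]
  have ht : PR (⊤ : Subgroup G) t := by
    refine ⟨fun h _ => ?_, fun g _ h _ => ⟨1, one_ne_zero, fun v => by rw [hmul, one_smul]⟩⟩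
    refine Function.LeftInverse.injective (g := t h⁻¹) fun v => ?_
    rw [← hmul, inv_mul_cancel, hone]
  have hinj : ∀ g h, (∀ v, t g v = t h v) → g = h := by
    intro g h hv
    apply hφ
    apply Units.ext
    apply Matrix.mulVec_injective
    funext v
    exact hv v
  have hns : ¬ VSQ (⊤ : Subgroup G) (kerP ⊤ t) := by
    intro hv
    obtain ⟨H0, hl, hr, n, hn⟩ := hv.comm ⊥ (by
      rintro a ⟨-, x, hx, ha⟩ b ⟨-, y, hy, hb⟩
      rw [Subgroup.mem_bot]
      have : a * b = b * a := by
        apply hinj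
        intro v
        rw [hmul, hmul, ha, hb, hb, ha, smul_comm]
      rw [this]; group)
    have hs := solvable_of_ds H0 n hn
    rw [Subgroup.relIndex_top_right] at hr
    exact hG H0 ⟨hr⟩ hs
  obtain ⟨H', -, hi, hic, V', i1, i2, i3, t', hk1, hk2, ht', hst, hns'⟩ :=
    ind_star d ⊤ (Fin d → K) t (by simp) ht hns
  rw [Subgroup.relIndex_top_right] at hi hic
  obtain ⟨σ, hσ, A, hA⟩ := core ht' hk1 rfl hst hns' F hF h1 hgen d.factorial hi hic (e _) (he _) (hM _ hk1 K) μ hμ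
  refine ⟨σ, hσ, A, lt_of_le_of_lt ?_ hA⟩
  have := hmin (finrank K V') (by simp; omega)
  gcongr

end USG
end PartP3d

section PartP3e
set_option linter.unusedVariables false
set_option linter.unusedSectionVars false
open Module Pointwise

namespace USG

lemma mass_diff {X : Type*} (e : X ≃ X) (f : X → ℂ) (hf : Summable fun x => ‖f x‖ ^ 2) (B : Set X) (ε : ℝ) (hε : 0 < ε)
    (hE : ∑' x, ‖f (e x) - f x‖ ^ 2 ≤ ε ^ 2 / 4 * ∑' x, ‖f x‖ ^ 2) :
    |∑' x, Set.indicator (e ⁻¹' B) (fun x => ‖f x‖ ^ 2) x - ∑' x, Set.indicator B (fun x => ‖f x‖ ^ 2) x|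
      ≤ ε * ∑' x, ‖f x‖ ^ 2 := by
  set S := ∑' x, ‖f x‖ ^ 2 with hS
  have hfe : Summable fun x => ‖f (e x)‖ ^ 2 := (e.summable_iff (f := fun x => ‖f x‖ ^ 2)).2 hf
  have hSe : ∑' x, ‖f (e x)‖ ^ 2 = S := e.tsum_eq (fun x => ‖f x‖ ^ 2)
  have hD : Summable fun x => ‖f (e x) - f x‖ ^ 2 := by
    refine Summable.of_nonneg_of_le (fun x => by positivity) (fun x => ?_) ((hfe.add hf).mul_left 2)
    have h1 := norm_sub_le (f (e x)) (f x)
    have h0 := norm_nonneg (f (e x) - f x)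
    have h2 : ‖f (e x) - f x‖ ^ 2 ≤ (‖f (e x)‖ + ‖f x‖) ^ 2 := by gcongr
    nlinarith [sq_nonneg (‖f (e x)‖ - ‖f x‖)]
  have hB : ∑' x, Set.indicator B (fun x => ‖f x‖ ^ 2) x
      = ∑' x, Set.indicator (e ⁻¹' B) (fun x => ‖f (e x)‖ ^ 2) x := by
    rw [← e.tsum_eq]; rfl
  rw [hB, ← (hf.indicator _).tsum_sub (hfe.indicator _)]
  have hpt : ∀ x, |Set.indicator (e ⁻¹' B) (fun x => ‖f x‖ ^ 2) x - Set.indicator (e ⁻¹' B) (fun x => ‖f (e x)‖ ^ 2) x|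
      ≤ 2 / ε * ‖f (e x) - f x‖ ^ 2 + ε / 4 * (‖f (e x)‖ ^ 2 + ‖f x‖ ^ 2) := by
    intro x
    by_cases hx : x ∈ e ⁻¹' B
    · rw [Set.indicator_of_mem hx, Set.indicator_of_mem hx]
      have h1 := abs_norm_sub_norm_le (f (e x)) (f x)
      have ha := norm_nonneg (f (e x))
      have hb := norm_nonneg (f x)
      generalize ‖f (e x) - f x‖ = D at *
      generalize ‖f (e x)‖ = a at *
      generalize ‖f x‖ = b at *
      have hD0 : 0 ≤ D := (abs_nonneg _).trans h1
      have e1 : |b ^ 2 - a ^ 2| = |a - b| * (a + b) := by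
        rw [← abs_of_nonneg (add_nonneg ha hb), ← abs_mul, abs_sub_comm]
        congr 1; ring
      rw [e1]
      have e2 : |a - b| * (a + b) ≤ D * (a + b) := by gcongr
      refine e2.trans ?_
      have key : D * (a + b) ≤ 2 / ε * D ^ 2 + ε / 8 * (a + b) ^ 2 := by
        have : 2 / ε * D ^ 2 + ε / 8 * (a + b) ^ 2 - D * (a + b) = 2 / ε * (D - ε / 4 * (a + b)) ^ 2 := by
          field_simp; ring
        have h3 : 0 ≤ 2 / ε * (D - ε / 4 * (a + b)) ^ 2 := by positivity
        linarith
      nlinarith [mul_nonneg hε.le (sq_nonneg (a - b))]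
    · rw [Set.indicator_of_notMem hx, Set.indicator_of_notMem hx]
      simp only [sub_zero, abs_zero]; positivity
  have hsum : Summable fun x => 2 / ε * ‖f (e x) - f x‖ ^ 2 + ε / 4 * (‖f (e x)‖ ^ 2 + ‖f x‖ ^ 2) :=
    (hD.mul_left _).add ((hfe.add hf).mul_left _)
  refine (tsum_of_norm_bounded (hsum.hasSum) (fun x => (Real.norm_eq_abs _).le.trans (hpt x))).trans ?_
  rw [(hD.mul_left _).tsum_add ((hfe.add hf).mul_left _), tsum_mul_left, tsum_mul_left, hfe.tsum_add hf, hSe, ← hS]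
  have : 2 / ε * ∑' x, ‖f (e x) - f x‖ ^ 2 ≤ 2 / ε * (ε ^ 2 / 4 * S) := by gcongr
  have e3 : 2 / ε * (ε ^ 2 / 4 * S) = ε / 2 * S := by field_simp; ring
  linarith

lemma mass_FA {X G : Type*} (κ : X → G) (f : X → ℂ) (hf : Summable fun x => ‖f x‖ ^ 2) (h0 : ∑' x, ‖f x‖ ^ 2 ≠ 0) :
    FA fun A : Set G => (∑' x, Set.indicator (κ ⁻¹' A) (fun x => ‖f x‖ ^ 2) x) / ∑' x, ‖f x‖ ^ 2 := by
  refine ⟨fun A => ?_, fun A A' h => ?_, ?_⟩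
  · exact div_nonneg (tsum_nonneg fun x => Set.indicator_nonneg (fun _ _ => by positivity) _)
      (tsum_nonneg fun x => by positivity)
  · rw [← add_div, ← (hf.indicator _).tsum_add (hf.indicator _), Set.preimage_union,
      Set.indicator_union_of_disjoint (h.preimage κ)]
  · simp only [Set.preimage_univ, Set.indicator_univ]
    exact div_self h0

lemma exists_gl_embed {d : ℕ} (K : Type) [Field K] (F : Set (GL (Fin d) K)) (hF : F.Finite) :
    ∃ (K' : Type) (_ : Field K') (_ : IsAlgClosed K') (_ : Countable K') (φ : ↥(Subgroup.closure F) →* GL (Fin d) K'),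
      Function.Injective φ := by
  classical
  let E : Set K := ⋃ x ∈ F, ⋃ i : Fin d, ⋃ j : Fin d, {x.1 i j}
  have hE : E.Countable := hF.countable.biUnion fun x _ => Set.countable_iUnion fun i =>
    Set.countable_iUnion fun j => Set.countable_singleton _
  let K0 : Subfield K := Subfield.closure E
  have hc0 : Countable K0 := by
    rw [← Cardinal.mk_le_aleph0_iff]
    exact (Subfield.cardinalMk_closure_le_max E).trans (max_le hE.le_aleph0 le_rfl)
  have hc1 : Countable (AlgebraicClosure K0) := by
    rw [← Cardinal.mk_le_aleph0_iff]
    exact (Algebra.IsAlgebraic.cardinalMk_le_max K0 (AlgebraicClosure K0)).trans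
      (max_le (Cardinal.mk_le_aleph0_iff.2 hc0) le_rfl)
  have hinj : ∀ {R S : Type} [Field R] [Field S] (f : R →+* S),
      Function.Injective (Matrix.GeneralLinearGroup.map (n := Fin d) f) := by
    intro R S _ _ f a b h
    apply Units.ext
    ext i j
    apply f.injective
    rw [← Matrix.GeneralLinearGroup.map_apply, ← Matrix.GeneralLinearGroup.map_apply, h]
  let ψ := Matrix.GeneralLinearGroup.map (n := Fin d) K0.subtype
  have hle : Subgroup.closure F ≤ ψ.range := by
    rw [Subgroup.closure_le]
    intro x hx
    have hmem : ∀ i j, x.1 i j ∈ K0 := fun i j => Subfield.subset_closure (by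
      simp only [E, Set.mem_iUnion, Set.mem_singleton_iff]
      exact ⟨x, hx, i, j, rfl⟩)
    let A : Matrix (Fin d) (Fin d) K0 := Matrix.of fun i j => ⟨x.1 i j, hmem i j⟩
    have hA : A.map K0.subtype = x.1 := by ext i j; rfl
    have hdet : A.det ≠ 0 := by
      intro h
      have h2 := RingHom.map_det K0.subtype A
      rw [h, map_zero, RingHom.mapMatrix_apply, hA] at h2
      have h3 : IsUnit x.1.det := (Matrix.isUnit_iff_isUnit_det _).1 x.isUnit
      exact h3.ne_zero h2.symm
    refine ⟨Matrix.GeneralLinearGroup.mkOfDetNeZero A hdet, ?_⟩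
    apply Units.ext
    exact hA
  refine ⟨AlgebraicClosure K0, inferInstance, inferInstance, hc1,
    (Matrix.GeneralLinearGroup.map (algebraMap K0 (AlgebraicClosure K0))).comp
      ((MonoidHom.ofInjective (hinj K0.subtype)).symm.toMonoidHom.comp (Subgroup.inclusion hle)), ?_⟩
  exact (hinj _).comp ((MulEquiv.injective (MonoidHom.ofInjective (hinj K0.subtype)).symm).comp (Subgroup.inclusion_injective hle))

end USG
end PartP3e

open scoped MatrixGroups

/-- **Uniform spectral gap in `ℓ²`.** For every `d ≥ 1` there is `ε = ε(d) > 0` such that if `F`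
is a finite subset of `GL_d(K)` containing the identity and generating a non virtually solvable
subgroup, `Γ` is any subgroup of `GL_d(K)` containing `F`, and `f ∈ ℓ²(Γ)`, then there is `σ ∈ F`
with `Σ_x |f(σ⁻¹x) − f(x)|² ≥ ε · Σ_x |f(x)|²`. -/
theorem uniform_spectral_gap :
    ∀ d : ℕ, 1 ≤ d → ∃ ε : ℝ, 0 < ε ∧
      ∀ (K : Type) [Field K], ∀ F : Set (GL (Fin d) K),
        F.Finite → (1 : GL (Fin d) K) ∈ F →
        ¬(∃ H : Subgroup ↥(Subgroup.closure F), H.FiniteIndex ∧ IsSolvable ↥H) →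
        ∀ Γ : Subgroup (GL (Fin d) K), ∀ hΓ : F ⊆ (Γ : Set (GL (Fin d) K)),
        ∀ f : Γ → ℂ, Summable (fun x : Γ => ‖f x‖ ^ 2) →
        ∃ σ : GL (Fin d) K, ∃ hσ : σ ∈ F,
          ε * (∑' x : Γ, ‖f x‖ ^ 2) ≤
            ∑' x : Γ, ‖f ((⟨σ, hΓ hσ⟩ : Γ)⁻¹ * x) - f x‖ ^ 2 := by
  intro d _
  obtain ⟨ε, hε, hA⟩ := USG.theoremA d
  refine ⟨ε ^ 2 / 4, by positivity, ?_⟩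
  intro K _ F hF h1 hns Γ hΓ f hf
  by_cases hz : ∑' x : Γ, ‖f x‖ ^ 2 = 0
  · refine ⟨1, h1, ?_⟩
    rw [hz, mul_zero]
    exact tsum_nonneg fun x => by positivity
  have hpos : 0 < ∑' x : Γ, ‖f x‖ ^ 2 := lt_of_le_of_ne (tsum_nonneg fun x => by positivity) (Ne.symm hz)
  obtain ⟨K', _, _, _, φ, hφ⟩ := USG.exists_gl_embed K F hF
  have hcl : Subgroup.closure F ≤ Γ := (Subgroup.closure_le Γ).2 hΓ
  obtain ⟨κ0, hκ0⟩ := USG.exists_kappa ((Subgroup.closure F).subgroupOf Γ)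
  let κ : Γ → ↥(Subgroup.closure F) := fun x => ⟨((κ0 x : Γ) : GL (Fin d) K), (κ0 x).2⟩
  have hκ : ∀ (h : ↥(Subgroup.closure F)) (x : Γ), κ (Subgroup.inclusion hcl h * x) = h * κ x := by
    intro h x
    have := hκ0 ⟨Subgroup.inclusion hcl h, h.2⟩ x
    apply Subtype.ext
    exact congrArg (fun y => ((y : Γ) : GL (Fin d) K)) (congrArg Subtype.val this)
  by_contra hcon
  push Not at hcon
  let F' : Set ↥(Subgroup.closure F) := Subtype.val ⁻¹' F
  obtain ⟨σ, hσ, A, hlt⟩ := hA K' ↥(Subgroup.closure F) F' (hF.preimage Subtype.val_injective.injOn) h1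
    (Subgroup.closure_closure_coe_preimage) φ hφ (fun H hH hs => hns ⟨H, hH, hs⟩) _ (USG.mass_FA κ f hf hz)
  have hb := USG.mass_diff (Equiv.mulLeft ((⟨σ.1, hΓ hσ⟩ : Γ)⁻¹)) f hf (κ ⁻¹' A) ε hε (hcon σ.1 hσ).le
  have hset : (Equiv.mulLeft ((⟨σ.1, hΓ hσ⟩ : Γ)⁻¹)) ⁻¹' (κ ⁻¹' A) = κ ⁻¹' (USG.ltr σ A) := by
    ext x
    have := hκ σ⁻¹ x
    change κ ((⟨σ.1, hΓ hσ⟩ : Γ)⁻¹ * x) ∈ A ↔ σ⁻¹ * κ x ∈ A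
    rw [← this]; rfl
  rw [hset] at hb
  rw [← sub_div, abs_div, abs_of_pos hpos, lt_div_iff₀ hpos] at hlt
  exact absurd hb (not_le.2 hlt)
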